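/- Under the stated hypotheses, the Orbit 4 (L,K,K) three-term relation holds: S(f−a)·A(1−a, e−a, f−a, g−a)·A(1+a−g, 1+b−g, 1+c−g, 1+d−g)·K(a;b,c,d;e,f,g) − S(g−a)·A(f−a, f−b, f−c, f−d)·A(a, 1+a−e, 1+a−f, 1+a−g)·K(e−a; e−b, e−c, e−d; e, 1+e−f, 1+e−g) − B_2(a,b,c,d,e,f,g)·L(a,b,c,d;g;f,e) = 0. -/

import Mathlib

noncomputable section

open Complex

/-- `Sn x = sin (π x)`. -/
def Sn (x : ℂ) : ℂ := Complex.sin ((Real.pi : ℂ) * x)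

/-- The renormalized Saalschützian series
`F*(a,b,c,d;e,f,g) = ∑ₖ Γ(k+a)Γ(k+b)Γ(k+c)Γ(k+d)/(k!·Γ(k+e)Γ(k+f)Γ(k+g))`. -/
def Fstar (a b c d e f g : ℂ) : ℂ :=
  ∑' k : ℕ, (Complex.Gamma (k + a) * Complex.Gamma (k + b) *
      Complex.Gamma (k + c) * Complex.Gamma (k + d)) /
    ((k.factorial : ℂ) * Complex.Gamma (k + e) * Complex.Gamma (k + f) *
      Complex.Gamma (k + g))

/-- The function `K(a;b,c,d;e,f,g)`. -/
def Kf (a b c d e f g : ℂ) : ℂ :=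
  (Fstar a b c d e f g +
      Fstar a (1 + a - e) (1 + a - f) (1 + a - g) (1 + a - b) (1 + a - c) (1 + a - d)) /
    (Sn a * Complex.Gamma a ^ 2 * Complex.Gamma b * Complex.Gamma c * Complex.Gamma d *
      Complex.Gamma (1 + a - e) * Complex.Gamma (1 + a - f) * Complex.Gamma (1 + a - g))

/-- The function `L(a,b,c,d;e;f,g)`. -/
def Lf (a b c d e f g : ℂ) : ℂ :=
  (Fstar a b c d e f g -
      Fstar (1 + a - e) (1 + b - e) (1 + c - e) (1 + d - e) (2 - e) (1 + f - e) (1 + g - e)) /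
    (Sn e * Complex.Gamma a * Complex.Gamma b * Complex.Gamma c * Complex.Gamma d *
      Complex.Gamma (1 + a - e) * Complex.Gamma (1 + b - e) * Complex.Gamma (1 + c - e) *
      Complex.Gamma (1 + d - e))

/-- `A(x,y,z,t) = 1/(Γ(x)Γ(y)Γ(z)Γ(t))`. -/
def Af (x y z t : ℂ) : ℂ :=
  1 / (Complex.Gamma x * Complex.Gamma y * Complex.Gamma z * Complex.Gamma t)

def B1 (a b c d e f g : ℂ) : ℂ :=
  Sn b * Sn c * (Sn (b - a) * Sn (c - a) * Sn d + Sn (e - a) * Sn (f - a) * Sn (g - a)) /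
    (Real.pi : ℂ) ^ 4

def B2 (a b c d e f g : ℂ) : ℂ :=
  Sn (f - a) * Sn (g - a) *
    (Sn (b - a) * Sn (c - a) * Sn (d - a) + Sn (e - 2 * a) * Sn (f - a) * Sn (g - a)) /
    (Real.pi : ℂ) ^ 4

def B3 (a b c d e f g : ℂ) : ℂ :=
  (Sn f * Sn (f - e) * Sn (g - a) * Sn (g - b) * Sn (g - c) * Sn (g - d) -
      Sn g * Sn (g - e) * Sn (f - a) * Sn (f - b) * Sn (f - c) * Sn (f - d)) /
    ((Real.pi : ℂ) ^ 4 * Sn (f - g))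

def B4 (a b c d e f g : ℂ) : ℂ :=
  Sn (f - a) * Sn (g - a) * (Sn b * Sn c * Sn d + Sn (e - a) * Sn f * Sn g) /
    (Real.pi : ℂ) ^ 4

def B5 (a b c d e f g : ℂ) : ℂ :=
  Sn b * Sn (e - b) *
    (Sn (b - a) * Sn (c - a) * Sn (d - a) + Sn (e - 2 * a) * Sn (f - a) * Sn (g - a)) /
    (Real.pi : ℂ) ^ 4

def Cf (a b c d e f g : ℂ) : ℂ :=
  Sn (e - a) * (Sn b * Sn c * Sn d * B2 a b c d e f g +
      Sn e * Sn (f - a) * Sn (g - a) * B4 a b c d e f g) / (Real.pi : ℂ) ^ 4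

section

open Filter Topology

/-- Expansion of `∏ (1 + uᵢ h)` to second order. -/
lemma norm_prod_one_add_mul_sub_le {ι : Type*} (s : Finset ι) (u : ι → ℂ) (h : ℂ) {R : ℝ}
    (hR : 0 ≤ R) (hu : ∀ i ∈ s, ‖u i‖ ≤ R) (hh : ‖h‖ ≤ 1) :
    ‖∏ i ∈ s, (1 + u i * h) - 1 - h * ∑ i ∈ s, u i‖ ≤
      (s.card : ℝ) ^ 2 * (1 + R) ^ (s.card + 1) * ‖h‖ ^ 2 := by
  classical
  induction s using Finset.induction_on with
  | empty => simp
  | insert a s ha ih =>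
    have ih' := ih fun i hi => hu i (Finset.mem_insert_of_mem hi)
    have hua := hu a (Finset.mem_insert_self a s)
    have hsum : ‖∑ i ∈ s, u i‖ ≤ s.card * R := by
      simpa using norm_sum_le_of_le s (f := u) (n := fun _ => R)
        fun i hi => hu i (Finset.mem_insert_of_mem hi)
    rw [Finset.prod_insert ha, Finset.sum_insert ha, Finset.card_insert_of_notMem ha]
    have hid : (1 + u a * h) * ∏ i ∈ s, (1 + u i * h) - 1 - h * (u a + ∑ i ∈ s, u i) =
        (1 + u a * h) * (∏ i ∈ s, (1 + u i * h) - 1 - h * ∑ i ∈ s, u i) +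
          u a * h ^ 2 * ∑ i ∈ s, u i := by ring
    rw [hid]
    have h1 : ‖1 + u a * h‖ ≤ 1 + R := by
      refine (norm_add_le _ _).trans ?_
      rw [norm_one, norm_mul]
      nlinarith [norm_nonneg (u a), norm_nonneg h]
    refine (norm_add_le _ _).trans ?_
    rw [norm_mul, norm_mul, norm_mul, norm_pow]
    have h2 := mul_le_mul h1 ih' (norm_nonneg _) (by linarith)
    have h3 : ‖u a‖ * ‖h‖ ^ 2 * ‖∑ i ∈ s, u i‖ ≤ R * ‖h‖ ^ 2 * (s.card * R) := by gcongr
    have h4 : R * R ≤ (1 + R) ^ (s.card + 2) := by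
      calc R * R ≤ (1 + R) ^ 2 := by nlinarith
        _ ≤ _ := pow_le_pow_right₀ (by linarith) (by omega)
    have h5 : (s.card : ℝ) * (R * R) ≤ s.card * (1 + R) ^ (s.card + 2) := by gcongr
    have h6 : 0 ≤ (1 + R) ^ (s.card + 2) := by positivity
    have hc : (0 : ℝ) ≤ s.card := by positivity
    push_cast
    calc _ ≤ (1 + R) * ((s.card : ℝ) ^ 2 * (1 + R) ^ (s.card + 1) * ‖h‖ ^ 2) +
          R * ‖h‖ ^ 2 * (s.card * R) := add_le_add h2 h3
      _ = ((s.card : ℝ) ^ 2 * (1 + R) ^ (s.card + 2) + s.card * (R * R)) * ‖h‖ ^ 2 := by ring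
      _ ≤ _ := by
        gcongr
        have : s.card + 1 + 1 = s.card + 2 := rfl
        rw [this]
        nlinarith

/-- Two monic products with the same subleading coefficient agree up to a factor
`1 + O(|w|⁻²)`, uniformly in bounded roots. -/
lemma exists_norm_prod_add_le (n : ℕ) (R : ℝ) (hR : 0 ≤ R) :
    ∃ C : ℝ, 0 ≤ C ∧ ∀ u v : Fin n → ℂ, (∀ i, ‖u i‖ ≤ R) → (∀ i, ‖v i‖ ≤ R) →
      ∑ i, u i = ∑ i, v i → ∀ w : ℂ, 2 * R + 1 ≤ ‖w‖ →
      ‖∏ i, (w + u i)‖ ≤ (1 + C / ‖w‖ ^ 2) * ‖∏ i, (w + v i)‖ := by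
  set M : ℝ := (n : ℝ) ^ 2 * (1 + R) ^ (n + 1) with hM
  have hM0 : 0 ≤ M := by positivity
  refine ⟨2 * M * 2 ^ n, by positivity, fun u v hu hv huv w hw => ?_⟩
  have hw1 : 1 ≤ ‖w‖ := by linarith
  have hw0 : w ≠ 0 := by rintro rfl; simp at hw1; linarith
  have hwp : 0 < ‖w‖ := by linarith
  have hh : ‖w⁻¹‖ ≤ 1 := by rw [norm_inv]; exact inv_le_one_of_one_le₀ hw1
  have fac : ∀ x : Fin n → ℂ, ∏ i, (w + x i) = w ^ n * ∏ i, (1 + x i * w⁻¹) := by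
    intro x
    have : ∀ i, w + x i = w * (1 + x i * w⁻¹) := fun i => by field_simp
    simp_rw [this, Finset.prod_mul_distrib]
    simp
  have bu := norm_prod_one_add_mul_sub_le Finset.univ u w⁻¹ hR (fun i _ => hu i) hh
  have bv := norm_prod_one_add_mul_sub_le Finset.univ v w⁻¹ hR (fun i _ => hv i) hh
  rw [Finset.card_univ, Fintype.card_fin, ← hM] at bu bv
  rw [huv] at bu
  have bd : ‖∏ i, (1 + u i * w⁻¹) - ∏ i, (1 + v i * w⁻¹)‖ ≤ 2 * M * ‖w⁻¹‖ ^ 2 := by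
    have := (norm_sub_le (∏ i, (1 + u i * w⁻¹) - 1 - w⁻¹ * ∑ i, v i)
      (∏ i, (1 + v i * w⁻¹) - 1 - w⁻¹ * ∑ i, v i)).trans (add_le_add bu bv)
    calc _ = _ := by congr 1; ring
      _ ≤ _ := this
      _ = _ := by ring
  have lowv : (1 / 2 : ℝ) ^ n ≤ ‖∏ i, (1 + v i * w⁻¹)‖ := by
    rw [norm_prod]
    calc (1 / 2 : ℝ) ^ n = ∏ _i : Fin n, (1 / 2 : ℝ) := by simp
      _ ≤ _ := by
        refine Finset.prod_le_prod (fun _ _ => by norm_num) fun i _ => ?_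
        have h1 : ‖v i * w⁻¹‖ ≤ 1 / 2 := by
          rw [norm_mul, norm_inv, ← div_eq_mul_inv, div_le_iff₀ hwp]
          linarith [hv i]
        have h2 := norm_sub_norm_le (1 : ℂ) (-(v i * w⁻¹))
        rw [norm_neg, sub_neg_eq_add, norm_one] at h2
        linarith
  rw [fac u, fac v, norm_mul, norm_mul, mul_left_comm]
  gcongr
  have h3 : ‖∏ i, (1 + u i * w⁻¹)‖ ≤ ‖∏ i, (1 + v i * w⁻¹)‖ + 2 * M * ‖w⁻¹‖ ^ 2 := by
    have := norm_le_norm_add_norm_sub' (∏ i, (1 + u i * w⁻¹)) (∏ i, (1 + v i * w⁻¹))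
    linarith
  have h2 : (2 : ℝ) ^ n * (1 / 2) ^ n = 1 := by rw [← mul_pow]; norm_num
  have h4 : 2 * M * ‖w⁻¹‖ ^ 2 = 2 * M * 2 ^ n / ‖w‖ ^ 2 * (1 / 2) ^ n := by
    rw [norm_inv, inv_pow]
    linear_combination (-2 * M * (‖w‖ ^ 2)⁻¹) * h2
  have h5 : 2 * M * 2 ^ n / ‖w‖ ^ 2 * (1 / 2) ^ n ≤
      2 * M * 2 ^ n / ‖w‖ ^ 2 * ‖∏ i, (1 + v i * w⁻¹)‖ := by gcongr
  linarith

/-- `Γ(z + n + 1) / (n! n ^ z) → 1`. -/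
lemma tendsto_Gamma_add_nat_div (z : ℂ) (hz : ∀ m : ℕ, z ≠ -m) :
    Tendsto (fun n : ℕ => Complex.Gamma (n + 1 + z) / (n.factorial * (n : ℂ) ^ z))
      atTop (𝓝 1) := by
  have h0 : Complex.Gamma z ≠ 0 := Complex.Gamma_ne_zero hz
  have h1 := (tendsto_const_nhds (x := Complex.Gamma z)).div
    (Complex.GammaSeq_tendsto_Gamma z) h0
  rw [div_self h0] at h1
  refine h1.congr' ?_
  filter_upwards with n
  have key : ∀ n : ℕ, Complex.Gamma (n + z) = Complex.Gamma z * ∏ j ∈ Finset.range n, (z + j) := by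
    intro n
    induction n with
    | zero => simp
    | succ n ih =>
      rw [Finset.prod_range_succ, ← mul_assoc, ← ih]
      have : ((n + 1 : ℕ) : ℂ) + z = (n + z) + 1 := by push_cast; ring
      rw [this, Complex.Gamma_add_one _ (fun h => hz n (by linear_combination h))]
      ring
  have := key (n + 1)
  push_cast at this
  rw [Pi.div_apply, this, Complex.GammaSeq, div_div_eq_mul_div]
  rw [mul_comm ((n : ℂ) ^ z)]

/-- A balanced quotient of Gamma functions tends to one along the positive integers. -/
lemma tendsto_Gamma_quot {N : ℕ} (u v : Fin N → ℂ) (huv : ∑ i, u i = ∑ i, v i)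
    (hu : ∀ i, ∀ m : ℕ, u i ≠ -m) (hv : ∀ i, ∀ m : ℕ, v i ≠ -m) :
    Tendsto (fun n : ℕ => (∏ i, Complex.Gamma (n + 1 + u i)) / ∏ i, Complex.Gamma (n + 1 + v i))
      atTop (𝓝 1) := by
  have h1 := tendsto_finsetProd (Finset.univ : Finset (Fin N))
    fun i _ => tendsto_Gamma_add_nat_div (u i) (hu i)
  have h2 := tendsto_finsetProd (Finset.univ : Finset (Fin N))
    fun i _ => tendsto_Gamma_add_nat_div (v i) (hv i)
  have h3 := h1.div h2 (by simp)
  simp only [Finset.prod_const_one, div_one] at h3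
  refine h3.congr' ?_
  filter_upwards [eventually_ge_atTop 1] with n hn
  have hn0 : (n : ℂ) ≠ 0 := by exact_mod_cast (by omega : n ≠ 0)
  have hf : (n.factorial : ℂ) ≠ 0 := by exact_mod_cast n.factorial_ne_zero
  simp only [Pi.div_apply, Finset.prod_div_distrib, Finset.prod_mul_distrib]
  have e : ∏ i, (n : ℂ) ^ u i = ∏ i, (n : ℂ) ^ v i := by
    have : ∀ x : Fin N → ℂ, ∏ i, (n : ℂ) ^ x i = (n : ℂ) ^ (∑ i, x i) := by
      intro x
      simp only [Complex.cpow_def_of_ne_zero hn0, ← Complex.exp_sum, Finset.mul_sum]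
    rw [this, this, huv]
  rw [e, div_div_div_cancel_right₀]
  refine mul_ne_zero (Finset.prod_ne_zero_iff.2 fun i _ => hf)
    (Finset.prod_ne_zero_iff.2 fun i _ => ?_)
  simp [Complex.cpow_eq_zero_iff, hn0]

lemma norm_sq_add_sq_le {w : ℂ} (hw : 0 ≤ w.re) (k : ℕ) :
    ‖w‖ ^ 2 + (k : ℝ) ^ 2 ≤ ‖w + k‖ ^ 2 := by
  rw [← Complex.normSq_eq_norm_sq, ← Complex.normSq_eq_norm_sq, Complex.normSq_apply,
    Complex.normSq_apply]
  simp only [Complex.add_re, Complex.add_im, Complex.natCast_re, Complex.natCast_im]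
  have : (0 : ℝ) ≤ k := by positivity
  nlinarith [mul_nonneg hw this]

lemma norm_le_norm_add_natCast {w : ℂ} (hw : 0 ≤ w.re) (k : ℕ) : ‖w‖ ≤ ‖w + k‖ := by
  have := norm_sq_add_sq_le hw k
  exact (sq_le_sq₀ (norm_nonneg _) (norm_nonneg _)).1 (by nlinarith [sq_nonneg (k : ℝ)])

/-- A balanced quotient of Gamma functions is bounded in the right half-plane away from
the origin. -/
lemma exists_norm_prod_Gamma_le (N : ℕ) (R : ℝ) (hR : 0 ≤ R) :
    ∃ C : ℝ, 0 ≤ C ∧ ∀ u v : Fin N → ℂ, (∀ i, ‖u i‖ ≤ R) → (∀ i, ‖v i‖ ≤ R) →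
      ∑ i, u i = ∑ i, v i → ∀ w : ℂ, 0 ≤ w.re → 2 * R + 1 ≤ ‖w‖ →
      ‖∏ i, Complex.Gamma (w + u i)‖ ≤ C * ‖∏ i, Complex.Gamma (w + v i)‖ := by
  obtain ⟨C, hC0, hC⟩ := exists_norm_prod_add_le N R hR
  have hsum : Summable fun k : ℕ => C / ((k : ℝ) ^ 2 + 1) := by
    refine Summable.of_nonneg_of_le (fun k => by positivity) (fun k => ?_)
      ((Real.summable_one_div_nat_pow.2 (by norm_num : 1 < 2)).mul_left C |>.add
        (summable_of_hasFiniteSupport (f := fun k : ℕ => if k = 0 then C else 0)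
          ((Set.finite_singleton 0).subset fun k hk => by
            by_contra h; simp [Set.mem_singleton_iff.not.1 h] at hk)))
    rcases Nat.eq_zero_or_pos k with rfl | hk
    · simp
    · rw [if_neg hk.ne', add_zero, mul_one_div]
      have : (0 : ℝ) < k := by exact_mod_cast hk
      gcongr
      linarith
  set S := ∑' k : ℕ, C / ((k : ℝ) ^ 2 + 1) with hS
  refine ⟨Real.exp S, (Real.exp_pos _).le, fun u v hu hv huv w hw hwn => ?_⟩
  have hnk := norm_sq_add_sq_le hw
  have hnk1 := norm_le_norm_add_natCast hw
  have hpole : ∀ x : ℂ, ‖x‖ ≤ R → ∀ m : ℕ, w + x ≠ -m := by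
    intro x hx m h
    have h1 : w + m = -x := by linear_combination h
    have h2 := hnk1 m
    rw [h1, norm_neg] at h2
    linarith
  have hG : ∀ x : ℂ, ‖x‖ ≤ R → ∀ k : ℕ, Complex.Gamma (w + k + x) ≠ 0 := by
    intro x hx k
    refine Complex.Gamma_ne_zero fun m h => hpole x hx (m + k) ?_
    push_cast
    linear_combination h
  have hA : ∀ x : ℂ, ‖x‖ ≤ R → ∀ k : ℕ, w + k + x ≠ 0 := by
    intro x hx k h
    exact hpole x hx k (by linear_combination h)
  set r : ℕ → ℂ := fun k =>
    (∏ i, Complex.Gamma (w + k + u i)) / ∏ i, Complex.Gamma (w + k + v i) with hr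
  have hstep : ∀ (x : Fin N → ℂ), (∀ i, ‖x i‖ ≤ R) → ∀ k : ℕ,
      ∏ i, Complex.Gamma (w + (k + 1 : ℕ) + x i) =
        (∏ i, (w + k + x i)) * ∏ i, Complex.Gamma (w + k + x i) := by
    intro x hx k
    rw [← Finset.prod_mul_distrib]
    refine Finset.prod_congr rfl fun i _ => ?_
    rw [← Complex.Gamma_add_one _ (hA _ (hx i) k)]
    congr 1
    push_cast
    ring
  have hrec : ∀ k, ‖r k‖ ≤ Real.exp (C / ((k : ℝ) ^ 2 + 1)) * ‖r (k + 1)‖ := by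
    intro k
    have h1 := hC v u hv hu huv.symm (w + k) (hwn.trans (hnk1 k))
    have hu0 : ∏ i, (w + k + u i) ≠ 0 := Finset.prod_ne_zero_iff.2 fun i _ => hA _ (hu i) k
    have hv0 : ∏ i, (w + k + v i) ≠ 0 := Finset.prod_ne_zero_iff.2 fun i _ => hA _ (hv i) k
    have hgv : ∏ i, Complex.Gamma (w + k + v i) ≠ 0 :=
      Finset.prod_ne_zero_iff.2 fun i _ => hG _ (hv i) k
    have h2 : r k * ∏ i, (w + k + u i) = r (k + 1) * ∏ i, (w + k + v i) := by
      simp only [hr]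
      rw [hstep u hu, hstep v hv]
      field_simp
    have h3 : ‖r k‖ * ‖∏ i, (w + k + u i)‖ ≤
        ((1 + C / ‖w + k‖ ^ 2) * ‖r (k + 1)‖) * ‖∏ i, (w + k + u i)‖ := by
      rw [← norm_mul, h2, norm_mul]
      calc _ ≤ ‖r (k + 1)‖ * ((1 + C / ‖w + k‖ ^ 2) * ‖∏ i, (w + k + u i)‖) := by gcongr
        _ = _ := by ring
    have h4 := le_of_mul_le_mul_right h3 (norm_pos_iff.2 hu0)
    refine h4.trans ?_
    gcongr
    have h5 : C / ‖w + k‖ ^ 2 ≤ C / ((k : ℝ) ^ 2 + 1) := by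
      gcongr
      have := hnk k
      have h1 : 1 ≤ ‖w‖ := by linarith
      nlinarith
    linarith [Real.add_one_le_exp (C / ((k : ℝ) ^ 2 + 1))]
  have hind : ∀ n : ℕ, ‖r 0‖ ≤
      Real.exp (∑ k ∈ Finset.range n, C / ((k : ℝ) ^ 2 + 1)) * ‖r n‖ := by
    intro n
    induction n with
    | zero => simp
    | succ n ih =>
      rw [Finset.sum_range_succ, Real.exp_add, mul_assoc]
      exact ih.trans (by gcongr; exact hrec n)
  have hlim : Tendsto (fun n => ‖r (n + 1)‖) atTop (𝓝 1) := by
    have := tendsto_Gamma_quot (fun i => w + u i) (fun i => w + v i)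
      (by simp [Finset.sum_add_distrib, huv]) (fun i => hpole _ (hu i)) (fun i => hpole _ (hv i))
    rw [← norm_one (α := ℂ)]
    refine (this.norm).congr fun n => ?_
    simp only [hr]
    congr 2 <;>
    · refine Finset.prod_congr rfl fun i _ => ?_
      congr 1
      push_cast
      ring
  have hfin : ‖r 0‖ ≤ Real.exp S := by
    have h1 : Tendsto (fun n => Real.exp S * ‖r (n + 1)‖) atTop (𝓝 (Real.exp S * 1)) :=
      hlim.const_mul _
    rw [mul_one] at h1
    refine ge_of_tendsto' h1 fun n => (hind (n + 1)).trans ?_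
    gcongr
    exact hsum.sum_le_tsum _ fun k _ => by positivity
  have hgv : ∏ i, Complex.Gamma (w + v i) ≠ 0 := by
    refine Finset.prod_ne_zero_iff.2 fun i _ => ?_
    simpa using hG _ (hv i) 0
  simp only [hr, Nat.cast_zero, add_zero] at hfin
  rwa [norm_div, div_le_iff₀ (norm_pos_iff.2 hgv)] at hfin

lemma norm_sin_pi_mul_le (z : ℂ) : ‖Complex.sin (Real.pi * z)‖ ≤ Real.exp (Real.pi * |z.im|) := by
  have h1 : ‖Complex.exp (-(Real.pi * z) * Complex.I)‖ ≤ Real.exp (Real.pi * |z.im|) := by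
    rw [Complex.norm_exp]
    simp
    gcongr
    exact le_abs_self _
  have h2 : ‖Complex.exp (Real.pi * z * Complex.I)‖ ≤ Real.exp (Real.pi * |z.im|) := by
    rw [Complex.norm_exp]
    simp
    nlinarith [neg_abs_le z.im, Real.pi_pos]
  rw [Complex.sin, norm_div, norm_mul, Complex.norm_I, mul_one, Complex.norm_ofNat]
  have := norm_sub_le (Complex.exp (-(Real.pi * z) * Complex.I))
    (Complex.exp (Real.pi * z * Complex.I))
  linarith

/-- `1 / (Γ(z) Γ(1 - z)) = sin (π z) / π`. -/
lemma inv_Gamma_mul_inv_Gamma_one_sub (z : ℂ) :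
    (Complex.Gamma z)⁻¹ * (Complex.Gamma (1 - z))⁻¹ = Complex.sin (Real.pi * z) / Real.pi := by
  rw [← mul_inv, Complex.Gamma_mul_Gamma_one_sub, inv_div]

/-- The summand of the bilateral series, made entire by multiplication with sines. -/
noncomputable def psi (x y : Fin 4 → ℂ) (t : ℂ) : ℂ :=
  (∏ i, (Complex.Gamma (1 - x i - t))⁻¹) * ∏ i, (Complex.Gamma (y i + t))⁻¹

lemma differentiable_psi (x y : Fin 4 → ℂ) : Differentiable ℂ (psi x y) := by
  have h := Complex.differentiable_one_div_Gamma
  unfold psi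
  refine Differentiable.mul ?_ ?_
  · exact Differentiable.fun_finsetProd fun i _ =>
      h.comp ((differentiable_const (1 - x i)).sub differentiable_id)
  · exact Differentiable.fun_finsetProd fun i _ =>
      h.comp ((differentiable_const (y i)).add differentiable_id)

lemma psi_neg (x y : Fin 4 → ℂ) (t : ℂ) :
    psi x y (-t) = psi (fun i => 1 - y i) (fun i => 1 - x i) t := by
  unfold psi
  rw [mul_comm]
  congr 1 <;> refine Finset.prod_congr rfl fun i _ => ?_ <;> congr 2 <;> ring

lemma exists_norm_psi_le_of_re_nonneg (x y : Fin 4 → ℂ) (hxy : ∑ i, y i = ∑ i, x i + 2) :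
    ∃ C Y : ℝ, 0 ≤ C ∧ ∀ t : ℂ, 0 ≤ t.re → Y ≤ ‖t‖ →
      ‖psi x y t‖ * ‖t‖ ^ 2 ≤ C * Real.exp (4 * Real.pi * |t.im|) := by
  set R : ℝ := 2 + ∑ i, ‖x i‖ + ∑ i, ‖y i‖ with hRdef
  have hsx : 0 ≤ ∑ i, ‖x i‖ := Finset.sum_nonneg fun _ _ => norm_nonneg _
  have hsy : 0 ≤ ∑ i, ‖y i‖ := Finset.sum_nonneg fun _ _ => norm_nonneg _
  have hx : ∀ i, ‖x i‖ ≤ R := fun i => by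
    have := Finset.single_le_sum (f := fun i => ‖x i‖) (fun _ _ => norm_nonneg _)
      (Finset.mem_univ i)
    linarith
  have hy : ∀ i, ‖y i‖ ≤ R := fun i => by
    have := Finset.single_le_sum (f := fun i => ‖y i‖) (fun _ _ => norm_nonneg _)
      (Finset.mem_univ i)
    linarith
  have hR : 0 ≤ R := by linarith
  obtain ⟨C, hC0, hC⟩ := exists_norm_prod_Gamma_le 5 R hR
  refine ⟨C * ∏ i, Real.exp (Real.pi * |(x i).im|), 2 * R + 1,
    mul_nonneg hC0 (Finset.prod_nonneg fun _ _ => (Real.exp_pos _).le), fun t ht htn => ?_⟩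
  have ht1 : 1 ≤ ‖t‖ := by linarith
  have ht0 : t ≠ 0 := by rintro rfl; simp at ht1; linarith
  have ht10 : t + 1 ≠ 0 := by
    intro h
    have := congrArg Complex.re h
    simp at this
    linarith
  have key := hC (Fin.cons 2 x) (Fin.cons 0 y)
    (Fin.cases (by simp only [Fin.cons_zero, Complex.norm_ofNat]; linarith) hx)
    (Fin.cases (by simpa using hR) hy)
    (by
      refine (Fin.sum_univ_succ _).trans (Eq.trans ?_ (Fin.sum_univ_succ _).symm)
      simp only [Fin.cons_zero, Fin.cons_succ, hxy]
      ring) t ht htn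
  have hcons : ∀ (z : ℂ) (x : Fin 4 → ℂ),
      ∏ i, Complex.Gamma (t + (Fin.cons z x : Fin 5 → ℂ) i) =
        (∏ i, Complex.Gamma (t + x i)) * Complex.Gamma (t + z) := fun z x =>
    (Fin.prod_univ_succ _).trans (mul_comm _ _)
  rw [hcons, hcons, add_zero] at key
  have hG2 : Complex.Gamma (t + 2) = (t + 1) * (t * Complex.Gamma t) := by
    rw [← Complex.Gamma_add_one t ht0, ← Complex.Gamma_add_one _ ht10]
    congr 1
    ring
  have hGt : Complex.Gamma t ≠ 0 := Complex.Gamma_ne_zero fun m h => by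
    have h1 := congrArg Complex.re h
    have h2 := congrArg Complex.im h
    simp at h1 h2
    have h3 : t.re = 0 := by
      have : (0 : ℝ) ≤ m := by positivity
      linarith
    exact ht0 (Complex.ext h3 h2)
  have hGy : ∏ i, Complex.Gamma (t + y i) ≠ 0 := by
    refine Finset.prod_ne_zero_iff.2 fun i _ => Complex.Gamma_ne_zero fun m h => ?_
    have h1 : t + m = -y i := by linear_combination h
    have h2 := norm_le_norm_add_natCast ht m
    rw [h1, norm_neg] at h2
    linarith [hy i]
  rw [hG2, norm_mul, norm_mul, norm_mul, norm_mul, ← mul_assoc, ← mul_assoc, ← mul_assoc] at key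
  have key2 := le_of_mul_le_mul_right key (norm_pos_iff.2 hGt)
  have hpsi : psi x y t * ∏ i, Complex.Gamma (t + y i) =
      (∏ i, Complex.Gamma (t + x i)) * ∏ i, (Complex.sin (Real.pi * (t + x i)) / Real.pi) := by
    have hGx : ∏ i, Complex.Gamma (t + x i) ≠ 0 := by
      refine Finset.prod_ne_zero_iff.2 fun i _ => Complex.Gamma_ne_zero fun m h => ?_
      have h1 : t + m = -x i := by linear_combination h
      have h2 := norm_le_norm_add_natCast ht m
      rw [h1, norm_neg] at h2
      linarith [hx i]
    simp_rw [← inv_Gamma_mul_inv_Gamma_one_sub, Finset.prod_mul_distrib]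
    rw [← mul_assoc, Finset.prod_inv_distrib, mul_inv_cancel₀ hGx, one_mul, psi]
    have e : ∀ i, y i + t = t + y i := fun i => add_comm _ _
    have e' : ∀ i, 1 - (t + x i) = 1 - x i - t := fun i => by ring
    simp_rw [e, e']
    rw [Finset.prod_inv_distrib, Finset.prod_inv_distrib, mul_assoc, inv_mul_cancel₀ hGy, mul_one]
  have hsin : ‖∏ i, (Complex.sin (Real.pi * (t + x i)) / Real.pi)‖ ≤
      (∏ i, Real.exp (Real.pi * |(x i).im|)) * Real.exp (4 * Real.pi * |t.im|) := by
    have e4 : Real.exp (4 * Real.pi * |t.im|) = ∏ _i : Fin 4, Real.exp (Real.pi * |t.im|) := by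
      rw [Finset.prod_const, Finset.card_univ, Fintype.card_fin, ← Real.exp_nat_mul]
      congr 1
      push_cast
      ring
    rw [e4, ← Finset.prod_mul_distrib, norm_prod]
    refine Finset.prod_le_prod (fun _ _ => norm_nonneg _) fun i _ => ?_
    rw [norm_div, Complex.norm_real, Real.norm_of_nonneg Real.pi_pos.le, ← Real.exp_add]
    refine (div_le_self (norm_nonneg _) (by linarith [Real.pi_gt_three])).trans
      ((norm_sin_pi_mul_le _).trans (Real.exp_le_exp.2 ?_))
    rw [Complex.add_im, ← mul_add, add_comm |(x i).im|]
    gcongr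
    exact abs_add_le _ _
  have ht2 : ‖t‖ ^ 2 ≤ ‖t + 1‖ * ‖t‖ := by
    have : ‖t‖ ≤ ‖t + 1‖ := by simpa using norm_le_norm_add_natCast ht 1
    nlinarith [norm_nonneg t]
  have hP := norm_pos_iff.2 hGy
  refine le_of_mul_le_mul_right ?_ hP
  calc ‖psi x y t‖ * ‖t‖ ^ 2 * ‖∏ i, Complex.Gamma (t + y i)‖
      = ‖psi x y t * ∏ i, Complex.Gamma (t + y i)‖ * ‖t‖ ^ 2 := by rw [norm_mul]; ring
    _ ≤ ‖psi x y t * ∏ i, Complex.Gamma (t + y i)‖ * (‖t + 1‖ * ‖t‖) := by gcongr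
    _ = (‖∏ i, Complex.Gamma (t + x i)‖ * ‖t + 1‖ * ‖t‖) *
        ‖∏ i, (Complex.sin (Real.pi * (t + x i)) / Real.pi)‖ := by
        rw [hpsi, norm_mul]; ring
    _ ≤ (C * ‖∏ i, Complex.Gamma (t + y i)‖) *
        ((∏ i, Real.exp (Real.pi * |(x i).im|)) * Real.exp (4 * Real.pi * |t.im|)) := by
        gcongr
    _ = _ := by ring

lemma exists_norm_psi_le (x y : Fin 4 → ℂ) (hxy : ∑ i, y i = ∑ i, x i + 2) :
    ∃ C : ℝ, 0 ≤ C ∧ ∀ t : ℂ,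
      ‖psi x y t‖ ≤ C * Real.exp (4 * Real.pi * |t.im|) / (1 + ‖t‖ ^ 2) := by
  obtain ⟨C₁, Y₁, hC₁, h₁⟩ := exists_norm_psi_le_of_re_nonneg x y hxy
  obtain ⟨C₂, Y₂, hC₂, h₂⟩ := exists_norm_psi_le_of_re_nonneg (fun i => 1 - y i)
    (fun i => 1 - x i) (by simp only [Finset.sum_sub_distrib, hxy]; simp; ring)
  set Y := max 1 (max Y₁ Y₂) with hY
  obtain ⟨C₀, hC₀⟩ := (isCompact_closedBall (0 : ℂ) Y).exists_bound_of_continuousOn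
    (differentiable_psi x y).continuous.continuousOn
  have hC₀' : 0 ≤ C₀ := (norm_nonneg _).trans
    (hC₀ 0 (Metric.mem_closedBall_self ((zero_le_one).trans (le_max_left _ _))))
  refine ⟨max (2 * max C₁ C₂) (C₀ * (1 + Y ^ 2)), le_max_of_le_right (by positivity), fun t => ?_⟩
  rw [le_div_iff₀ (by positivity)]
  have hexp : 1 ≤ Real.exp (4 * Real.pi * |t.im|) := Real.one_le_exp (by positivity)
  rcases le_or_gt ‖t‖ Y with h | h
  · have hb := hC₀ t (by simpa using h)
    calc ‖psi x y t‖ * (1 + ‖t‖ ^ 2) ≤ C₀ * (1 + Y ^ 2) := by gcongr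
      _ ≤ C₀ * (1 + Y ^ 2) * Real.exp (4 * Real.pi * |t.im|) :=
        le_mul_of_one_le_right (by positivity) hexp
      _ ≤ _ := by gcongr; exact le_max_right _ _
  · have ht1 : 1 < ‖t‖ := (le_max_left _ _).trans_lt h
    have hY1 : Y₁ ≤ ‖t‖ := ((le_max_left _ _).trans (le_max_right _ _)).trans h.le
    have hY2 : Y₂ ≤ ‖t‖ := ((le_max_right _ _).trans (le_max_right _ _)).trans h.le
    have hmain : ‖psi x y t‖ * ‖t‖ ^ 2 ≤ max C₁ C₂ * Real.exp (4 * Real.pi * |t.im|) := by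
      rcases le_total 0 t.re with hre | hre
      · refine (h₁ t hre hY1).trans ?_
        gcongr
        exact le_max_left _ _
      · have := h₂ (-t) (by simpa using hre) (by simpa using hY2)
        rw [← psi_neg, neg_neg, norm_neg, Complex.neg_im, abs_neg] at this
        refine this.trans ?_
        gcongr
        exact le_max_right _ _
    calc ‖psi x y t‖ * (1 + ‖t‖ ^ 2) ≤ 2 * (‖psi x y t‖ * ‖t‖ ^ 2) := by
          have : 1 ≤ ‖t‖ ^ 2 := one_le_pow₀ ht1.le
          nlinarith [norm_nonneg (psi x y t)]
      _ ≤ 2 * (max C₁ C₂ * Real.exp (4 * Real.pi * |t.im|)) := by gcongr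
      _ = 2 * max C₁ C₂ * Real.exp (4 * Real.pi * |t.im|) := by ring
      _ ≤ _ := by gcongr; exact le_max_left _ _

/-- An entire one-periodic function of growth `o(exp (4π |Im t|))` is a trigonometric polynomial
of degree at most one. -/
lemma exists_trig_poly_of_periodic {f : ℂ → ℂ} (hf : Differentiable ℂ f)
    (hper : Function.Periodic f 1)
    (hgrowth : ∀ ε : ℝ, 0 < ε → ∃ Y : ℝ, ∀ t : ℂ, Y ≤ |t.im| →
      ‖f t‖ ≤ ε * Real.exp (4 * Real.pi * |t.im|)) :
    ∃ α β γ : ℂ, ∀ t : ℂ, f t = α * Complex.exp (-(2 * Real.pi * Complex.I * t)) + β +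
      γ * Complex.exp (2 * Real.pi * Complex.I * t) := by
  have hper' : Function.Periodic f ((1 : ℝ) : ℂ) := by simpa using hper
  set h := Function.Periodic.cuspFunction 1 f with hh
  set G : ℂ → ℂ := fun q => q ^ 2 * h q with hG
  have hsurj : ∀ q : ℂ, q ≠ 0 → ∃ t, Function.Periodic.qParam 1 t = q := fun q hq =>
    ⟨_, Function.Periodic.qParam_right_inv one_ne_zero hq⟩
  have hGq : ∀ t, G (Function.Periodic.qParam 1 t) = Function.Periodic.qParam 1 t ^ 2 * f t := by
    intro t
    simp only [hG, hh]
    rw [Function.Periodic.eq_cuspFunction one_ne_zero hper']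
  have hnorm : ∀ t, ‖Function.Periodic.qParam 1 t‖ = Real.exp (-2 * Real.pi * t.im) := by
    intro t
    rw [Function.Periodic.norm_qParam, div_one]
  have hpi := Real.pi_pos
  have hG0 : G 0 = 0 := by simp [hG]
  have hsmall : ∀ ε : ℝ, 0 < ε → ∃ δ : ℝ, 0 < δ ∧ ∀ q, ‖q‖ ≤ δ → ‖G q‖ ≤ ε := by
    intro ε hε
    obtain ⟨Y, hY⟩ := hgrowth ε hε
    refine ⟨Real.exp (-2 * Real.pi * max Y 0), Real.exp_pos _, fun q hq => ?_⟩
    rcases eq_or_ne q 0 with rfl | hq0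
    · simpa [hG0] using hε.le
    obtain ⟨t, rfl⟩ := hsurj q hq0
    rw [hnorm, Real.exp_le_exp] at hq
    have ht : max Y 0 ≤ t.im := by nlinarith
    have ht0 : 0 ≤ t.im := (le_max_right _ _).trans ht
    rw [hGq, norm_mul, norm_pow, hnorm]
    have := hY t (((le_max_left _ _).trans ht).trans (le_abs_self _))
    rw [abs_of_nonneg ht0] at this
    calc _ ≤ Real.exp (-2 * Real.pi * t.im) ^ 2 * (ε * Real.exp (4 * Real.pi * t.im)) := by gcongr
      _ = ε * (Real.exp (-2 * Real.pi * t.im) ^ 2 * Real.exp (4 * Real.pi * t.im)) := by ring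
      _ = ε := by
        rw [← Real.exp_nat_mul, ← Real.exp_add]
        have : ((2 : ℕ) : ℝ) * (-2 * Real.pi * t.im) + 4 * Real.pi * t.im = 0 := by
          push_cast; ring
        rw [this, Real.exp_zero, mul_one]
  have hlarge : ∀ ε : ℝ, 0 < ε → ∃ ρ : ℝ, 0 < ρ ∧ ∀ q, ρ ≤ ‖q‖ → ‖G q‖ ≤ ε * ‖q‖ ^ 4 := by
    intro ε hε
    obtain ⟨Y, hY⟩ := hgrowth ε hε
    refine ⟨Real.exp (2 * Real.pi * max Y 0), Real.exp_pos _, fun q hq => ?_⟩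
    have hq0 : q ≠ 0 := by
      rintro rfl
      rw [norm_zero] at hq
      exact absurd (Real.exp_pos _) (not_lt.2 hq)
    obtain ⟨t, rfl⟩ := hsurj q hq0
    rw [hnorm, Real.exp_le_exp] at hq
    have ht : max Y 0 ≤ -t.im := by nlinarith
    have ht0 : t.im ≤ 0 := by linarith [(le_max_right Y 0).trans ht]
    rw [hGq, norm_mul, norm_pow, hnorm]
    have := hY t (((le_max_left _ _).trans ht).trans (neg_le_abs _))
    rw [abs_of_nonpos ht0] at this
    calc _ ≤ Real.exp (-2 * Real.pi * t.im) ^ 2 * (ε * Real.exp (4 * Real.pi * -t.im)) := by gcongr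
      _ = ε * (Real.exp (-2 * Real.pi * t.im) ^ 2 * Real.exp (4 * Real.pi * -t.im)) := by ring
      _ = _ := by
        rw [← Real.exp_nat_mul, ← Real.exp_nat_mul, ← Real.exp_add]
        congr 2
        push_cast; ring
  have hGd : Differentiable ℂ G := by
    have hoff : DifferentiableOn ℂ G (Set.univ \ {0}) := by
      intro q hq
      have hq0 : q ≠ 0 := by simpa using hq
      obtain ⟨t, rfl⟩ := hsurj q hq0
      have := Function.Periodic.differentiableAt_cuspFunction one_ne_zero hper' (hf t)
      exact ((differentiableAt_id.pow 2).mul this).differentiableWithinAt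
    have hcont : ContinuousAt G 0 := by
      rw [Metric.continuousAt_iff]
      intro ε hε
      obtain ⟨δ, hδ, H⟩ := hsmall (ε / 2) (by linarith)
      refine ⟨δ, hδ, fun {q} hq => ?_⟩
      rw [dist_zero_right] at hq
      rw [hG0, dist_zero_right]
      linarith [H q hq.le]
    exact differentiableOn_univ.1
      ((Complex.differentiableOn_compl_singleton_and_continuousAt_iff univ_mem).1 ⟨hoff, hcont⟩)
  have hder : ∀ n : ℕ, 4 ≤ n → iteratedDeriv n G 0 = 0 := by
    intro n hn
    by_contra hne
    have hpos : 0 < ‖iteratedDeriv n G 0‖ := norm_pos_iff.2 hne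
    have hfac : (0 : ℝ) < n.factorial := by exact_mod_cast n.factorial_pos
    obtain ⟨ρ, hρ, H⟩ := hlarge (‖iteratedDeriv n G 0‖ / (2 * n.factorial)) (by positivity)
    set r := max ρ 1
    have hr1 : 1 ≤ r := le_max_right _ _
    have hr0 : 0 < r := by linarith
    have hb := Complex.norm_iteratedDeriv_le_of_forall_mem_sphere_norm_le (c := 0) (R := r) n
      hr0 hGd.diffContOnCl fun z hz => by
        have hz' : ‖z‖ = r := by simpa using hz
        have := H z (by rw [hz']; exact le_max_left _ _)
        rwa [hz'] at this
    have h2 : (n.factorial : ℝ) * (‖iteratedDeriv n G 0‖ / (2 * n.factorial) * r ^ 4) / r ^ n ≤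
        ‖iteratedDeriv n G 0‖ / 2 := by
      rw [div_le_iff₀ (by positivity)]
      have h3 : r ^ 4 ≤ r ^ n := pow_le_pow_right₀ hr1 hn
      calc _ = ‖iteratedDeriv n G 0‖ / 2 * r ^ 4 := by field_simp
        _ ≤ _ := by gcongr
    linarith
  have hpoly : ∀ q, G q = iteratedDeriv 1 G 0 * q + iteratedDeriv 2 G 0 / 2 * q ^ 2 +
      iteratedDeriv 3 G 0 / 6 * q ^ 3 := by
    intro q
    rw [← Complex.taylorSeries_eq_of_entire' 0 q hGd, tsum_eq_sum (s := Finset.range 4)]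
    · simp [Finset.sum_range_succ, hG0, Nat.factorial]
      ring
    · intro n hn
      rw [hder n (by simpa using hn)]
      simp
  refine ⟨iteratedDeriv 1 G 0, iteratedDeriv 2 G 0 / 2, iteratedDeriv 3 G 0 / 6, fun t => ?_⟩
  have h1 := hGq t
  have hq : Function.Periodic.qParam 1 t = Complex.exp (2 * Real.pi * Complex.I * t) := by
    simp [Function.Periodic.qParam]
  rw [hpoly, hq] at h1
  have hE := Complex.exp_ne_zero (2 * Real.pi * Complex.I * t)
  rw [Complex.exp_neg]
  field_simp
  apply mul_left_cancel₀ hE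
  linear_combination -12 * h1

/-- Values of a trigonometric polynomial of degree one at four points are linearly dependent. -/
lemma trig_poly_four_points {f : ℂ → ℂ} {α β γ : ℂ}
    (hf : ∀ t : ℂ, f t = α * Complex.exp (-(2 * Real.pi * Complex.I * t)) + β +
      γ * Complex.exp (2 * Real.pi * Complex.I * t)) (t₁ t₂ t₃ t₄ : ℂ)
    (h₁₂ : Complex.sin (Real.pi * (t₁ - t₂)) ≠ 0) (h₁₃ : Complex.sin (Real.pi * (t₁ - t₃)) ≠ 0)
    (h₁₄ : Complex.sin (Real.pi * (t₁ - t₄)) ≠ 0) (h₂₃ : Complex.sin (Real.pi * (t₂ - t₃)) ≠ 0)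
    (h₂₄ : Complex.sin (Real.pi * (t₂ - t₄)) ≠ 0) (h₃₄ : Complex.sin (Real.pi * (t₃ - t₄)) ≠ 0) :
    f t₁ / (Complex.sin (Real.pi * (t₁ - t₂)) * Complex.sin (Real.pi * (t₁ - t₃)) *
        Complex.sin (Real.pi * (t₁ - t₄))) -
      f t₂ / (Complex.sin (Real.pi * (t₁ - t₂)) * Complex.sin (Real.pi * (t₂ - t₃)) *
        Complex.sin (Real.pi * (t₂ - t₄))) +
      f t₃ / (Complex.sin (Real.pi * (t₁ - t₃)) * Complex.sin (Real.pi * (t₂ - t₃)) *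
        Complex.sin (Real.pi * (t₃ - t₄))) -
      f t₄ / (Complex.sin (Real.pi * (t₁ - t₄)) * Complex.sin (Real.pi * (t₂ - t₄)) *
        Complex.sin (Real.pi * (t₃ - t₄))) = 0 := by
  set E : ℂ → ℂ := fun t => Complex.exp (Real.pi * Complex.I * t) with hE
  have hE0 : ∀ t, E t ≠ 0 := fun t => Complex.exp_ne_zero _
  have hfE : ∀ t, f t = α / E t ^ 2 + β + γ * E t ^ 2 := by
    intro t
    have e : E t ^ 2 = Complex.exp (2 * Real.pi * Complex.I * t) := by
      simp only [hE]
      rw [← Complex.exp_nat_mul]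
      congr 1
      push_cast
      ring
    rw [hf, e, Complex.exp_neg]
    rfl
  have hs : ∀ s t, Complex.sin (Real.pi * (s - t)) =
      (E t / E s - E s / E t) * Complex.I / 2 := by
    intro s t
    simp only [hE]
    rw [Complex.sin, ← Complex.exp_sub, ← Complex.exp_sub]
    congr 4 <;> ring
  have hs2 : ∀ s t, Complex.sin (Real.pi * (s - t)) =
      (E t ^ 2 - E s ^ 2) * Complex.I / (2 * (E s * E t)) := by
    intro s t
    rw [hs]
    have := hE0 s
    have := hE0 t
    field_simp
  have hne : ∀ s t, Complex.sin (Real.pi * (s - t)) ≠ 0 → E t ^ 2 - E s ^ 2 ≠ 0 := by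
    intro s t h h'
    rw [hs2, h'] at h
    simp at h
  have n12 := hne _ _ h₁₂
  have n13 := hne _ _ h₁₃
  have n14 := hne _ _ h₁₄
  have n23 := hne _ _ h₂₃
  have n24 := hne _ _ h₂₄
  have n34 := hne _ _ h₃₄
  simp only [hfE, hs2]
  have := hE0 t₁
  have := hE0 t₂
  have := hE0 t₃
  have := hE0 t₄
  have := Complex.I_ne_zero
  field_simp
  ring

/-- The periodization of `psi`. -/
noncomputable def psiSum (x y : Fin 4 → ℂ) (t : ℂ) : ℂ := ∑' n : ℤ, psi x y (t + n)

lemma summable_one_div_one_add_int_sq : Summable fun n : ℤ => 1 / (1 + (n : ℝ) ^ 2) := by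
  have h := (Real.summable_one_div_int_pow (p := 2)).2 (by norm_num)
  refine Summable.of_norm_bounded_eventually h ?_
  have hc : ∀ᶠ n : ℤ in cofinite, n ≠ 0 :=
    (Set.finite_singleton (0 : ℤ)).eventually_cofinite_notMem
  filter_upwards [hc] with n hn
  have hn' : (0 : ℝ) < (n : ℝ) ^ 2 := by positivity
  rw [Real.norm_of_nonneg (by positivity)]
  gcongr
  linarith

lemma summable_psi (x y : Fin 4 → ℂ) (hxy : ∑ i, y i = ∑ i, x i + 2) (ρ : ℝ) :
    ∃ C : ℝ, 0 ≤ C ∧ ∀ t : ℂ, ‖t‖ ≤ ρ → ∀ n : ℤ, ‖psi x y (t + n)‖ ≤ C * (1 / (1 + (n : ℝ) ^ 2)) := by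
  obtain ⟨C, hC, H⟩ := exists_norm_psi_le x y hxy
  refine ⟨C * Real.exp (4 * Real.pi * ρ) * (2 + 2 * ρ ^ 2), by positivity, fun t ht n => ?_⟩
  refine (H _).trans ?_
  have h1 : |(t + n).im| ≤ ρ := by
    rw [Complex.add_im, Complex.intCast_im, add_zero]
    exact (Complex.abs_im_le_norm t).trans ht
  have h2 : 1 + (n : ℝ) ^ 2 ≤ (2 + 2 * ρ ^ 2) * (1 + ‖t + n‖ ^ 2) := by
    have h3 : |(n : ℝ)| ≤ ‖t + n‖ + ‖t‖ := by
      have := norm_sub_le (t + n) t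
      rwa [add_sub_cancel_left, Complex.norm_intCast] at this
    have h4 : (n : ℝ) ^ 2 ≤ (‖t + n‖ + ‖t‖) ^ 2 := by
      rw [← sq_abs]
      gcongr
    have h5 : ‖t‖ ^ 2 ≤ ρ ^ 2 := by gcongr
    nlinarith [sq_nonneg (‖t + n‖ - ‖t‖), mul_nonneg (sq_nonneg ρ) (sq_nonneg ‖t + n‖)]
  rw [mul_one_div, div_le_div_iff₀ (by positivity) (by positivity)]
  calc _ ≤ C * Real.exp (4 * Real.pi * ρ) * ((2 + 2 * ρ ^ 2) * (1 + ‖t + n‖ ^ 2)) := by gcongr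
    _ = _ := by ring

lemma differentiable_psiSum (x y : Fin 4 → ℂ) (hxy : ∑ i, y i = ∑ i, x i + 2) :
    Differentiable ℂ (psiSum x y) := by
  intro t
  obtain ⟨C, hC, H⟩ := summable_psi x y hxy (‖t‖ + 1)
  have hd : DifferentiableOn ℂ (fun t : ℂ => ∑' n : ℤ, psi x y (t + n))
      (Metric.ball 0 (‖t‖ + 1)) := by
    refine Complex.differentiableOn_tsum_of_summable_norm
      (summable_one_div_one_add_int_sq.mul_left C) (fun n => ?_) Metric.isOpen_ball ?_
    · exact ((differentiable_psi x y).comp (differentiable_id.add_const _)).differentiableOn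
    · intro n w hw
      exact H w (by simpa using (mem_ball_zero_iff.1 hw).le) n
  exact hd.differentiableAt (Metric.isOpen_ball.mem_nhds (by simp))

lemma periodic_psiSum (x y : Fin 4 → ℂ) : Function.Periodic (psiSum x y) 1 := by
  intro t
  rw [psiSum, psiSum, ← (Equiv.addRight (1 : ℤ)).tsum_eq fun n : ℤ => psi x y (t + n)]
  refine tsum_congr fun n => ?_
  congr 1
  simp
  ring

lemma psiSum_growth (x y : Fin 4 → ℂ) (hxy : ∑ i, y i = ∑ i, x i + 2) (ε : ℝ) (hε : 0 < ε) :
    ∃ Y : ℝ, ∀ t : ℂ, Y ≤ |t.im| → ‖psiSum x y t‖ ≤ ε * Real.exp (4 * Real.pi * |t.im|) := by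
  obtain ⟨C, hC, H⟩ := exists_norm_psi_le x y hxy
  have hs : ∀ s : ℝ, Summable fun n : ℤ => 3 * C * (1 / (1 + (n : ℝ) ^ 2 + s ^ 2)) := by
    intro s
    refine Summable.mul_left _ (Summable.of_nonneg_of_le (fun n => by positivity) (fun n => ?_)
      summable_one_div_one_add_int_sq)
    exact one_div_le_one_div_of_le (by positivity) (by nlinarith [sq_nonneg s])
  have hlim : Tendsto (fun s : ℝ => ∑' n : ℤ, 3 * C * (1 / (1 + (n : ℝ) ^ 2 + s ^ 2))) atTop
      (𝓝 (∑' _n : ℤ, (0 : ℝ))) := by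
    refine tendsto_tsum_of_dominated_convergence
      (summable_one_div_one_add_int_sq.mul_left (3 * C)) (fun n => ?_) (Eventually.of_forall
      fun s n => ?_)
    · have h1 : Tendsto (fun s : ℝ => 1 + (n : ℝ) ^ 2 + s ^ 2) atTop atTop :=
        tendsto_atTop_add_const_left _ _ (tendsto_pow_atTop two_ne_zero)
      have := (tendsto_inv_atTop_zero.comp h1).const_mul (3 * C)
      simpa [Function.comp_def] using this
    · rw [Real.norm_of_nonneg (by positivity)]
      exact mul_le_mul_of_nonneg_left
        (one_div_le_one_div_of_le (by positivity) (by nlinarith [sq_nonneg s])) (by positivity)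
  rw [tsum_zero] at hlim
  obtain ⟨Y, hY⟩ := eventually_atTop.1 (hlim.eventually (gt_mem_nhds hε))
  refine ⟨Y, fun t ht => ?_⟩
  have hper := periodic_psiSum x y
  have hred : psiSum x y t = psiSum x y (t - ⌊t.re⌋) := by
    have := (hper.int_mul (-⌊t.re⌋)) t
    rw [← this]
    congr 1
    push_cast
    ring
  rw [hred]
  set t' : ℂ := t - ⌊t.re⌋ with ht'
  have him : t'.im = t.im := by simp [ht']
  have hre : t'.re = Int.fract t.re := by simp [ht', Int.self_sub_floor]
  have hre0 : 0 ≤ t'.re := hre ▸ Int.fract_nonneg _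
  have hre1 : t'.re ≤ 1 := hre ▸ (Int.fract_lt_one _).le
  rw [← him] at ht ⊢
  have hterm : ∀ n : ℤ, ‖psi x y (t' + n)‖ ≤
      Real.exp (4 * Real.pi * |t'.im|) * (3 * C * (1 / (1 + (n : ℝ) ^ 2 + |t'.im| ^ 2))) := by
    intro n
    refine (H _).trans ?_
    have h1 : (t' + n).im = t'.im := by simp
    rw [h1, ← mul_assoc, mul_one_div, div_le_div_iff₀ (by positivity) (by positivity)]
    have h2 : 1 + (n : ℝ) ^ 2 + |t'.im| ^ 2 ≤ 3 * (1 + ‖t' + n‖ ^ 2) := by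
      rw [← Complex.normSq_eq_norm_sq, Complex.normSq_apply, sq_abs]
      simp only [Complex.add_re, Complex.add_im, Complex.intCast_re, Complex.intCast_im]
      nlinarith [sq_nonneg (2 * t'.re + (n : ℝ)), sq_nonneg t'.im, sq_nonneg (t'.re + (n : ℝ))]
    calc _ ≤ C * Real.exp (4 * Real.pi * |t'.im|) * (3 * (1 + ‖t' + n‖ ^ 2)) := by gcongr
      _ = _ := by ring
  have hsum := (hs |t'.im|).mul_left (Real.exp (4 * Real.pi * |t'.im|))
  calc ‖psiSum x y t'‖ ≤ ∑' n : ℤ, Real.exp (4 * Real.pi * |t'.im|) *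
        (3 * C * (1 / (1 + (n : ℝ) ^ 2 + |t'.im| ^ 2))) := tsum_of_norm_bounded hsum.hasSum hterm
    _ = Real.exp (4 * Real.pi * |t'.im|) *
        ∑' n : ℤ, 3 * C * (1 / (1 + (n : ℝ) ^ 2 + |t'.im| ^ 2)) := tsum_mul_left
    _ ≤ Real.exp (4 * Real.pi * |t'.im|) * ε := by
        gcongr
        exact (hY _ ht).le
    _ = _ := mul_comm _ _

/-- Linear relation between four values of the periodization. -/
lemma psiSum_four_points (x y : Fin 4 → ℂ) (hxy : ∑ i, y i = ∑ i, x i + 2) (t₁ t₂ t₃ t₄ : ℂ)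
    (h₁₂ : Complex.sin (Real.pi * (t₁ - t₂)) ≠ 0) (h₁₃ : Complex.sin (Real.pi * (t₁ - t₃)) ≠ 0)
    (h₁₄ : Complex.sin (Real.pi * (t₁ - t₄)) ≠ 0) (h₂₃ : Complex.sin (Real.pi * (t₂ - t₃)) ≠ 0)
    (h₂₄ : Complex.sin (Real.pi * (t₂ - t₄)) ≠ 0) (h₃₄ : Complex.sin (Real.pi * (t₃ - t₄)) ≠ 0) :
    psiSum x y t₁ / (Complex.sin (Real.pi * (t₁ - t₂)) * Complex.sin (Real.pi * (t₁ - t₃)) *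
        Complex.sin (Real.pi * (t₁ - t₄))) -
      psiSum x y t₂ / (Complex.sin (Real.pi * (t₁ - t₂)) * Complex.sin (Real.pi * (t₂ - t₃)) *
        Complex.sin (Real.pi * (t₂ - t₄))) +
      psiSum x y t₃ / (Complex.sin (Real.pi * (t₁ - t₃)) * Complex.sin (Real.pi * (t₂ - t₃)) *
        Complex.sin (Real.pi * (t₃ - t₄))) -
      psiSum x y t₄ / (Complex.sin (Real.pi * (t₁ - t₄)) * Complex.sin (Real.pi * (t₂ - t₄)) *
        Complex.sin (Real.pi * (t₃ - t₄))) = 0 := by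
  obtain ⟨α, β, γ, h⟩ := exists_trig_poly_of_periodic (differentiable_psiSum x y hxy)
    (periodic_psiSum x y) (psiSum_growth x y hxy)
  exact trig_poly_four_points h t₁ t₂ t₃ t₄ h₁₂ h₁₃ h₁₄ h₂₃ h₂₄ h₃₄

lemma Sn_add_natCast_four (a b c d : ℂ) (k : ℕ) :
    Sn (k + a) * Sn (k + b) * Sn (k + c) * Sn (k + d) = Sn a * Sn b * Sn c * Sn d := by
  have h : ∀ z : ℂ, Sn (k + z) = (-1) ^ k * Sn z := by
    intro z
    simp only [Sn]
    induction k with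
    | zero => simp
    | succ k ih =>
      have e : (Real.pi : ℂ) * ((k + 1 : ℕ) + z) = Real.pi * (k + z) + Real.pi := by
        push_cast
        ring
      rw [e, Complex.sin_add_pi, ih, pow_succ]
      ring
  have h1 : ((-1 : ℂ) ^ k) ^ 4 = 1 := by
    rw [← pow_mul, mul_comm, pow_mul]
    norm_num
  rw [h, h, h, h]
  linear_combination (Sn a * Sn b * Sn c * Sn d) * h1

lemma inv_Gamma_one_sub (z : ℂ) (hz : ∀ n : ℤ, z ≠ n) :
    (Complex.Gamma (1 - z))⁻¹ = Complex.Gamma z * Sn z / Real.pi := by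
  have hG : Complex.Gamma z ≠ 0 := Complex.Gamma_ne_zero fun m h => hz (-m) (by simpa using h)
  rw [Sn, mul_div_assoc, ← inv_Gamma_mul_inv_Gamma_one_sub, ← mul_assoc, mul_inv_cancel₀ hG, one_mul]

lemma psiSum_zero (a b c d e f g : ℂ) (ha : ∀ n : ℤ, a ≠ n) (hb : ∀ n : ℤ, b ≠ n)
    (hc : ∀ n : ℤ, c ≠ n) (hd : ∀ n : ℤ, d ≠ n) :
    psiSum ![a, b, c, d] ![1, e, f, g] 0 =
      Sn a * Sn b * Sn c * Sn d / Real.pi ^ 4 * Fstar a b c d e f g := by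
  have hsupp : Function.support (fun n : ℤ => psi ![a, b, c, d] ![1, e, f, g] (0 + n)) ⊆
      Set.range (Nat.cast : ℕ → ℤ) := by
    intro n hn
    by_contra hneg
    apply hn
    have hn0 : n < 0 := by
      by_contra h
      exact hneg ⟨n.toNat, Int.toNat_of_nonneg (not_lt.1 h)⟩
    have hz : Complex.Gamma (1 + n) = 0 := by
      have : (1 + n : ℂ) = -((-n - 1).toNat : ℂ) := by
        have h1 : (((-n - 1).toNat : ℤ) : ℂ) = ((-n - 1 : ℤ) : ℂ) := by
          rw [Int.toNat_of_nonneg (by omega)]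
        push_cast at h1
        rw [h1]
        ring
      rw [this, Complex.Gamma_neg_nat_eq_zero]
    simp [psi, Fin.prod_univ_four, hz]
  rw [psiSum, ← Nat.cast_injective.tsum_eq hsupp, Fstar, ← tsum_mul_left]
  refine tsum_congr fun k => ?_
  have hni : ∀ z : ℂ, (∀ n : ℤ, z ≠ n) → ∀ n : ℤ, (k + z : ℂ) ≠ n := by
    intro z hz n h
    apply hz (n - k)
    push_cast
    linear_combination h
  have e1 : ∀ z : ℂ, 1 - z - k = 1 - (k + z) := fun z => by ring
  simp only [psi, Fin.prod_univ_four, zero_add, Matrix.cons_val, Int.cast_natCast, e1]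
  rw [add_comm e, add_comm f, add_comm g, add_comm 1 (k : ℂ)]
  rw [inv_Gamma_one_sub _ (hni a ha), inv_Gamma_one_sub _ (hni b hb),
    inv_Gamma_one_sub _ (hni c hc), inv_Gamma_one_sub _ (hni d hd), Complex.Gamma_nat_eq_factorial,
    ← Sn_add_natCast_four a b c d k]
  simp only [div_eq_mul_inv, mul_inv]
  ring

lemma psiSum_one_sub (a b c d e f g : ℂ) :
    psiSum ![a, b, c, d] ![1, e, f, g] (-f) =
      psiSum ![1 + a - f, 1 + b - f, 1 + c - f, 1 + d - f] ![1, 2 - f, 1 + e - f, 1 + g - f] 0 := by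
  rw [← periodic_psiSum]
  refine tsum_congr fun n => ?_
  simp only [psi, Fin.prod_univ_four, Matrix.cons_val]
  ring_nf

lemma psiSum_swap (x : Fin 4 → ℂ) (e f g t : ℂ) :
    psiSum x ![1, e, f, g] t = psiSum x ![1, e, g, f] t := by
  refine tsum_congr fun n => ?_
  simp only [psi, Fin.prod_univ_four, Matrix.cons_val]
  ring_nf

lemma psiSum_neg_upper (a b c d e f g : ℂ) :
    psiSum ![a, b, c, d] ![1, e, f, g] (-a) =
      psiSum ![a, 1 + a - e, 1 + a - f, 1 + a - g] ![1, 1 + a - b, 1 + a - c, 1 + a - d] 0 := by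
  rw [psiSum, ← (Equiv.neg ℤ).tsum_eq]
  refine tsum_congr fun n => ?_
  simp only [psi, Fin.prod_univ_four, Matrix.cons_val, Equiv.neg_apply, Int.cast_neg]
  ring_nf

lemma Sn_ne_zero {z : ℂ} (hz : ∀ n : ℤ, z ≠ n) : Sn z ≠ 0 := by
  rw [Sn, Ne, Complex.sin_eq_zero_iff]
  rintro ⟨k, hk⟩
  have hpi : (Real.pi : ℂ) ≠ 0 := by exact_mod_cast Real.pi_ne_zero
  exact hz k (mul_left_cancel₀ hpi (by rw [hk]; ring))

lemma Sn_neg (z : ℂ) : Sn (-z) = -Sn z := by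
  rw [Sn, mul_neg, Complex.sin_neg, Sn]

lemma Sn_one_sub (z : ℂ) : Sn (1 - z) = Sn z := by
  rw [Sn, Sn, mul_sub, mul_one, Complex.sin_pi_sub]

lemma Sn_sub_comm (z w : ℂ) : Sn (z - w) = -Sn (w - z) := by
  rw [← Sn_neg, neg_sub]

lemma Sn_one_add (z : ℂ) : Sn (1 + z) = -Sn z := by
  rw [← Sn_neg, ← Sn_one_sub (1 + z)]
  congr 1
  ring

/-- Genericity is preserved under translation by one and reflection. -/
lemma not_int_one_add {z : ℂ} (hz : ∀ n : ℤ, z ≠ n) : ∀ n : ℤ, 1 + z ≠ n := by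
  intro n h
  apply hz (n - 1)
  push_cast
  linear_combination h

lemma not_int_neg {z : ℂ} (hz : ∀ n : ℤ, z ≠ n) : ∀ n : ℤ, -z ≠ n := by
  intro n h
  apply hz (-n)
  push_cast
  linear_combination -h

lemma not_int_one_add_sub {z w : ℂ} (hz : ∀ n : ℤ, z - w ≠ n) : ∀ n : ℤ, 1 + z - w ≠ n := by
  intro n h
  exact not_int_one_add hz n (by linear_combination h)

/-- The four-term relation between Saalschützian series. -/
lemma Fstar_four_term (a b c d e f g : ℂ) (hsaal : e + f + g = a + b + c + d + 1)
    (ha : ∀ n : ℤ, a ≠ n) (hb : ∀ n : ℤ, b ≠ n) (hc : ∀ n : ℤ, c ≠ n) (hd : ∀ n : ℤ, d ≠ n)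
    (hf : ∀ n : ℤ, f ≠ n) (hg : ∀ n : ℤ, g ≠ n) (hfg : ∀ n : ℤ, f - g ≠ n)
    (hae : ∀ n : ℤ, a - e ≠ n)
    (haf : ∀ n : ℤ, a - f ≠ n) (hbf : ∀ n : ℤ, b - f ≠ n) (hcf : ∀ n : ℤ, c - f ≠ n)
    (hdf : ∀ n : ℤ, d - f ≠ n)
    (hag : ∀ n : ℤ, a - g ≠ n) (hbg : ∀ n : ℤ, b - g ≠ n) (hcg : ∀ n : ℤ, c - g ≠ n)
    (hdg : ∀ n : ℤ, d - g ≠ n) :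
    Fstar a b c d e f g * (Sn b * Sn c * Sn d) / (Sn f * Sn g) +
      Fstar (1 + a - f) (1 + b - f) (1 + c - f) (1 + d - f) (2 - f) (1 + e - f) (1 + g - f) *
        (Sn (b - f) * Sn (c - f) * Sn (d - f)) / (Sn f * Sn (f - g)) -
      Fstar (1 + a - g) (1 + b - g) (1 + c - g) (1 + d - g) (2 - g) (1 + e - g) (1 + f - g) *
        (Sn (b - g) * Sn (c - g) * Sn (d - g)) / (Sn g * Sn (f - g)) =
      Fstar a (1 + a - e) (1 + a - f) (1 + a - g) (1 + a - b) (1 + a - c) (1 + a - d) *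
        Sn (e - a) := by
  have h0 := psiSum_zero a b c d e f g ha hb hc hd
  have h1 := psiSum_one_sub a b c d e f g
  rw [psiSum_zero _ _ _ _ _ _ _ (not_int_one_add_sub haf) (not_int_one_add_sub hbf)
    (not_int_one_add_sub hcf) (not_int_one_add_sub hdf)] at h1
  have h2 := psiSum_one_sub a b c d e g f
  rw [psiSum_zero _ _ _ _ _ _ _ (not_int_one_add_sub hag) (not_int_one_add_sub hbg)
    (not_int_one_add_sub hcg) (not_int_one_add_sub hdg), psiSum_swap] at h2
  have h3 := psiSum_neg_upper a b c d e f g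
  rw [psiSum_zero _ _ _ _ _ _ _ ha (not_int_one_add_sub hae) (not_int_one_add_sub haf)
    (not_int_one_add_sub hag)] at h3
  have n1 := Sn_ne_zero hf
  have n2 := Sn_ne_zero hg
  have n3 := Sn_ne_zero ha
  have n4 := Sn_ne_zero hfg
  have n5 := Sn_ne_zero haf
  have n6 := Sn_ne_zero hag
  have r1 : Sn (0 - -f) = Sn f := by simp
  have r2 : Sn (0 - -g) = Sn g := by simp
  have r3 : Sn (0 - -a) = Sn a := by simp
  have r4 : Sn (-f - -g) = -Sn (f - g) := by rw [← Sn_neg]; congr 1; ring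
  have r5 : Sn (-f - -a) = Sn (a - f) := by congr 1; ring
  have r6 : Sn (-g - -a) = Sn (a - g) := by congr 1; ring
  have n7 := psiSum_four_points ![a, b, c, d] ![1, e, f, g]
    (by
      simp only [Fin.sum_univ_four, Matrix.cons_val]
      linear_combination hsaal) 0 (-f) (-g) (-a)
    (by change Sn (0 - -f) ≠ 0; rwa [r1]) (by change Sn (0 - -g) ≠ 0; rwa [r2])
    (by change Sn (0 - -a) ≠ 0; rwa [r3])
    (by change Sn (-f - -g) ≠ 0; rw [r4]; exact neg_ne_zero.2 n4)
    (by change Sn (-f - -a) ≠ 0; rwa [r5]) (by change Sn (-g - -a) ≠ 0; rwa [r6])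
  have key :
      psiSum ![a, b, c, d] ![1, e, f, g] 0 / (Sn (0 - -f) * Sn (0 - -g) * Sn (0 - -a)) -
        psiSum ![a, b, c, d] ![1, e, f, g] (-f) / (Sn (0 - -f) * Sn (-f - -g) * Sn (-f - -a)) +
        psiSum ![a, b, c, d] ![1, e, f, g] (-g) / (Sn (0 - -g) * Sn (-f - -g) * Sn (-g - -a)) -
        psiSum ![a, b, c, d] ![1, e, f, g] (-a) /
          (Sn (0 - -a) * Sn (-f - -a) * Sn (-g - -a)) = 0 := n7
  rw [h0, h1, h2, h3, r1, r2, r3, r4, r5, r6] at key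
  have q : ∀ z w : ℂ, Sn (1 + z - w) = -Sn (z - w) := fun z w => by
    rw [← Sn_one_add]; congr 1; ring
  simp only [q] at key
  have hpi : (Real.pi : ℂ) ≠ 0 := by exact_mod_cast Real.pi_ne_zero
  rw [Sn_sub_comm e a]
  field_simp at key ⊢
  linear_combination key

/-- The coefficients of the renormalized Gauss hypergeometric series. -/
def gaussCoeff (A B D : ℂ) (k : ℕ) : ℂ :=
  Complex.Gamma (k + A) * Complex.Gamma (k + B) / (k.factorial * Complex.Gamma (k + D))

/-- The renormalized Gauss hypergeometric series. -/
def gaussSeries (A B D z : ℂ) : ℂ := ∑' k : ℕ, gaussCoeff A B D k * z ^ k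

lemma not_int_natCast_add {z : ℂ} (hz : ∀ n : ℤ, z ≠ n) (k : ℕ) : ∀ n : ℤ, (k + z : ℂ) ≠ n := by
  intro n h
  apply hz (n - k)
  push_cast
  linear_combination h

lemma Gamma_ne_zero_of_not_int {z : ℂ} (hz : ∀ n : ℤ, z ≠ n) : Complex.Gamma z ≠ 0 :=
  Complex.Gamma_ne_zero fun m h => hz (-m) (by simpa using h)

lemma Gamma_natCast_add_ne_zero {z : ℂ} (hz : ∀ n : ℤ, z ≠ n) (k : ℕ) :
    Complex.Gamma (k + z) ≠ 0 :=
  Gamma_ne_zero_of_not_int (not_int_natCast_add hz k)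

lemma ne_zero_of_not_int {z : ℂ} (hz : ∀ n : ℤ, z ≠ n) : z ≠ 0 := by
  simpa using hz 0

lemma Gamma_natCast_succ_add {z : ℂ} (hz : ∀ n : ℤ, z ≠ n) (k : ℕ) :
    Complex.Gamma ((k + 1 : ℕ) + z) = (k + z) * Complex.Gamma (k + z) := by
  rw [← Complex.Gamma_add_one _ (ne_zero_of_not_int (not_int_natCast_add hz k))]
  congr 1
  push_cast
  ring

lemma gaussCoeff_succ {A B D : ℂ} (hA : ∀ n : ℤ, A ≠ n) (hB : ∀ n : ℤ, B ≠ n)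
    (hD : ∀ n : ℤ, D ≠ n) (k : ℕ) :
    (k + 1) * (k + D) * gaussCoeff A B D (k + 1) = (k + A) * (k + B) * gaussCoeff A B D k := by
  have h1 := Gamma_natCast_add_ne_zero hD k
  have h2 := ne_zero_of_not_int (not_int_natCast_add hD k)
  have h3 : (k.factorial : ℂ) ≠ 0 := by exact_mod_cast k.factorial_ne_zero
  have h4 : (k + 1 : ℂ) ≠ 0 := by exact_mod_cast k.succ_ne_zero
  rw [gaussCoeff, gaussCoeff, Gamma_natCast_succ_add hA, Gamma_natCast_succ_add hB,
    Gamma_natCast_succ_add hD, Nat.factorial_succ]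
  push_cast
  field_simp

lemma gaussCoeff_one_add (A B D : ℂ) (k : ℕ) :
    gaussCoeff (1 + A) (1 + B) (1 + D) k = (k + 1) * gaussCoeff A B D (k + 1) := by
  have h3 : (k.factorial : ℂ) ≠ 0 := by exact_mod_cast k.factorial_ne_zero
  have h4 : (k + 1 : ℂ) ≠ 0 := by exact_mod_cast k.succ_ne_zero
  rw [gaussCoeff, gaussCoeff, Nat.factorial_succ]
  push_cast
  rw [← add_assoc, ← add_assoc, ← add_assoc]
  field_simp

lemma tendsto_gaussCoeff_div {A B D : ℂ} (hA : ∀ n : ℤ, A ≠ n) (hB : ∀ n : ℤ, B ≠ n)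
    (hD : ∀ n : ℤ, D ≠ n) :
    Tendsto (fun n : ℕ => gaussCoeff A B D n / (n : ℂ) ^ (A + B - D - 1)) atTop (𝓝 1) := by
  have hs : ∀ {z : ℂ}, (∀ n : ℤ, z ≠ n) → ∀ m : ℕ, z - 1 ≠ -m := by
    intro z hz m h
    apply hz (1 - m)
    push_cast
    linear_combination h
  have h := ((tendsto_Gamma_add_nat_div _ (hs hA)).mul (tendsto_Gamma_add_nat_div _ (hs hB))).div
    (tendsto_Gamma_add_nat_div _ (hs hD)) one_ne_zero
  simp only [mul_one, div_one] at h
  refine h.congr' ?_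
  filter_upwards [eventually_ge_atTop 1] with n hn
  have hn0 : (n : ℂ) ≠ 0 := by exact_mod_cast (by omega : n ≠ 0)
  have hf : (n.factorial : ℂ) ≠ 0 := by exact_mod_cast n.factorial_ne_zero
  have e : ∀ z : ℂ, (n : ℂ) + 1 + (z - 1) = n + z := fun z => by ring
  have hp : (n : ℂ) ^ (A + B - D - 1) =
      (n : ℂ) ^ (A - 1) * (n : ℂ) ^ (B - 1) / (n : ℂ) ^ (D - 1) := by
    rw [← Complex.cpow_add _ _ hn0, ← Complex.cpow_sub _ _ hn0]
    congr 1
    ring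
  have hc : ∀ z : ℂ, (n : ℂ) ^ z ≠ 0 := fun z => by simp [Complex.cpow_eq_zero_iff, hn0]
  have h1 := hc (A - 1)
  have h2 := hc (B - 1)
  have h3 := hc (D - 1)
  have h4 := Gamma_natCast_add_ne_zero hD n
  simp only [Pi.div_apply, e, hp, gaussCoeff]
  field_simp

lemma isBigO_gaussCoeff {A B D : ℂ} (hA : ∀ n : ℤ, A ≠ n) (hB : ∀ n : ℤ, B ≠ n)
    (hD : ∀ n : ℤ, D ≠ n) :
    gaussCoeff A B D =O[atTop] fun n : ℕ => (n : ℝ) ^ ((A + B - D).re - 1) := by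
  have h := Asymptotics.isBigO_of_div_tendsto_nhds (f := gaussCoeff A B D)
    (g := fun n : ℕ => (n : ℂ) ^ (A + B - D - 1)) (l := atTop) ?_ 1
    (tendsto_gaussCoeff_div hA hB hD)
  · refine h.trans (Asymptotics.IsBigO.of_bound 1 ?_)
    filter_upwards [eventually_ge_atTop 1] with n hn
    rw [Complex.norm_natCast_cpow_of_pos hn, one_mul, Real.norm_eq_abs]
    simp only [Complex.sub_re, Complex.one_re]
    exact le_abs_self _
  · filter_upwards [eventually_ge_atTop 1] with n hn h0
    have hn0 : (n : ℂ) ≠ 0 := by exact_mod_cast (by omega : n ≠ 0)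
    simp [Complex.cpow_eq_zero_iff, hn0] at h0

lemma summable_gaussCoeff {A B D : ℂ} (hA : ∀ n : ℤ, A ≠ n) (hB : ∀ n : ℤ, B ≠ n)
    (hD : ∀ n : ℤ, D ≠ n) (h : 0 < (D - A - B).re) :
    Summable fun k => ‖gaussCoeff A B D k‖ := by
  refine summable_of_isBigO_nat (Real.summable_nat_rpow.2 ?_) (isBigO_gaussCoeff hA hB hD).norm_left
  simp only [Complex.sub_re, Complex.add_re] at h ⊢
  linarith

lemma summable_gaussCoeff_mul_pow {A B D : ℂ} (hA : ∀ n : ℤ, A ≠ n) (hB : ∀ n : ℤ, B ≠ n)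
    (hD : ∀ n : ℤ, D ≠ n) {r : ℝ} (hr0 : 0 ≤ r) (hr : r < 1) :
    Summable fun k => ‖gaussCoeff A B D k‖ * r ^ k := by
  obtain ⟨N, hN⟩ := exists_nat_ge ((A + B - D).re - 1)
  have hs := summable_pow_mul_geometric_of_norm_lt_one (R := ℝ) N (r := r)
    (by rwa [Real.norm_of_nonneg hr0])
  refine summable_of_isBigO_nat hs (Asymptotics.IsBigO.mul ?_ (Asymptotics.isBigO_refl _ _))
  refine ((isBigO_gaussCoeff hA hB hD).norm_left).trans (Asymptotics.IsBigO.of_bound 1 ?_)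
  filter_upwards [eventually_ge_atTop 1] with n hn
  have hn1 : (1 : ℝ) ≤ n := by exact_mod_cast hn
  rw [one_mul, Real.norm_of_nonneg (by positivity), Real.norm_of_nonneg (by positivity),
    ← Real.rpow_natCast]
  exact Real.rpow_le_rpow_of_exponent_le hn1 hN

lemma hasSum_gaussSeries {A B D : ℂ} (hA : ∀ n : ℤ, A ≠ n) (hB : ∀ n : ℤ, B ≠ n)
    (hD : ∀ n : ℤ, D ≠ n) {z : ℂ} (hz : ‖z‖ < 1) :
    HasSum (fun k => gaussCoeff A B D k * z ^ k) (gaussSeries A B D z) := by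
  refine (Summable.of_norm ?_).hasSum
  simpa [norm_mul, norm_pow] using summable_gaussCoeff_mul_pow hA hB hD (norm_nonneg z) hz

lemma hasDerivAt_gaussSeries {A B D : ℂ} (hA : ∀ n : ℤ, A ≠ n) (hB : ∀ n : ℤ, B ≠ n)
    (hD : ∀ n : ℤ, D ≠ n) {z : ℂ} (hz : ‖z‖ < 1) :
    HasDerivAt (gaussSeries A B D) (gaussSeries (1 + A) (1 + B) (1 + D) z) z := by
  obtain ⟨r, hzr, hr⟩ := exists_between hz
  have hr0 : 0 ≤ r := (norm_nonneg z).trans hzr.le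
  have hsum := summable_gaussCoeff_mul_pow hA hB hD hr0 hr
  have hdiff : ∀ k : ℕ, DifferentiableOn ℂ (fun w : ℂ => gaussCoeff A B D k * w ^ k)
      (Metric.ball 0 r) := fun k => by fun_prop
  have hle : ∀ k : ℕ, ∀ w ∈ Metric.ball (0 : ℂ) r, ‖gaussCoeff A B D k * w ^ k‖ ≤
      ‖gaussCoeff A B D k‖ * r ^ k := by
    intro k w hw
    rw [mem_ball_zero_iff] at hw
    rw [norm_mul, norm_pow]
    gcongr
  have hmem : z ∈ Metric.ball (0 : ℂ) r := by simpa using hzr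
  have h1 := Complex.hasSum_deriv_of_summable_norm hsum hdiff Metric.isOpen_ball hle hmem
  have h2 := (Complex.differentiableOn_tsum_of_summable_norm hsum hdiff Metric.isOpen_ball
    hle).differentiableAt (Metric.isOpen_ball.mem_nhds hmem)
  have h3 := hasSum_gaussSeries (not_int_one_add hA) (not_int_one_add hB) (not_int_one_add hD) hz
  have h4 : deriv (gaussSeries A B D) z = gaussSeries (1 + A) (1 + B) (1 + D) z := by
    refine h1.unique ?_
    rw [← hasSum_nat_add_iff' 1]
    simp only [Finset.range_one, Finset.sum_singleton, pow_zero, mul_one, deriv_const, sub_zero]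
    refine h3.congr_fun fun k => ?_
    rw [gaussCoeff_one_add, deriv_const_mul _ (by fun_prop), deriv_pow_field]
    simp only [Nat.cast_add, Nat.cast_one, Nat.add_sub_cancel]
    ring
  rw [← h4]
  exact h2.hasDerivAt

lemma hasSum_mul_of_hasSum_succ {c : ℕ → ℂ} {z s : ℂ} (h0 : c 0 = 0)
    (h : HasSum (fun k => c (k + 1) * z ^ k) s) : HasSum (fun k => c k * z ^ k) (z * s) := by
  rw [← hasSum_nat_add_iff' 1]
  simp only [Finset.range_one, Finset.sum_singleton, h0, zero_mul, sub_zero]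
  refine (h.mul_left z).congr_fun fun k => ?_
  rw [pow_succ]
  ring

/-- The hypergeometric differential equation. -/
lemma gaussSeries_ode {A B D : ℂ} (hA : ∀ n : ℤ, A ≠ n) (hB : ∀ n : ℤ, B ≠ n)
    (hD : ∀ n : ℤ, D ≠ n) {z : ℂ} (hz : ‖z‖ < 1) :
    z * (1 - z) * gaussSeries (1 + (1 + A)) (1 + (1 + B)) (1 + (1 + D)) z +
      (D - (A + B + 1) * z) * gaussSeries (1 + A) (1 + B) (1 + D) z -
      A * B * gaussSeries A B D z = 0 := by
  have s0 := hasSum_gaussSeries hA hB hD hz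
  have s1 := hasSum_gaussSeries (not_int_one_add hA) (not_int_one_add hB) (not_int_one_add hD) hz
  have s2 := hasSum_gaussSeries (not_int_one_add (not_int_one_add hA))
    (not_int_one_add (not_int_one_add hB)) (not_int_one_add (not_int_one_add hD)) hz
  have t1 : HasSum (fun k : ℕ => (k * gaussCoeff A B D k) * z ^ k)
      (z * gaussSeries (1 + A) (1 + B) (1 + D) z) := by
    refine hasSum_mul_of_hasSum_succ (by simp) (s1.congr_fun fun k => ?_)
    rw [gaussCoeff_one_add]
    push_cast
    ring
  have t2 : HasSum (fun k : ℕ => (k * ((k + 1) * gaussCoeff A B D (k + 1))) * z ^ k)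
      (z * gaussSeries (1 + (1 + A)) (1 + (1 + B)) (1 + (1 + D)) z) := by
    refine hasSum_mul_of_hasSum_succ (by simp) (s2.congr_fun fun k => ?_)
    rw [gaussCoeff_one_add, gaussCoeff_one_add]
    push_cast
    ring
  have t3 : HasSum (fun k : ℕ => (k * ((k - 1) * gaussCoeff A B D k)) * z ^ k)
      (z * (z * gaussSeries (1 + (1 + A)) (1 + (1 + B)) (1 + (1 + D)) z)) := by
    refine hasSum_mul_of_hasSum_succ (by simp) (t2.congr_fun fun k => ?_)
    push_cast
    ring
  have h := (((t2.sub t3).add (s1.mul_left D)).sub (t1.mul_left (A + B + 1))).sub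
    (s0.mul_left (A * B))
  have h' := h.unique (hasSum_zero.congr_fun fun k => ?_)
  · linear_combination h'
  · have := gaussCoeff_succ hA hB hD k
    rw [gaussCoeff_one_add]
    linear_combination z ^ k * this

/-- Gauss's summation is compatible with raising the lower parameter. -/
lemma gaussSeries_one_recurrence {A B D : ℂ} (hA : ∀ n : ℤ, A ≠ n) (hB : ∀ n : ℤ, B ≠ n)
    (hD : ∀ n : ℤ, D ≠ n) (h : 0 < (D - A - B).re) :
    (D - A - B) * gaussSeries A B D 1 = (D - A) * (D - B) * gaussSeries A B (1 + D) 1 := by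
  have h' : 0 < (1 + D - A - B).re := by
    simp only [Complex.sub_re, Complex.add_re, Complex.one_re] at h ⊢
    linarith
  have s0 : HasSum (gaussCoeff A B D) (gaussSeries A B D 1) := by
    simpa [gaussSeries] using (summable_gaussCoeff hA hB hD h).of_norm.hasSum
  have s1 : HasSum (gaussCoeff A B (1 + D)) (gaussSeries A B (1 + D) 1) := by
    simpa [gaussSeries] using (summable_gaussCoeff hA hB (not_int_one_add hD) h').of_norm.hasSum
  have s2 := (s0.mul_left (D - A - B)).sub (s1.mul_left ((D - A) * (D - B)))
  have ht : Tendsto (fun n : ℕ => (n : ℂ) * gaussCoeff A B D n) atTop (𝓝 0) := by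
    rw [tendsto_zero_iff_norm_tendsto_zero]
    have hO : (fun n : ℕ => ‖(n : ℂ) * gaussCoeff A B D n‖) =O[atTop]
        fun n : ℕ => (n : ℝ) ^ (-(D - A - B).re) := by
      refine ((Asymptotics.isBigO_refl (fun n : ℕ => (n : ℂ)) atTop).norm_right.mul
        (isBigO_gaussCoeff hA hB hD)).norm_left.congr' EventuallyEq.rfl ?_
      filter_upwards [eventually_ge_atTop 1] with n hn
      have hn0 : (0 : ℝ) < n := by exact_mod_cast hn
      rw [Complex.norm_natCast, mul_comm, ← Real.rpow_add_one hn0.ne']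
      congr 1
      simp only [Complex.sub_re, Complex.add_re]
      ring
    exact hO.trans_tendsto ((tendsto_rpow_neg_atTop h).comp tendsto_natCast_atTop_atTop)
  have e : ∀ k : ℕ, (D - A - B) * gaussCoeff A B D k - (D - A) * (D - B) * gaussCoeff A B (1 + D) k =
      k * gaussCoeff A B D k - (k + 1 : ℕ) * gaussCoeff A B D (k + 1) := by
    intro k
    have hr := gaussCoeff_succ hA hB hD k
    have hk : gaussCoeff A B D k = (k + D) * gaussCoeff A B (1 + D) k := by
      have h1 := Gamma_natCast_add_ne_zero hD k
      have h2 := ne_zero_of_not_int (not_int_natCast_add hD k)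
      have h3 : (k.factorial : ℂ) ≠ 0 := by exact_mod_cast k.factorial_ne_zero
      have h4 : Complex.Gamma (k + (1 + D)) = (k + D) * Complex.Gamma (k + D) := by
        rw [← Complex.Gamma_add_one _ h2]
        congr 1
        ring
      rw [gaussCoeff, gaussCoeff, h4]
      field_simp
    have h2 := ne_zero_of_not_int (not_int_natCast_add hD k)
    apply mul_left_cancel₀ h2
    rw [hk] at hr ⊢
    push_cast
    linear_combination hr
  have h3 := s2.tendsto_sum_nat
  simp only [e, Finset.sum_range_sub'] at h3
  have h4 := tendsto_nhds_unique h3 (by simpa using ht.const_sub 0)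
  linear_combination h4

lemma norm_Gamma_div_Gamma_le {D : ℂ} (hD : ∀ n : ℤ, D ≠ n) (hre : 0 < D.re) (n k : ℕ) :
    ‖Complex.Gamma (n + D) / Complex.Gamma (k + (n + D))‖ ≤
      ‖Complex.Gamma D / Complex.Gamma (k + D)‖ := by
  induction k with
  | zero =>
    have h1 := Gamma_natCast_add_ne_zero hD n
    have h2 := Gamma_ne_zero_of_not_int hD
    simp [h1, h2]
  | succ k ih =>
    rw [Gamma_natCast_succ_add hD, Gamma_natCast_succ_add (not_int_natCast_add hD n),
      mul_comm _ (Complex.Gamma _), mul_comm _ (Complex.Gamma _), ← div_div, ← div_div,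
      norm_div _ (k + _ : ℂ), norm_div _ (k + _ : ℂ)]
    have h2 := norm_pos_iff.2 (ne_zero_of_not_int (not_int_natCast_add hD k))
    gcongr
    rw [Complex.norm_def, Complex.norm_def]
    apply Real.sqrt_le_sqrt
    simp only [Complex.normSq_apply, Complex.add_re, Complex.add_im, Complex.natCast_re,
      Complex.natCast_im]
    have : (0 : ℝ) ≤ k := k.cast_nonneg
    have : (0 : ℝ) ≤ n := n.cast_nonneg
    nlinarith [mul_nonneg this hre.le, mul_nonneg ‹(0 : ℝ) ≤ k› this]

lemma tendsto_gaussSeries_one_mul_Gamma {A B D : ℂ} (hA : ∀ n : ℤ, A ≠ n) (hB : ∀ n : ℤ, B ≠ n)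
    (hD : ∀ n : ℤ, D ≠ n) (hre : 0 < D.re) (h : 0 < (D - A - B).re) :
    Tendsto (fun n : ℕ => gaussSeries A B (n + D) 1 * Complex.Gamma (n + D)) atTop
      (𝓝 (Complex.Gamma A * Complex.Gamma B)) := by
  have hlim : Complex.Gamma A * Complex.Gamma B =
      ∑' k : ℕ, if k = 0 then Complex.Gamma A * Complex.Gamma B else 0 := by simp
  rw [hlim]
  simp only [gaussSeries, one_pow, mul_one, ← tsum_mul_right]
  refine tendsto_tsum_of_dominated_convergence
    (bound := fun k => ‖gaussCoeff A B D k‖ * ‖Complex.Gamma D‖)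
    ((summable_gaussCoeff hA hB hD h).mul_right _) ?_ ?_
  · intro k
    have h0 : ∀ n : ℕ, gaussCoeff A B (n + D) k * Complex.Gamma (n + D) =
        Complex.Gamma (k + A) * Complex.Gamma (k + B) / k.factorial *
          (Complex.Gamma (n + D) / Complex.Gamma (k + (n + D))) := by
      intro n
      rw [gaussCoeff]
      field_simp
    simp only [h0]
    rcases k with _ | k
    · have h1 : ∀ n : ℕ, Complex.Gamma (n + D) ≠ 0 := Gamma_natCast_add_ne_zero hD
      simp [h1]
    · rw [if_neg (Nat.succ_ne_zero k)]
      have h2 : Tendsto (fun n : ℕ => Complex.Gamma (n + D) / Complex.Gamma ((k + 1 : ℕ) + (n + D)))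
          atTop (𝓝 0) := by
        refine squeeze_zero_norm' (a := fun n : ℕ => ‖Complex.Gamma D / Complex.Gamma (k + D)‖ *
          ((n : ℝ))⁻¹) ?_ ?_
        · filter_upwards [eventually_ge_atTop 1] with n hn
          rw [Gamma_natCast_succ_add (not_int_natCast_add hD n), mul_comm, ← div_div, norm_div,
            div_eq_mul_inv]
          have h3 := norm_Gamma_div_Gamma_le hD hre n k
          have hn0 : (0 : ℝ) < n := by exact_mod_cast hn
          have h4 : (n : ℝ) ≤ ‖(k + (n + D) : ℂ)‖ := by
            refine le_trans ?_ (Complex.re_le_norm _)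
            simp only [Complex.add_re, Complex.natCast_re]
            have : (0 : ℝ) ≤ k := k.cast_nonneg
            linarith
          gcongr
        · simpa using tendsto_inv_atTop_nhds_zero_nat.const_mul
            ‖Complex.Gamma D / Complex.Gamma (k + D)‖
      simpa using h2.const_mul _
  · filter_upwards with n k
    have := norm_Gamma_div_Gamma_le hD hre n k
    rw [← norm_mul, gaussCoeff, gaussCoeff]
    calc ‖_‖ = ‖Complex.Gamma (k + A) * Complex.Gamma (k + B) / k.factorial‖ *
          ‖Complex.Gamma (n + D) / Complex.Gamma (k + (n + D))‖ := by
          rw [← norm_mul]; congr 1; field_simp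
      _ ≤ ‖Complex.Gamma (k + A) * Complex.Gamma (k + B) / k.factorial‖ *
          ‖Complex.Gamma D / Complex.Gamma (k + D)‖ := by gcongr
      _ = _ := by rw [← norm_mul]; congr 1; field_simp

/-- Gauss's summation theorem. -/
lemma gaussSeries_one {A B D : ℂ} (hA : ∀ n : ℤ, A ≠ n) (hB : ∀ n : ℤ, B ≠ n)
    (hD : ∀ n : ℤ, D ≠ n) (hDA : ∀ n : ℤ, D - A ≠ n) (hDB : ∀ n : ℤ, D - B ≠ n)
    (hDAB : ∀ n : ℤ, D - A - B ≠ n) (hre : 0 < D.re) (h : 0 < (D - A - B).re) :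
    gaussSeries A B D 1 = Complex.Gamma A * Complex.Gamma B * Complex.Gamma (D - A - B) /
      (Complex.Gamma (D - A) * Complex.Gamma (D - B)) := by
  have hc : ∀ n : ℕ, gaussSeries A B (n + D) 1 * (Complex.Gamma (n + (D - A)) *
      Complex.Gamma (n + (D - B)) / Complex.Gamma (n + (D - A - B))) =
      gaussSeries A B D 1 * (Complex.Gamma (D - A) *
      Complex.Gamma (D - B) / Complex.Gamma (D - A - B)) := by
    intro n
    induction n with
    | zero => simp
    | succ n ih =>
      rw [← ih, Gamma_natCast_succ_add hDA, Gamma_natCast_succ_add hDB,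
        Gamma_natCast_succ_add hDAB]
      have hr := gaussSeries_one_recurrence hA hB (not_int_natCast_add hD n) (by
        simp only [Complex.sub_re, Complex.add_re, Complex.natCast_re] at h ⊢
        have : (0 : ℝ) ≤ n := n.cast_nonneg
        linarith)
      have h1 := Gamma_natCast_add_ne_zero hDAB n
      have h2 := ne_zero_of_not_int (not_int_natCast_add hDAB n)
      have e : ((n + 1 : ℕ) : ℂ) + D = 1 + (n + D) := by push_cast; ring
      rw [e]
      field_simp
      linear_combination (-Complex.Gamma (n + (D - A)) * Complex.Gamma (n + (D - B))) * hr
  have hq := tendsto_Gamma_quot ![D - A, D - B] ![D - A - B, D]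
    (by simp only [Fin.sum_univ_two, Matrix.cons_val]; ring)
    (by
      intro i m hm
      fin_cases i
      · exact hDA (-m) (by simpa using hm)
      · exact hDB (-m) (by simpa using hm))
    (by
      intro i m hm
      fin_cases i
      · exact hDAB (-m) (by simpa using hm)
      · exact hD (-m) (by simpa using hm))
  have hl := ((tendsto_gaussSeries_one_mul_Gamma hA hB hD hre h).comp
    (tendsto_add_atTop_nat 1)).mul hq
  have h1 := Gamma_ne_zero_of_not_int hDA
  have h2 := Gamma_ne_zero_of_not_int hDB
  have h3 := Gamma_ne_zero_of_not_int hDAB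
  have hl' : Tendsto (fun _ : ℕ => gaussSeries A B D 1 * (Complex.Gamma (D - A) *
      Complex.Gamma (D - B) / Complex.Gamma (D - A - B))) atTop
      (𝓝 (Complex.Gamma A * Complex.Gamma B * 1)) := by
    refine hl.congr fun n => ?_
    have h1 := Gamma_natCast_add_ne_zero hD (n + 1)
    have h2 := Gamma_natCast_add_ne_zero hDAB (n + 1)
    rw [← hc (n + 1)]
    simp only [Function.comp, Fin.prod_univ_two, Matrix.cons_val]
    push_cast at h1 h2 ⊢
    field_simp
  have := tendsto_nhds_unique tendsto_const_nhds hl'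
  field_simp at this ⊢
  linear_combination this

lemma continuousOn_gaussSeries {A B D : ℂ} (hA : ∀ n : ℤ, A ≠ n) (hB : ∀ n : ℤ, B ≠ n)
    (hD : ∀ n : ℤ, D ≠ n) (h : 0 < (D - A - B).re) :
    ContinuousOn (gaussSeries A B D) (Metric.closedBall 0 1) := by
  refine continuousOn_tsum (u := fun k => ‖gaussCoeff A B D k‖) (fun k => by fun_prop)
    (summable_gaussCoeff hA hB hD h) fun k z hz => ?_
  rw [mem_closedBall_zero_iff] at hz
  rw [norm_mul, norm_pow]
  exact mul_le_of_le_one_right (norm_nonneg _) (pow_le_one₀ (norm_nonneg _) hz)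

lemma gaussSeries_zero (A B D : ℂ) :
    gaussSeries A B D 0 = Complex.Gamma A * Complex.Gamma B / Complex.Gamma D := by
  rw [gaussSeries, tsum_eq_single 0 fun k hk => by simp [hk]]
  simp [gaussCoeff]

/-- `y` solves the hypergeometric equation on the disc with diameter `(0, 1)`, with first and
second derivatives `y'` and `y''`. -/
structure IsGaussSolution (A B D : ℂ) (y y' y'' : ℂ → ℂ) : Prop where
  hasDerivAt : ∀ z ∈ Metric.ball (1 / 2 : ℂ) (1 / 2), HasDerivAt y (y' z) z
  hasDerivAt' : ∀ z ∈ Metric.ball (1 / 2 : ℂ) (1 / 2), HasDerivAt y' (y'' z) z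
  ode : ∀ z ∈ Metric.ball (1 / 2 : ℂ) (1 / 2),
    z * (1 - z) * y'' z + (D - (A + B + 1) * z) * y' z - A * B * y z = 0

lemma re_mem_of_mem_ball {z : ℂ} (hz : z ∈ Metric.ball (1 / 2 : ℂ) (1 / 2)) :
    0 < z.re ∧ z.re < 1 := by
  rw [mem_ball_iff_norm] at hz
  have h := abs_lt.1 ((Complex.abs_re_le_norm _).trans_lt hz)
  have e : (z - 1 / 2).re = z.re - 1 / 2 := by simp
  rw [e] at h
  constructor <;> linarith [h.1, h.2]

lemma mem_slitPlane_of_mem_ball {z : ℂ} (hz : z ∈ Metric.ball (1 / 2 : ℂ) (1 / 2)) :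
    z ∈ Complex.slitPlane := Or.inl (re_mem_of_mem_ball hz).1

lemma one_sub_mem_ball {z : ℂ} (hz : z ∈ Metric.ball (1 / 2 : ℂ) (1 / 2)) :
    1 - z ∈ Metric.ball (1 / 2 : ℂ) (1 / 2) := by
  rw [mem_ball_iff_norm] at hz ⊢
  rwa [← norm_neg, show -(1 - z - 1 / 2) = z - 1 / 2 by ring]

lemma norm_lt_one_of_mem_ball {z : ℂ} (hz : z ∈ Metric.ball (1 / 2 : ℂ) (1 / 2)) : ‖z‖ < 1 := by
  rw [mem_ball_iff_norm] at hz
  calc ‖z‖ = ‖(z - 1 / 2) + 1 / 2‖ := by simp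
    _ ≤ ‖z - 1 / 2‖ + ‖(1 / 2 : ℂ)‖ := norm_add_le _ _
    _ < 1 / 2 + 1 / 2 := by
      have : ‖(1 / 2 : ℂ)‖ = 1 / 2 := by norm_num
      linarith
    _ = 1 := by norm_num

lemma ofReal_mem_ball {t : ℝ} (h0 : 0 < t) (h1 : t < 1) :
    (t : ℂ) ∈ Metric.ball (1 / 2 : ℂ) (1 / 2) := by
  rw [mem_ball_iff_norm]
  have : (t : ℂ) - 1 / 2 = ((t - 1 / 2 : ℝ) : ℂ) := by push_cast; ring
  rw [this, Complex.norm_real, Real.norm_eq_abs, abs_lt]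
  constructor <;> linarith

/-- Abel's formula for the Wronskian of two solutions of the hypergeometric equation. -/
lemma IsGaussSolution.exists_wronskian {A B C D : ℂ} (hCD : C + D = A + B + 1)
    {y y' y'' v v' v'' : ℂ → ℂ}
    (hy : IsGaussSolution A B D y y' y'') (hv : IsGaussSolution A B D v v' v'') :
    ∃ c : ℂ, ∀ z ∈ Metric.ball (1 / 2 : ℂ) (1 / 2),
      (y z * v' z - v z * y' z) * (z ^ D * (1 - z) ^ C) = c := by
  have hd : ∀ z ∈ Metric.ball (1 / 2 : ℂ) (1 / 2),
      HasDerivAt (fun z => (y z * v' z - v z * y' z) * (z ^ D * (1 - z) ^ C)) 0 z := by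
    intro z hz
    have hz0 : z ≠ 0 := Complex.slitPlane_ne_zero (mem_slitPlane_of_mem_ball hz)
    have hz1 : 1 - z ≠ 0 := Complex.slitPlane_ne_zero
      (mem_slitPlane_of_mem_ball (one_sub_mem_ball hz))
    have h1 := ((hy.hasDerivAt z hz).mul (hv.hasDerivAt' z hz)).sub
      ((hv.hasDerivAt z hz).mul (hy.hasDerivAt' z hz))
    have h2 := (hasDerivAt_id z).cpow_const (c := D) (mem_slitPlane_of_mem_ball hz)
    have h3 := ((hasDerivAt_id z).const_sub 1).cpow_const (c := C)
      (mem_slitPlane_of_mem_ball (one_sub_mem_ball hz))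
    refine (h1.mul (h2.mul h3)).congr_deriv ?_
    have e1 := hy.ode z hz
    have e2 := hv.ode z hz
    simp only [Pi.mul_apply, Pi.sub_apply, id, Complex.cpow_sub _ _ hz0, Complex.cpow_sub _ _ hz1,
      Complex.cpow_one]
    field_simp
    have hD : D = A + B + 1 - C := by linear_combination hCD
    rw [hD] at e1 e2
    rw [hD]
    linear_combination (z ^ (A + B + 1 - C) * (1 - z) ^ C) * (y z * e2 - v z * e1)
  obtain ⟨c, hc⟩ := Metric.isOpen_ball.exists_is_const_of_deriv_eq_zero
    (convex_ball (1 / 2 : ℂ) (1 / 2)).isPreconnected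
    (fun z hz => (hd z hz).differentiableAt.differentiableWithinAt)
    (fun z hz => (hd z hz).deriv)
  exact ⟨c, hc⟩

lemma isGaussSolution_gaussSeries {A B D : ℂ} (hA : ∀ n : ℤ, A ≠ n) (hB : ∀ n : ℤ, B ≠ n)
    (hD : ∀ n : ℤ, D ≠ n) :
    IsGaussSolution A B D (gaussSeries A B D) (gaussSeries (1 + A) (1 + B) (1 + D))
      (gaussSeries (1 + (1 + A)) (1 + (1 + B)) (1 + (1 + D))) where
  hasDerivAt _ hz := hasDerivAt_gaussSeries hA hB hD (norm_lt_one_of_mem_ball hz)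
  hasDerivAt' _ hz := hasDerivAt_gaussSeries (not_int_one_add hA) (not_int_one_add hB)
    (not_int_one_add hD) (norm_lt_one_of_mem_ball hz)
  ode _ hz := gaussSeries_ode hA hB hD (norm_lt_one_of_mem_ball hz)

lemma isGaussSolution_gaussSeries_one_sub {A B C D : ℂ} (hCD : C + D = A + B + 1)
    (hA : ∀ n : ℤ, A ≠ n) (hB : ∀ n : ℤ, B ≠ n) (hC : ∀ n : ℤ, C ≠ n) :
    IsGaussSolution A B D (fun z => gaussSeries A B C (1 - z))
      (fun z => -gaussSeries (1 + A) (1 + B) (1 + C) (1 - z))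
      (fun z => gaussSeries (1 + (1 + A)) (1 + (1 + B)) (1 + (1 + C)) (1 - z)) where
  hasDerivAt z hz := by
    exact (hasDerivAt_gaussSeries hA hB hC
      (norm_lt_one_of_mem_ball (one_sub_mem_ball hz))).comp_const_sub 1 z
  hasDerivAt' z hz := by
    have h := ((hasDerivAt_gaussSeries (not_int_one_add hA) (not_int_one_add hB)
      (not_int_one_add hC)
      (norm_lt_one_of_mem_ball (one_sub_mem_ball hz))).comp_const_sub 1 z).fun_neg
    rwa [neg_neg] at h
  ode z hz := by
    have h := gaussSeries_ode hA hB hC (norm_lt_one_of_mem_ball (one_sub_mem_ball hz))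
    have hD : D = A + B + 1 - C := by linear_combination hCD
    subst hD
    linear_combination h

lemma isGaussSolution_cpow_mul {A B C D : ℂ} (hCD : C + D = A + B + 1)
    (hA : ∀ n : ℤ, C - A ≠ n) (hB : ∀ n : ℤ, C - B ≠ n) (hD : ∀ n : ℤ, C - A - B ≠ n) :
    ∃ y'' : ℂ → ℂ, IsGaussSolution A B D
      (fun z => z ^ (C - A - B) * gaussSeries (C - A) (C - B) (1 + (C - A - B)) z)
      (fun z => z ^ (C - A - B) * ((C - A - B) / z *
        gaussSeries (C - A) (C - B) (1 + (C - A - B)) z +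
        gaussSeries (1 + (C - A)) (1 + (C - B)) (1 + (1 + (C - A - B))) z)) y'' := by
  have hs := isGaussSolution_gaussSeries hA hB (not_int_one_add hD)
  set Y := gaussSeries (C - A) (C - B) (1 + (C - A - B))
  set Y' := gaussSeries (1 + (C - A)) (1 + (C - B)) (1 + (1 + (C - A - B)))
  set Y'' := gaussSeries (1 + (1 + (C - A))) (1 + (1 + (C - B))) (1 + (1 + (1 + (C - A - B))))
  refine ⟨fun z => z ^ (C - A - B) * ((C - A - B) * (C - A - B - 1) / z ^ 2 * Y z +
    2 * (C - A - B) / z * Y' z + Y'' z), ?_, ?_, ?_⟩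
  · intro z hz
    have hz0 : z ≠ 0 := Complex.slitPlane_ne_zero (mem_slitPlane_of_mem_ball hz)
    have h1 := (hasDerivAt_id z).cpow_const (c := C - A - B) (mem_slitPlane_of_mem_ball hz)
    refine (h1.mul (hs.hasDerivAt z hz)).congr_deriv ?_
    simp only [id, Complex.cpow_sub _ _ hz0, Complex.cpow_one]
    field_simp
  · intro z hz
    have hz0 : z ≠ 0 := Complex.slitPlane_ne_zero (mem_slitPlane_of_mem_ball hz)
    have h1 := (hasDerivAt_id z).cpow_const (c := C - A - B) (mem_slitPlane_of_mem_ball hz)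
    have h2 := ((hasDerivAt_const z (C - A - B)).div (hasDerivAt_id z) hz0)
    refine (h1.mul ((h2.mul (hs.hasDerivAt z hz)).add (hs.hasDerivAt' z hz))).congr_deriv ?_
    simp only [Pi.mul_apply, Pi.add_apply, Pi.div_apply, id, Complex.cpow_sub _ _ hz0, Complex.cpow_one]
    field_simp
    ring
  · intro z hz
    have hz0 : z ≠ 0 := Complex.slitPlane_ne_zero (mem_slitPlane_of_mem_ball hz)
    have h := hs.ode z hz
    have hD : D = A + B + 1 - C := by linear_combination hCD
    subst hD
    field_simp
    linear_combination z ^ (C - A - B) * z * h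

lemma tendsto_gaussSeries_zero {A B D : ℂ} (hA : ∀ n : ℤ, A ≠ n) (hB : ∀ n : ℤ, B ≠ n)
    (hD : ∀ n : ℤ, D ≠ n) :
    Tendsto (fun t : ℝ => gaussSeries A B D t) (𝓝[>] 0)
      (𝓝 (Complex.Gamma A * Complex.Gamma B / Complex.Gamma D)) := by
  rw [← gaussSeries_zero]
  have h := (hasDerivAt_gaussSeries hA hB hD (z := ((0 : ℝ) : ℂ)) (by simp)).continuousAt
  have h' := h.tendsto.comp (Complex.continuous_ofReal.tendsto 0)
  simpa [Function.comp_def] using h'.mono_left nhdsWithin_le_nhds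

lemma tendsto_gaussSeries_one {A B D : ℂ} (hA : ∀ n : ℤ, A ≠ n) (hB : ∀ n : ℤ, B ≠ n)
    (hD : ∀ n : ℤ, D ≠ n) (h : 0 < (D - A - B).re) :
    Tendsto (fun t : ℝ => gaussSeries A B D t) (𝓝[<] 1) (𝓝 (gaussSeries A B D 1)) := by
  have h1 := (continuousOn_gaussSeries hA hB hD h) ((1 : ℝ) : ℂ) (by simp)
  have h2 : Tendsto (fun t : ℝ => (t : ℂ)) (𝓝[<] 1) (𝓝[Metric.closedBall 0 1] ((1 : ℝ) : ℂ)) := by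
    refine tendsto_nhdsWithin_iff.2
      ⟨(Complex.continuous_ofReal.tendsto 1).mono_left nhdsWithin_le_nhds, ?_⟩
    filter_upwards [Ioo_mem_nhdsLT (show (0 : ℝ) < 1 by norm_num)] with t ht
    simp only [mem_closedBall_zero_iff, Complex.norm_real, Real.norm_eq_abs]
    exact abs_le.2 ⟨by linarith [ht.1], ht.2.le⟩
  simpa [Function.comp_def] using h1.tendsto.comp h2

lemma tendsto_one_sub_nhdsGT : Tendsto (fun t : ℝ => 1 - t) (𝓝[>] 0) (𝓝[<] 1) := by
  refine tendsto_nhdsWithin_iff.2 ⟨?_, ?_⟩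
  · have : Tendsto (fun t : ℝ => 1 - t) (𝓝 0) (𝓝 (1 - 0)) :=
      tendsto_const_nhds.sub tendsto_id
    simpa using this.mono_left nhdsWithin_le_nhds
  · filter_upwards [self_mem_nhdsWithin] with t ht
    simpa using ht

lemma tendsto_one_sub_nhdsLT : Tendsto (fun t : ℝ => 1 - t) (𝓝[<] 1) (𝓝[>] 0) := by
  refine tendsto_nhdsWithin_iff.2 ⟨?_, ?_⟩
  · have : Tendsto (fun t : ℝ => 1 - t) (𝓝 1) (𝓝 (1 - 1)) :=
      tendsto_const_nhds.sub tendsto_id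
    simpa using this.mono_left nhdsWithin_le_nhds
  · filter_upwards [self_mem_nhdsWithin] with t ht
    simpa using ht

lemma eq_mul_gaussSeries_add {A B C D : ℂ} (hCD : C + D = A + B + 1)
    (hA : ∀ n : ℤ, A ≠ n) (hB : ∀ n : ℤ, B ≠ n) (hC : ∀ n : ℤ, C ≠ n) (hD : ∀ n : ℤ, D ≠ n)
    (hCA : ∀ n : ℤ, C - A ≠ n) (hCB : ∀ n : ℤ, C - B ≠ n) (hCAB : ∀ n : ℤ, C - A - B ≠ n) :
    ∃ α β : ℂ, ∀ t : ℝ, 0 < t → t < 1 → gaussSeries A B C (1 - t) =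
      α * gaussSeries A B D t +
        β * ((t : ℂ) ^ (C - A - B) * gaussSeries (C - A) (C - B) (1 + (C - A - B)) t) := by
  obtain ⟨w, hw⟩ := isGaussSolution_cpow_mul hCD hCA hCB hCAB
  have hu := isGaussSolution_gaussSeries_one_sub hCD hA hB hC
  have hv := isGaussSolution_gaussSeries hA hB hD
  obtain ⟨c₀, h₀⟩ := hv.exists_wronskian hCD hw
  obtain ⟨c₁, h₁⟩ := hw.exists_wronskian hCD hu
  obtain ⟨c₂, h₂⟩ := hu.exists_wronskian hCD hv
  have hc₀ : c₀ ≠ 0 := by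
    have hlim : Tendsto (fun t : ℝ => (1 - t : ℂ) ^ C * (gaussSeries A B D t *
        ((C - A - B) * gaussSeries (C - A) (C - B) (1 + (C - A - B)) t +
          t * gaussSeries (1 + (C - A)) (1 + (C - B)) (1 + (1 + (C - A - B))) t) -
        t * gaussSeries (C - A) (C - B) (1 + (C - A - B)) t *
          gaussSeries (1 + A) (1 + B) (1 + D) t)) (𝓝[>] 0)
        (𝓝 (1 * (Complex.Gamma A * Complex.Gamma B / Complex.Gamma D * ((C - A - B) *
          (Complex.Gamma (C - A) * Complex.Gamma (C - B) / Complex.Gamma (1 + (C - A - B))) +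
          0 * (Complex.Gamma (1 + (C - A)) * Complex.Gamma (1 + (C - B)) /
            Complex.Gamma (1 + (1 + (C - A - B))))) -
          0 * (Complex.Gamma (C - A) * Complex.Gamma (C - B) / Complex.Gamma (1 + (C - A - B))) *
          (Complex.Gamma (1 + A) * Complex.Gamma (1 + B) / Complex.Gamma (1 + D))))) := by
      have ht : Tendsto (fun t : ℝ => (t : ℂ)) (𝓝[>] 0) (𝓝 0) := by
        simpa using (Complex.continuous_ofReal.tendsto 0).mono_left nhdsWithin_le_nhds
      have hp : Tendsto (fun t : ℝ => (1 - t : ℂ) ^ C) (𝓝[>] 0) (𝓝 1) := by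
        have : ContinuousAt (fun z : ℂ => (1 - z) ^ C) 0 :=
          ContinuousAt.cpow (by fun_prop) continuousAt_const (by simp)
        simpa [Function.comp_def] using this.tendsto.comp ht
      have hY := tendsto_gaussSeries_zero hCA hCB (not_int_one_add hCAB)
      exact hp.mul (((tendsto_gaussSeries_zero hA hB hD).mul ((hY.const_mul _).add
        (ht.mul (tendsto_gaussSeries_zero (not_int_one_add hCA) (not_int_one_add hCB)
          (not_int_one_add (not_int_one_add hCAB)))))).sub
        ((ht.mul hY).mul (tendsto_gaussSeries_zero (not_int_one_add hA) (not_int_one_add hB)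
          (not_int_one_add hD))))
    have hconst : Tendsto (fun _ : ℝ => c₀) (𝓝[>] 0) (𝓝 c₀) := tendsto_const_nhds
    have := tendsto_nhds_unique (hconst.congr' ?_) hlim
    · rw [this]
      simp only [zero_mul, add_zero, sub_zero, one_mul]
      exact mul_ne_zero (div_ne_zero (mul_ne_zero (Gamma_ne_zero_of_not_int hA)
        (Gamma_ne_zero_of_not_int hB)) (Gamma_ne_zero_of_not_int hD))
        (mul_ne_zero (ne_zero_of_not_int hCAB) (div_ne_zero (mul_ne_zero
          (Gamma_ne_zero_of_not_int hCA) (Gamma_ne_zero_of_not_int hCB))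
          (Gamma_ne_zero_of_not_int (not_int_one_add hCAB))))
    · filter_upwards [Ioo_mem_nhdsGT (show (0 : ℝ) < 1 by norm_num)] with t ht
      rw [← h₀ t (ofReal_mem_ball ht.1 ht.2)]
      have ht0 : (t : ℂ) ≠ 0 := by exact_mod_cast ht.1.ne'
      have hDe : (t : ℂ) ^ D = t / (t : ℂ) ^ (C - A - B) := by
        rw [show D = 1 - (C - A - B) by linear_combination hCD, Complex.cpow_sub _ _ ht0,
          Complex.cpow_one]
      have hne : (t : ℂ) ^ (C - A - B) ≠ 0 := by simp [Complex.cpow_eq_zero_iff, ht0]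
      rw [hDe]
      field_simp
  refine ⟨-c₁ / c₀, -c₂ / c₀, fun t ht0 ht1 => ?_⟩
  have hm := ofReal_mem_ball ht0 ht1
  rw [← sub_eq_zero]
  have e0 := h₀ t hm
  have e1 := h₁ t hm
  have e2 := h₂ t hm
  field_simp
  rw [← e0, ← e1, ← e2]
  ring

lemma two_mul_Sn_mul_Sn (x y : ℂ) :
    2 * (Sn x * Sn y) = Complex.cos (Real.pi * (x - y)) - Complex.cos (Real.pi * (x + y)) := by
  simp only [Sn, mul_sub, mul_add, Complex.cos_sub, Complex.cos_add]
  ring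

lemma Sn_mul_Sn_sub (A B C : ℂ) :
    Sn C * Sn (C - A - B) = Sn (C - A) * Sn (C - B) - Sn A * Sn B := by
  have h1 := two_mul_Sn_mul_Sn C (C - A - B)
  have h2 := two_mul_Sn_mul_Sn (C - A) (C - B)
  have h3 := two_mul_Sn_mul_Sn A B
  rw [show C - (C - A - B) = A + B by ring, show C + (C - A - B) = C - A + (C - B) by ring] at h1
  rw [show C - A - (C - B) = -(A - B) by ring, mul_neg, Complex.cos_neg] at h2
  linear_combination (h1 - h2 + h3) / 2

lemma Gamma_mul_Gamma_one_sub_eq {z w : ℂ} (h : z + w = 1) :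
    Complex.Gamma z * Complex.Gamma w = Real.pi / Sn z := by
  rw [show w = 1 - z by linear_combination h, Complex.Gamma_mul_Gamma_one_sub, Sn]

/-- The connection formula between the points `1` and `0`. -/
lemma gaussSeries_one_sub {A B C D : ℂ} (hCD : C + D = A + B + 1)
    (hA : ∀ n : ℤ, A ≠ n) (hB : ∀ n : ℤ, B ≠ n) (hC : ∀ n : ℤ, C ≠ n)
    (hCA : ∀ n : ℤ, C - A ≠ n) (hCB : ∀ n : ℤ, C - B ≠ n) (hCAB : ∀ n : ℤ, C - A - B ≠ n)
    (hC0 : 0 < C.re) (hC1 : C.re < 1) (hD0 : 0 < D.re) (hD1 : D.re < 1) {t : ℝ}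
    (ht0 : 0 < t) (ht1 : t < 1) :
    gaussSeries A B C (1 - t) =
      Real.pi / (Sn (C - A - B) * Complex.Gamma (C - A) * Complex.Gamma (C - B)) *
        (gaussSeries A B D t -
          (t : ℂ) ^ (C - A - B) * gaussSeries (C - A) (C - B) (1 + (C - A - B)) t) := by
  have hωD : (C - A - B) + D = 1 := by linear_combination hCD
  have hωre : (C - A - B).re + D.re = 1 := by
    rw [← Complex.add_re, hωD, Complex.one_re]
  have hD : ∀ n : ℤ, D ≠ n := by
    intro n h
    apply hCAB (1 - n)
    push_cast
    linear_combination hωD - h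
  have hneg : ∀ {z w : ℂ}, (∀ n : ℤ, z ≠ n) → w = 1 - z → ∀ n : ℤ, w ≠ n := by
    intro z w hz hw n h
    apply hz (1 - n)
    push_cast
    linear_combination hw - h
  obtain ⟨α, β, h⟩ := eq_mul_gaussSeries_add hCD hA hB hC hD hCA hCB hCAB
  set ω := C - A - B with hω
  have hGA := Gamma_ne_zero_of_not_int hA
  have hGB := Gamma_ne_zero_of_not_int hB
  have hGC := Gamma_ne_zero_of_not_int hC
  have hGD := Gamma_ne_zero_of_not_int hD
  have hGω := Gamma_ne_zero_of_not_int hCAB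
  have hGCA := Gamma_ne_zero_of_not_int hCA
  have hGCB := Gamma_ne_zero_of_not_int hCB
  have hpi : (Real.pi : ℂ) ≠ 0 := by exact_mod_cast Real.pi_ne_zero
  have hSω := Sn_ne_zero hCAB
  have hSC := Sn_ne_zero hC
  have hSA := Sn_ne_zero hA
  have hSB := Sn_ne_zero hB
  have ht : Tendsto (fun t : ℝ => (t : ℂ)) (𝓝[>] 0) (𝓝 0) := by
    simpa using (Complex.continuous_ofReal.tendsto 0).mono_left nhdsWithin_le_nhds
  have hα : α = Real.pi / (Sn ω * Complex.Gamma (C - A) * Complex.Gamma (C - B)) := by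
    have hp : Tendsto (fun t : ℝ => (t : ℂ) ^ ω) (𝓝[>] 0) (𝓝 0) := by
      have hc := (Complex.continuousAt_cpow_const_of_re_pos (z := 0) (w := ω) (by simp)
        (by linarith)).tendsto.comp ht
      simpa [Function.comp_def, ne_zero_of_not_int hCAB] using hc
    have hl := ((tendsto_gaussSeries_zero hA hB hD).const_mul α).add
      ((hp.mul (tendsto_gaussSeries_zero hCA hCB (not_int_one_add hCAB))).const_mul β)
    have hu := (tendsto_gaussSeries_one hA hB hC (by rw [← hω]; linarith)).comp
      tendsto_one_sub_nhdsGT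
    have := tendsto_nhds_unique (hu.congr' ?_) hl
    · rw [gaussSeries_one hA hB hC hCA hCB hCAB hC0 (by rw [← hω]; linarith), ← hω] at this
      have hr := Gamma_mul_Gamma_one_sub_eq hωD
      simp only [zero_mul, mul_zero, add_zero] at this
      field_simp at this hr ⊢
      linear_combination (-Sn ω) * this + hr
    · filter_upwards [Ioo_mem_nhdsGT (show (0 : ℝ) < 1 by norm_num)] with t ht
      rw [← h t ht.1 ht.2]
      simp
  have hβ : β = -α := by
    have hp : Tendsto (fun t : ℝ => (t : ℂ) ^ ω) (𝓝[<] 1) (𝓝 1) := by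
      have h1 : Tendsto (fun t : ℝ => (t : ℂ)) (𝓝[<] 1) (𝓝 ((1 : ℝ) : ℂ)) :=
        (Complex.continuous_ofReal.tendsto 1).mono_left nhdsWithin_le_nhds
      have hc := (continuousAt_cpow_const (a := ((1 : ℝ) : ℂ)) (b := ω) (by simp)).tendsto.comp h1
      simpa [Function.comp_def] using hc
    have e1 : D - A - B = 1 - C := by linear_combination hCD
    have e2 : 1 + ω - (C - A) - (C - B) = 1 - C := by rw [hω]; ring
    have hr1 : 0 < (1 - C).re := by
      simp only [Complex.sub_re, Complex.one_re]
      linarith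
    have hD' : 0 < (1 + ω).re := by
      simp only [Complex.add_re, Complex.one_re]
      linarith
    have hl := ((tendsto_gaussSeries_one hA hB hD (by rwa [e1])).const_mul α).add
      ((hp.mul (tendsto_gaussSeries_one hCA hCB (not_int_one_add hCAB)
        (by rwa [e2]))).const_mul β)
    have hu := (tendsto_gaussSeries_zero hA hB hC).comp tendsto_one_sub_nhdsLT
    have := tendsto_nhds_unique (hu.congr' ?_) hl
    · rw [gaussSeries_one hA hB hD (hneg hCB (by linear_combination hCD))
        (hneg hCA (by linear_combination hCD)) (hneg hC e1) hD0 (by rwa [e1]), e1,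
        gaussSeries_one hCA hCB (not_int_one_add hCAB) (hneg hB (by rw [hω]; ring))
        (hneg hA (by rw [hω]; ring)) (hneg hC e2) hD' (by rwa [e2]), e2] at this
      have r1 := Gamma_mul_Gamma_one_sub_eq (show A + (1 + ω - (C - B)) = 1 by rw [hω]; ring)
      have r2 := Gamma_mul_Gamma_one_sub_eq (show B + (1 + ω - (C - A)) = 1 by rw [hω]; ring)
      have r3 := Gamma_mul_Gamma_one_sub_eq (show (C - A) + (D - B) = 1 by linear_combination hCD)
      have r4 := Gamma_mul_Gamma_one_sub_eq (show (C - B) + (D - A) = 1 by linear_combination hCD)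
      have r5 := Gamma_mul_Gamma_one_sub_eq (show C + (1 - C) = 1 by ring)
      have tr := Sn_mul_Sn_sub A B C
      rw [← hω] at tr
      have q1 : Complex.Gamma (1 + ω - (C - B)) = Real.pi / Sn A / Complex.Gamma A := by
        rw [← r1]; field_simp
      have q2 : Complex.Gamma (1 + ω - (C - A)) = Real.pi / Sn B / Complex.Gamma B := by
        rw [← r2]; field_simp
      have q3 : Complex.Gamma (D - B) = Real.pi / Sn (C - A) / Complex.Gamma (C - A) := by
        rw [← r3]; field_simp
      have q4 : Complex.Gamma (D - A) = Real.pi / Sn (C - B) / Complex.Gamma (C - B) := by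
        rw [← r4]; field_simp
      have q5 : Complex.Gamma (1 - C) = Real.pi / Sn C / Complex.Gamma C := by
        rw [← r5]; field_simp
      have hSCA := Sn_ne_zero hCA
      have hSCB := Sn_ne_zero hCB
      rw [q1, q2, q3, q4, q5] at this
      rw [hα] at this ⊢
      field_simp at this ⊢
      refine mul_left_cancel₀ (mul_ne_zero hSA hSB) ?_
      linear_combination -this + Real.pi * tr
    · filter_upwards [Ioo_mem_nhdsLT (show (0 : ℝ) < 1 by norm_num)] with t ht
      rw [← h t ht.1 ht.2]
      simp
  rw [h t ht0 ht1, hβ, hα]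
  ring

lemma hasSum_integral_tsum_pow_mul {c : ℕ → ℂ} (hc : Summable fun k => ‖c k‖) {p : ℝ → ℂ}
    (hp : Continuous p) (hp1 : ∀ x ∈ Set.Ioo (0 : ℝ) 1, ‖p x‖ ≤ 1) {w : ℝ → ℂ}
    (hw : MeasureTheory.IntegrableOn w (Set.Ioo 0 1)) :
    HasSum (fun k => c k * ∫ x in Set.Ioo (0 : ℝ) 1, p x ^ k * w x)
      (∫ x in Set.Ioo (0 : ℝ) 1, (∑' k, c k * p x ^ k) * w x) := by
  have hb : ∀ k : ℕ, ∀ x ∈ Set.Ioo (0 : ℝ) 1, ‖p x ^ k * w x‖ ≤ ‖w x‖ := fun k x hx => by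
    rw [norm_mul, norm_pow]
    exact mul_le_of_le_one_left (norm_nonneg _) (pow_le_one₀ (norm_nonneg _) (hp1 x hx))
  have hi : ∀ k : ℕ, MeasureTheory.IntegrableOn (fun x => p x ^ k * w x) (Set.Ioo 0 1) :=
    fun k => MeasureTheory.Integrable.mono hw
      ((hp.pow k).aestronglyMeasurable.mul hw.aestronglyMeasurable)
      ((MeasureTheory.ae_restrict_iff' measurableSet_Ioo).2 (Eventually.of_forall (hb k)))
  have hsum : Summable fun k => ∫ x in Set.Ioo (0 : ℝ) 1, ‖c k * (p x ^ k * w x)‖ := by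
    refine Summable.of_nonneg_of_le
      (fun k => MeasureTheory.integral_nonneg fun x => norm_nonneg _) (fun k => ?_)
      (hc.mul_right (∫ x in Set.Ioo (0 : ℝ) 1, ‖w x‖))
    simp only [norm_mul (c k)]
    rw [MeasureTheory.integral_const_mul]
    exact mul_le_mul_of_nonneg_left (MeasureTheory.setIntegral_mono_on (hi k).norm hw.norm
      measurableSet_Ioo (hb k)) (norm_nonneg _)
  have h := MeasureTheory.hasSum_integral_of_summable_integral_norm
    (F := fun k x => c k * (p x ^ k * w x)) (fun k => (hi k).const_mul (c k)) hsum
  simp only [MeasureTheory.integral_const_mul] at h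
  have he : (fun x => (∑' k, c k * p x ^ k) * w x) =
      fun x => ∑' k, c k * (p x ^ k * w x) := by
    ext x
    rw [← tsum_mul_right]
    exact tsum_congr fun k => by ring
  rw [he]
  exact h

lemma betaIntegral_eq_setIntegral (u v : ℂ) : Complex.betaIntegral u v =
    ∫ x in Set.Ioo (0 : ℝ) 1, (x : ℂ) ^ (u - 1) * (1 - (x : ℂ)) ^ (v - 1) := by
  rw [Complex.betaIntegral, intervalIntegral.integral_of_le zero_le_one,
    MeasureTheory.integral_Ioc_eq_integral_Ioo]

lemma integrableOn_cpow_mul_one_sub_cpow {u v : ℂ} (hu : 0 < u.re) (hv : 0 < v.re) :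
    MeasureTheory.IntegrableOn
      (fun x : ℝ => (x : ℂ) ^ (u - 1) * (1 - (x : ℂ)) ^ (v - 1)) (Set.Ioo 0 1) := by
  have h := Complex.betaIntegral_convergent hu hv
  rw [intervalIntegrable_iff_integrableOn_Ioc_of_le zero_le_one] at h
  exact h.mono_set Set.Ioo_subset_Ioc_self

lemma norm_ofReal_le_one_of_mem_Icc {x : ℝ} (hx : x ∈ Set.Icc (0 : ℝ) 1) : ‖(x : ℂ)‖ ≤ 1 := by
  rw [Complex.norm_real, Real.norm_of_nonneg hx.1]
  exact hx.2

lemma norm_one_sub_ofReal_le_one_of_mem_Icc {x : ℝ} (hx : x ∈ Set.Icc (0 : ℝ) 1) :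
    ‖1 - (x : ℂ)‖ ≤ 1 := by
  rw [show (1 : ℂ) - x = ((1 - x : ℝ) : ℂ) by push_cast; ring]
  exact norm_ofReal_le_one_of_mem_Icc ⟨by linarith [hx.2], by linarith [hx.1]⟩

lemma integral_cpow_mul_gaussSeries {A B C s : ℂ}
    (hA : ∀ n : ℤ, A ≠ n) (hB : ∀ n : ℤ, B ≠ n) (hC : ∀ n : ℤ, C ≠ n)
    (hC0 : 0 < C.re) (hs : 0 < s.re) (hre : 0 < (C - A - B).re)
    (h1 : ∀ n : ℤ, s + C ≠ n) (h2 : ∀ n : ℤ, s + C - A ≠ n) (h3 : ∀ n : ℤ, s + C - B ≠ n)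
    (h4 : ∀ n : ℤ, s + C - A - B ≠ n) :
    ∫ x in Set.Ioo (0 : ℝ) 1, gaussSeries A B C (1 - x) *
        ((x : ℂ) ^ (s - 1) * (1 - (x : ℂ)) ^ (C - 1)) =
      Complex.Gamma s * (Complex.Gamma A * Complex.Gamma B * Complex.Gamma (s + C - A - B) /
        (Complex.Gamma (s + C - A) * Complex.Gamma (s + C - B))) := by
  have hsC : 0 < (s + C - A - B).re := by
    simp only [Complex.sub_re, Complex.add_re] at hre ⊢
    linarith
  have h := hasSum_integral_tsum_pow_mul (summable_gaussCoeff hA hB hC hre)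
    (p := fun x : ℝ => 1 - (x : ℂ)) (by fun_prop) (fun x hx => ?_)
    (integrableOn_cpow_mul_one_sub_cpow hs hC0)
  · rw [← gaussSeries_one hA hB h1 h2 h3 h4 (by simpa using add_pos hs hC0) hsC]
    have hG : HasSum (fun k => Complex.Gamma s * gaussCoeff A B (s + C) k)
        (Complex.Gamma s * gaussSeries A B (s + C) 1) := by
      have := (summable_gaussCoeff hA hB h1 hsC).of_norm.hasSum.mul_left (Complex.Gamma s)
      simpa [gaussSeries] using this
    refine h.unique (hG.congr_fun fun k => ?_)
    have hk : ∫ x in Set.Ioo (0 : ℝ) 1, (1 - (x : ℂ)) ^ k *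
        ((x : ℂ) ^ (s - 1) * (1 - (x : ℂ)) ^ (C - 1)) = Complex.betaIntegral s (k + C) := by
      rw [betaIntegral_eq_setIntegral]
      refine MeasureTheory.setIntegral_congr_fun measurableSet_Ioo fun x hx => ?_
      have hx0 : (1 - (x : ℂ)) ≠ 0 := by
        rw [sub_ne_zero]
        exact_mod_cast hx.2.ne'
      rw [show (k : ℂ) + C - 1 = k + (C - 1) by ring, Complex.cpow_add _ _ hx0,
        Complex.cpow_natCast]
      ring
    have hkC : 0 < ((k : ℂ) + C).re := by
      simpa using add_pos_of_nonneg_of_pos (Nat.cast_nonneg k) hC0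
    rw [hk, Complex.betaIntegral_eq_Gamma_mul_div _ _ hs hkC, gaussCoeff, gaussCoeff,
      show s + (k + C) = k + (s + C) by ring]
    have := Gamma_natCast_add_ne_zero hC k
    have := Gamma_natCast_add_ne_zero h1 k
    have : (k.factorial : ℂ) ≠ 0 := by exact_mod_cast k.factorial_ne_zero
    field_simp
  · exact norm_one_sub_ofReal_le_one_of_mem_Icc (Set.Ioo_subset_Icc_self hx)

lemma integrableOn_gaussSeries_comp_mul {A B C : ℂ}
    (hA : ∀ n : ℤ, A ≠ n) (hB : ∀ n : ℤ, B ≠ n) (hC : ∀ n : ℤ, C ≠ n)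
    (hre : 0 < (C - A - B).re) {p : ℝ → ℂ} (hp : Continuous p)
    (hp1 : ∀ x ∈ Set.Icc (0 : ℝ) 1, ‖p x‖ ≤ 1) {w : ℝ → ℂ}
    (hw : MeasureTheory.IntegrableOn w (Set.Ioo 0 1)) :
    MeasureTheory.IntegrableOn (fun x : ℝ => gaussSeries A B C (p x) * w x) (Set.Ioo 0 1) := by
  rw [← integrableOn_Icc_iff_integrableOn_Ioo] at hw ⊢
  refine hw.continuousOn_mul ?_ isCompact_Icc
  refine (continuousOn_gaussSeries hA hB hC hre).comp hp.continuousOn fun x hx => ?_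
  rw [mem_closedBall_zero_iff]
  exact hp1 x hx

lemma integrableOn_gaussSeries_one_sub_mul {A B C : ℂ}
    (hA : ∀ n : ℤ, A ≠ n) (hB : ∀ n : ℤ, B ≠ n) (hC : ∀ n : ℤ, C ≠ n)
    (hre : 0 < (C - A - B).re) {w : ℝ → ℂ} (hw : MeasureTheory.IntegrableOn w (Set.Ioo 0 1)) :
    MeasureTheory.IntegrableOn (fun x : ℝ => gaussSeries A B C (1 - x) * w x) (Set.Ioo 0 1) :=
  integrableOn_gaussSeries_comp_mul hA hB hC hre (p := fun x : ℝ => 1 - (x : ℂ)) (by fun_prop)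
    (fun _ hx => norm_one_sub_ofReal_le_one_of_mem_Icc hx) hw

lemma integral_gaussSeries_mul_gaussSeries_one_sub {A B C a b e s : ℂ}
    (hA : ∀ n : ℤ, A ≠ n) (hB : ∀ n : ℤ, B ≠ n) (hC : ∀ n : ℤ, C ≠ n)
    (ha : ∀ n : ℤ, a ≠ n) (hb : ∀ n : ℤ, b ≠ n) (he : ∀ n : ℤ, e ≠ n)
    (hC0 : 0 < C.re) (hs : 0 < s.re) (hre : 0 < (C - A - B).re) (hre' : 0 < (e - a - b).re)
    (h1 : ∀ n : ℤ, s + C ≠ n) (h2 : ∀ n : ℤ, s + C - A ≠ n) (h3 : ∀ n : ℤ, s + C - B ≠ n)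
    (h4 : ∀ n : ℤ, s + C - A - B ≠ n) :
    ∫ x in Set.Ioo (0 : ℝ) 1, gaussSeries a b e x * (gaussSeries A B C (1 - x) *
        ((x : ℂ) ^ (s - 1) * (1 - (x : ℂ)) ^ (C - 1))) =
      Complex.Gamma A * Complex.Gamma B *
        Fstar a b s (s + C - A - B) e (s + C - A) (s + C - B) := by
  have h := hasSum_integral_tsum_pow_mul (summable_gaussCoeff ha hb he hre')
    (p := fun x : ℝ => (x : ℂ)) (by fun_prop) (fun x hx => ?_)
    (integrableOn_gaussSeries_one_sub_mul hA hB hC hre (integrableOn_cpow_mul_one_sub_cpow hs hC0))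
  · rw [show (∫ x in Set.Ioo (0 : ℝ) 1, gaussSeries a b e x * (gaussSeries A B C (1 - x) *
        ((x : ℂ) ^ (s - 1) * (1 - (x : ℂ)) ^ (C - 1)))) = _ from h.tsum_eq.symm, Fstar,
      ← tsum_mul_left]
    refine tsum_congr fun k => ?_
    have hk : ∫ x in Set.Ioo (0 : ℝ) 1, (x : ℂ) ^ k * (gaussSeries A B C (1 - x) *
        ((x : ℂ) ^ (s - 1) * (1 - (x : ℂ)) ^ (C - 1))) =
        ∫ x in Set.Ioo (0 : ℝ) 1, gaussSeries A B C (1 - x) *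
        ((x : ℂ) ^ (k + s - 1) * (1 - (x : ℂ)) ^ (C - 1)) := by
      refine MeasureTheory.setIntegral_congr_fun measurableSet_Ioo fun x hx => ?_
      have hx0 : (x : ℂ) ≠ 0 := by exact_mod_cast hx.1.ne'
      rw [show (k : ℂ) + s - 1 = k + (s - 1) by ring, Complex.cpow_add _ _ hx0,
        Complex.cpow_natCast]
      ring
    have e1 : (k + s + C : ℂ) = k + (s + C) := by ring
    have e2 : (k + s + C - A : ℂ) = k + (s + C - A) := by ring
    have e3 : (k + s + C - B : ℂ) = k + (s + C - B) := by ring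
    have e4 : (k + s + C - A - B : ℂ) = k + (s + C - A - B) := by ring
    have hks : 0 < ((k : ℂ) + s).re := by
      simpa using add_pos_of_nonneg_of_pos (Nat.cast_nonneg k) hs
    rw [hk, integral_cpow_mul_gaussSeries hA hB hC hC0 hks hre
      (by rw [e1]; exact not_int_natCast_add h1 k) (by rw [e2]; exact not_int_natCast_add h2 k)
      (by rw [e3]; exact not_int_natCast_add h3 k) (by rw [e4]; exact not_int_natCast_add h4 k),
      e4, e2, e3, gaussCoeff]
    have := Gamma_natCast_add_ne_zero h2 k
    have := Gamma_natCast_add_ne_zero h3 k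
    have := Gamma_natCast_add_ne_zero he k
    have : (k.factorial : ℂ) ≠ 0 := by exact_mod_cast k.factorial_ne_zero
    field_simp
  · exact norm_ofReal_le_one_of_mem_Icc (Set.Ioo_subset_Icc_self hx)

lemma integral_gaussSeries_mul_gaussSeries {A B C a b e s : ℂ} (hCe : C + e = a + b + 1)
    (hA : ∀ n : ℤ, A ≠ n) (hB : ∀ n : ℤ, B ≠ n) (hC : ∀ n : ℤ, C ≠ n)
    (ha : ∀ n : ℤ, a ≠ n) (hb : ∀ n : ℤ, b ≠ n) (he : ∀ n : ℤ, e ≠ n)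
    (hea : ∀ n : ℤ, a - e ≠ n) (heb : ∀ n : ℤ, b - e ≠ n)
    (hC0 : 0 < C.re) (hC1 : C.re < 1) (he0 : 0 < e.re) (he1 : e.re < 1)
    (hs : 0 < s.re) (hre : 0 < (C - A - B).re)
    (h1 : ∀ n : ℤ, s + C ≠ n) (h2 : ∀ n : ℤ, s + C - A ≠ n) (h3 : ∀ n : ℤ, s + C - B ≠ n)
    (h4 : ∀ n : ℤ, s + C - A - B ≠ n)
    (h1' : ∀ n : ℤ, s + C - e ≠ n) (h2' : ∀ n : ℤ, s + C - A - e ≠ n)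
    (h3' : ∀ n : ℤ, s + C - B - e ≠ n) (h4' : ∀ n : ℤ, s + C - A - B - e ≠ n)
    (hse : ∀ n : ℤ, s - e ≠ n) :
    ∫ x in Set.Ioo (0 : ℝ) 1, gaussSeries a b C (1 - x) * (gaussSeries A B C (1 - x) *
        ((x : ℂ) ^ (s - 1) * (1 - (x : ℂ)) ^ (C - 1))) =
      Real.pi * (Complex.Gamma A * Complex.Gamma B * Complex.Gamma a * Complex.Gamma b) *
        (Complex.Gamma s * Complex.Gamma (1 + s - e) * Complex.Gamma (s + C - A - B) *
        Complex.Gamma (1 + (s + C - A - B) - e)) *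
        Lf a b s (s + C - A - B) e (s + C - A) (s + C - B) := by
  have hCa : ∀ n : ℤ, C - a ≠ n := fun n h =>
    not_int_one_add_sub heb n (by linear_combination h - hCe)
  have hCb : ∀ n : ℤ, C - b ≠ n := fun n h =>
    not_int_one_add_sub hea n (by linear_combination h - hCe)
  have hω : C - a - b = 1 - e := by linear_combination hCe
  have hCab : ∀ n : ℤ, C - a - b ≠ n := by
    rw [hω]
    exact fun n h => not_int_one_add (not_int_neg he) n (by linear_combination h)
  have hse0 : 0 < (s + (1 - e)).re := by
    simp only [Complex.add_re, Complex.sub_re, Complex.one_re]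
    linarith
  have i0 := integrableOn_gaussSeries_one_sub_mul hA hB hC hre (integrableOn_cpow_mul_one_sub_cpow hs hC0)
  have i1 := integrableOn_gaussSeries_one_sub_mul hA hB hC hre
    (integrableOn_cpow_mul_one_sub_cpow hse0 hC0)
  have hre1 : 0 < (e - a - b).re := by
    rw [show e - a - b = 1 - C by linear_combination hCe]
    simpa using hC1
  have hre2 : 0 < (1 + (C - a - b) - (C - a) - (C - b)).re := by
    rw [show 1 + (C - a - b) - (C - a) - (C - b) = 1 - C by ring]
    simpa using hC1
  have k0 := integral_gaussSeries_mul_gaussSeries_one_sub hA hB hC ha hb he hC0 hs hre hre1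
    h1 h2 h3 h4
  have k1 := integral_gaussSeries_mul_gaussSeries_one_sub hA hB hC hCa hCb (not_int_one_add hCab)
    hC0 hse0 hre hre2 (fun n h => not_int_one_add h1' n (by linear_combination h))
    (fun n h => not_int_one_add h2' n (by linear_combination h))
    (fun n h => not_int_one_add h3' n (by linear_combination h))
    (fun n h => not_int_one_add h4' n (by linear_combination h))
  have j0 := integrableOn_gaussSeries_comp_mul ha hb he hre1 (p := fun x : ℝ => (x : ℂ))
    (by fun_prop) (fun _ hx => norm_ofReal_le_one_of_mem_Icc hx) i0
  have j1 := integrableOn_gaussSeries_comp_mul hCa hCb (not_int_one_add hCab) hre2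
    (p := fun x : ℝ => (x : ℂ)) (by fun_prop) (fun _ hx => norm_ofReal_le_one_of_mem_Icc hx) i1
  have key : ∫ x in Set.Ioo (0 : ℝ) 1, gaussSeries a b C (1 - x) * (gaussSeries A B C (1 - x) *
        ((x : ℂ) ^ (s - 1) * (1 - (x : ℂ)) ^ (C - 1))) =
      ∫ x in Set.Ioo (0 : ℝ) 1,
        Real.pi / (Sn (C - a - b) * Complex.Gamma (C - a) * Complex.Gamma (C - b)) *
        (gaussSeries a b e x * (gaussSeries A B C (1 - x) *
          ((x : ℂ) ^ (s - 1) * (1 - (x : ℂ)) ^ (C - 1))) -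
        gaussSeries (C - a) (C - b) (1 + (C - a - b)) x * (gaussSeries A B C (1 - x) *
          ((x : ℂ) ^ (s + (1 - e) - 1) * (1 - (x : ℂ)) ^ (C - 1)))) := by
    refine MeasureTheory.setIntegral_congr_fun measurableSet_Ioo fun x hx => ?_
    have hx0 : (x : ℂ) ≠ 0 := by exact_mod_cast hx.1.ne'
    rw [gaussSeries_one_sub hCe ha hb hC hCa hCb hCab hC0 hC1 he0 he1 hx.1 hx.2,
      show s + (1 - e) - 1 = (C - a - b) + (s - 1) by rw [hω]; ring, Complex.cpow_add _ _ hx0]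
    ring
  rw [key, MeasureTheory.integral_const_mul, MeasureTheory.integral_sub j0 j1, k0, k1, Lf, hω,
    show C - a = 1 + b - e by linear_combination hCe,
    show C - b = 1 + a - e by linear_combination hCe, Sn_one_sub,
    show s + (1 - e) = 1 + s - e by ring,
    show 1 + s - e + C - A = 1 + (s + C - A) - e by ring,
    show 1 + s - e + C - B = 1 + (s + C - B) - e by ring,
    show 1 + (s + C - A) - e - B = 1 + (s + C - A - B) - e by ring,
    show 1 + (1 - e) = 2 - e by ring]
  have g1 := Gamma_ne_zero_of_not_int ha
  have g2 := Gamma_ne_zero_of_not_int hb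
  have g3 := Gamma_ne_zero_of_not_int (not_int_one_add_sub hea)
  have g4 := Gamma_ne_zero_of_not_int (not_int_one_add_sub heb)
  have g5 := Gamma_ne_zero_of_not_int h4
  have g6 : Complex.Gamma (1 + (s + C - A - B) - e) ≠ 0 :=
    Gamma_ne_zero_of_not_int (not_int_one_add_sub h4')
  have g7 : Complex.Gamma s ≠ 0 := Complex.Gamma_ne_zero_of_re_pos hs
  have g8 := Gamma_ne_zero_of_not_int (not_int_one_add_sub hse)
  have g9 := Sn_ne_zero he
  have hF : Fstar (1 + b - e) (1 + a - e) (1 + s - e) (1 + (s + C - A - B) - e) (2 - e)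
      (1 + (s + C - A) - e) (1 + (s + C - B) - e) =
      Fstar (1 + a - e) (1 + b - e) (1 + s - e) (1 + (s + C - A - B) - e) (2 - e)
      (1 + (s + C - A) - e) (1 + (s + C - B) - e) := by
    unfold Fstar
    exact tsum_congr fun k => by ring
  rw [hF]
  field_simp

/-- Invariance of `L` coming from exchanging the two factors of the product integral. -/
lemma Lf_eq_of_re {a b c d e f g : ℂ} (hsaal : e + f + g = a + b + c + d + 1)
    (ha : ∀ n : ℤ, a ≠ n) (hb : ∀ n : ℤ, b ≠ n) (hc : ∀ n : ℤ, c ≠ n) (hd : ∀ n : ℤ, d ≠ n)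
    (he : ∀ n : ℤ, e ≠ n) (hf : ∀ n : ℤ, f ≠ n) (hg : ∀ n : ℤ, g ≠ n)
    (hae : ∀ n : ℤ, a - e ≠ n) (hbe : ∀ n : ℤ, b - e ≠ n) (hce : ∀ n : ℤ, c - e ≠ n)
    (hde : ∀ n : ℤ, d - e ≠ n) (hcd : ∀ n : ℤ, c - d ≠ n)
    (hfd : ∀ n : ℤ, f - d ≠ n) (hgd : ∀ n : ℤ, g - d ≠ n) (hfc : ∀ n : ℤ, f - c ≠ n)
    (hgc : ∀ n : ℤ, g - c ≠ n) (hfe : ∀ n : ℤ, f - e ≠ n) (hge : ∀ n : ℤ, g - e ≠ n)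
    (hC : ∀ n : ℤ, a + b - e ≠ n) (h1 : ∀ n : ℤ, a + b + c - e ≠ n)
    (h2 : ∀ n : ℤ, a + b + d - e ≠ n) (h3 : ∀ n : ℤ, a + b + c - 2 * e ≠ n)
    (h4 : ∀ n : ℤ, a + c - e ≠ n) (h5 : ∀ n : ℤ, b + c - e ≠ n)
    (h6 : ∀ n : ℤ, a + d - e ≠ n) (h7 : ∀ n : ℤ, b + d - e ≠ n)
    (hC0 : 0 < (1 + a + b - e).re) (hC1 : (1 + a + b - e).re < 1) (he0 : 0 < e.re)
    (he1 : e.re < 1) (hc0 : 0 < c.re) (hcd0 : c.re < d.re) (hcd1 : d.re < 1 + c.re) :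
    Lf a b c d e f g =
      Lf (g - d) (f - d) c (1 + c - e) (1 + c - d) (1 + b + c - e) (1 + a + c - e) := by
  have hC' : ∀ n : ℤ, 1 + a + b - e ≠ n := fun n h =>
    not_int_one_add hC n (by linear_combination h)
  have e1 : c + (1 + a + b - e) - (g - d) = f := by linear_combination -hsaal
  have e2 : c + (1 + a + b - e) - (f - d) = g := by linear_combination -hsaal
  have e3 : f - (f - d) = d := by ring
  have i1 := integral_gaussSeries_mul_gaussSeries (A := g - d) (B := f - d)
    (C := 1 + a + b - e) (a := a) (b := b) (e := e) (s := c) (by ring) hgd hfd hC' ha hb he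
    hae hbe hC0 hC1 he0 he1 hc0
    (by
      rw [show 1 + a + b - e - (g - d) - (f - d) = d - c by linear_combination -hsaal]
      simpa using hcd0)
    (fun n h => not_int_one_add h1 n (by linear_combination h))
    (by rw [e1]; exact hf) (by rw [e2]; exact hg) (by rw [e1, e3]; exact hd)
    (fun n h => not_int_one_add h3 n (by linear_combination h))
    (by rw [e1]; exact hfe) (by rw [e2]; exact hge) (by rw [e1, e3]; exact hde) hce
  have e4 : c + (1 + a + b - e) - a = 1 + b + c - e := by ring
  have e5 : c + (1 + a + b - e) - b = 1 + a + c - e := by ring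
  have e6 : 1 + b + c - e - b = 1 + c - e := by ring
  have i2 := integral_gaussSeries_mul_gaussSeries (A := a) (B := b)
    (C := 1 + a + b - e) (a := g - d) (b := f - d) (e := 1 + c - d) (s := c)
    (by linear_combination -hsaal) ha hb hC' hgd hfd (not_int_one_add_sub hcd)
    (fun n h => hgc (n + 1) (by push_cast; linear_combination h))
    (fun n h => hfc (n + 1) (by push_cast; linear_combination h)) hC0 hC1
    (by
      simp only [Complex.add_re, Complex.sub_re, Complex.one_re]
      linarith)
    (by
      simp only [Complex.add_re, Complex.sub_re, Complex.one_re]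
      linarith) hc0
    (by
      rw [show 1 + a + b - e - a - b = 1 - e by ring]
      simpa using he1)
    (fun n h => not_int_one_add h1 n (by linear_combination h))
    (by rw [e4]; exact fun n h => not_int_one_add h5 n (by linear_combination h))
    (by rw [e5]; exact fun n h => not_int_one_add h4 n (by linear_combination h))
    (by rw [e4, e6]; exact not_int_one_add_sub hce)
    (fun n h => h2 n (by linear_combination h))
    (fun n h => h7 n (by linear_combination h)) (fun n h => h6 n (by linear_combination h))
    (fun n h => hde n (by linear_combination h))
    (fun n h => hd (n + 1) (by push_cast; linear_combination h))
  have hi : ∫ x in Set.Ioo (0 : ℝ) 1, gaussSeries a b (1 + a + b - e) (1 - x) *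
      (gaussSeries (g - d) (f - d) (1 + a + b - e) (1 - x) *
        ((x : ℂ) ^ (c - 1) * (1 - (x : ℂ)) ^ (1 + a + b - e - 1))) =
      ∫ x in Set.Ioo (0 : ℝ) 1, gaussSeries (g - d) (f - d) (1 + a + b - e) (1 - x) *
      (gaussSeries a b (1 + a + b - e) (1 - x) *
        ((x : ℂ) ^ (c - 1) * (1 - (x : ℂ)) ^ (1 + a + b - e - 1))) := by
    congr 1
    ext x
    ring
  rw [i1, i2, e1, e2, e3, e4, e5, e6, show 1 + c - (1 + c - d) = d by ring,
    show 1 + (1 + c - e) - (1 + c - d) = 1 + d - e by ring] at hi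
  have g1 := Gamma_ne_zero_of_not_int ha
  have g2 := Gamma_ne_zero_of_not_int hb
  have g3 := Gamma_ne_zero_of_not_int hc
  have g4 := Gamma_ne_zero_of_not_int hd
  have g5 := Gamma_ne_zero_of_not_int hgd
  have g6 := Gamma_ne_zero_of_not_int hfd
  have g7 := Gamma_ne_zero_of_not_int (not_int_one_add_sub hce)
  have g8 := Gamma_ne_zero_of_not_int (not_int_one_add_sub hde)
  have hpi : (Real.pi : ℂ) ≠ 0 := by exact_mod_cast Real.pi_ne_zero
  refine mul_left_cancel₀ (mul_ne_zero (mul_ne_zero hpi (mul_ne_zero (mul_ne_zero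
    (mul_ne_zero g5 g6) g1) g2)) (mul_ne_zero (mul_ne_zero (mul_ne_zero g3 g7) g4) g8)) ?_
  linear_combination hi

lemma exists_norm_Fstar_term_le (R : ℝ) (hR : 2 ≤ R) :
    ∃ C : ℝ, 0 ≤ C ∧ ∀ a b c d e f g : ℂ, ‖a‖ ≤ R → ‖b‖ ≤ R → ‖c‖ ≤ R → ‖d‖ ≤ R → ‖e‖ ≤ R →
      ‖f‖ ≤ R → ‖g‖ ≤ R → e + f + g = a + b + c + d + 1 → ∀ k : ℕ, 2 * R + 1 ≤ k →
      ‖(Complex.Gamma (k + a) * Complex.Gamma (k + b) *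
        Complex.Gamma (k + c) * Complex.Gamma (k + d)) /
        ((k.factorial : ℂ) * Complex.Gamma (k + e) * Complex.Gamma (k + f) *
        Complex.Gamma (k + g))‖ ≤ C * (1 / (k : ℝ) ^ 2) := by
  obtain ⟨C, hC0, hC⟩ := exists_norm_prod_Gamma_le 5 R (by linarith)
  refine ⟨C, hC0, fun a b c d e f g ha hb hc hd he hf hg hsaal k hk => ?_⟩
  have hk0 : (0 : ℝ) < k := by linarith
  have hk1 : (k : ℂ) ≠ 0 := by exact_mod_cast hk0.ne'
  have hk2 : (k : ℂ) + 1 ≠ 0 := by exact_mod_cast k.succ_ne_zero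
  have h := hC ![a, b, c, d, 2] ![e, f, g, 1, 0]
    (by
      intro i
      fin_cases i <;> simp <;> assumption)
    (by
      intro i
      fin_cases i <;> simp <;> first | assumption | linarith)
    (by
      simp only [Fin.sum_univ_five, Matrix.cons_val]
      linear_combination -hsaal) k (by simp) (by simpa using hk)
  simp only [Fin.prod_univ_five, Matrix.cons_val, add_zero] at h
  have hG2 : Complex.Gamma (k + 2) = (k + 1) * (k * Complex.Gamma k) := by
    rw [show (k : ℂ) + 2 = (k + 1) + 1 by ring, Complex.Gamma_add_one _ hk2,
      Complex.Gamma_add_one _ hk1]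
  have hG0 : Complex.Gamma k ≠ 0 := Complex.Gamma_ne_zero_of_re_pos (by simpa using hk0)
  rw [hG2, Complex.Gamma_nat_eq_factorial, norm_mul, norm_mul _ (Complex.Gamma k), norm_mul _
    (_ * Complex.Gamma _), norm_mul _ (Complex.Gamma k), ← mul_assoc, ← mul_assoc,
    ← mul_assoc] at h
  have h' := le_of_mul_le_mul_right h (norm_pos_iff.2 hG0)
  rw [norm_div]
  refine div_le_of_le_mul₀ (norm_nonneg _) (by positivity) ?_
  have hn1 : ‖(k : ℂ) + 1‖ = k + 1 := by
    rw [show (k : ℂ) + 1 = ((k + 1 : ℕ) : ℂ) by push_cast; rfl, Complex.norm_natCast]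
    push_cast
    rfl
  rw [hn1, Complex.norm_natCast] at h'
  have h3 : ‖(k.factorial : ℂ) * Complex.Gamma (k + e) * Complex.Gamma (k + f) *
      Complex.Gamma (k + g)‖ = ‖Complex.Gamma (k + e) * Complex.Gamma (k + f) *
      Complex.Gamma (k + g) * (k.factorial : ℂ)‖ := by
    congr 1
    ring
  rw [h3, mul_one_div, div_mul_eq_mul_div, le_div_iff₀ (by positivity)]
  refine le_trans ?_ h'
  rw [mul_assoc ‖_‖]
  exact mul_le_mul_of_nonneg_left (by nlinarith) (norm_nonneg _)

lemma differentiableAt_Gamma_comp {u : ℂ → ℂ} {t : ℂ} (hu : DifferentiableAt ℂ u t)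
    (h : ∀ n : ℤ, u t ≠ n) : DifferentiableAt ℂ (fun s => Complex.Gamma (u s)) t :=
  (Complex.differentiableAt_Gamma _ fun m hm => h (-m) (by simpa using hm)).comp t hu

lemma isOpen_setOf_not_int {u : ℂ → ℂ} (hu : Continuous u) :
    IsOpen {t | ∀ n : ℤ, u t ≠ n} := by
  have : {t | ∀ n : ℤ, u t ≠ n} = u ⁻¹' (Set.range ((↑) : ℤ → ℂ))ᶜ := by
    ext t
    simp [eq_comm]
  rw [this]
  exact Complex.isOpen_compl_range_intCast.preimage hu

lemma differentiableAt_Fstar {a b c d e f g : ℂ → ℂ} (hda : Differentiable ℂ a)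
    (hdb : Differentiable ℂ b) (hdc : Differentiable ℂ c) (hdd : Differentiable ℂ d)
    (hde : Differentiable ℂ e) (hdf : Differentiable ℂ f) (hdg : Differentiable ℂ g)
    (hsaal : ∀ t, e t + f t + g t = a t + b t + c t + d t + 1) {t₀ : ℂ}
    (ha : ∀ n : ℤ, a t₀ ≠ n) (hb : ∀ n : ℤ, b t₀ ≠ n) (hc : ∀ n : ℤ, c t₀ ≠ n)
    (hd : ∀ n : ℤ, d t₀ ≠ n) :
    DifferentiableAt ℂ (fun t => Fstar (a t) (b t) (c t) (d t) (e t) (f t) (g t)) t₀ := by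
  set T : ℕ → ℂ → ℂ := fun k t => (Complex.Gamma (k + a t) * Complex.Gamma (k + b t) *
      Complex.Gamma (k + c t) * Complex.Gamma (k + d t)) /
    ((k.factorial : ℂ) * Complex.Gamma (k + e t) * Complex.Gamma (k + f t) *
      Complex.Gamma (k + g t)) with hT
  set V : Set ℂ := Metric.ball t₀ 1 ∩ ({t | ∀ n : ℤ, a t ≠ n} ∩ {t | ∀ n : ℤ, b t ≠ n} ∩
    ({t | ∀ n : ℤ, c t ≠ n} ∩ {t | ∀ n : ℤ, d t ≠ n})) with hV
  have hVo : IsOpen V := Metric.isOpen_ball.inter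
    (((isOpen_setOf_not_int hda.continuous).inter (isOpen_setOf_not_int hdb.continuous)).inter
      ((isOpen_setOf_not_int hdc.continuous).inter (isOpen_setOf_not_int hdd.continuous)))
  have hV0 : t₀ ∈ V := ⟨Metric.mem_ball_self one_pos, ⟨ha, hb⟩, hc, hd⟩
  have hbd : ∀ u : ℂ → ℂ, Differentiable ℂ u → ∃ r, ∀ t ∈ V, ‖u t‖ ≤ r := fun u hu => by
    obtain ⟨r, hr⟩ := (isCompact_closedBall t₀ 1).exists_bound_of_continuousOn
      hu.continuous.continuousOn
    exact ⟨r, fun t ht => hr t (Metric.ball_subset_closedBall ht.1)⟩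
  obtain ⟨ra, hra⟩ := hbd a hda
  obtain ⟨rb, hrb⟩ := hbd b hdb
  obtain ⟨rc, hrc⟩ := hbd c hdc
  obtain ⟨rd, hrd⟩ := hbd d hdd
  obtain ⟨re, hre⟩ := hbd e hde
  obtain ⟨rf, hrf⟩ := hbd f hdf
  obtain ⟨rg, hrg⟩ := hbd g hdg
  set R := max (max (max (max (max (max (max 2 ra) rb) rc) rd) re) rf) rg with hR
  obtain ⟨C, -, hC⟩ := exists_norm_Fstar_term_le R (by simp [hR])
  obtain ⟨K, hK⟩ := exists_nat_ge (2 * R + 1)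
  have hT_le : ∀ k : ℕ, ∀ t ∈ V, ‖T (k + K) t‖ ≤ C * (1 / ((k + K : ℕ) : ℝ) ^ 2) := by
    intro k t ht
    refine hC _ _ _ _ _ _ _ ?_ ?_ ?_ ?_ ?_ ?_ ?_ (hsaal t) (k + K)
      (hK.trans (by exact_mod_cast Nat.le_add_left K k))
    · exact (hra t ht).trans (by simp [hR])
    · exact (hrb t ht).trans (by simp [hR])
    · exact (hrc t ht).trans (by simp [hR])
    · exact (hrd t ht).trans (by simp [hR])
    · exact (hre t ht).trans (by simp [hR])
    · exact (hrf t ht).trans (by simp [hR])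
    · exact (hrg t ht).trans (by simp [hR])
  have hs : Summable fun k : ℕ => C * (1 / ((k + K : ℕ) : ℝ) ^ 2) :=
    ((summable_nat_add_iff K).2 (Real.summable_one_div_nat_pow.2 one_lt_two)).mul_left C
  have hTd : ∀ k : ℕ, DifferentiableOn ℂ (T k) V := by
    intro k t ht
    refine DifferentiableAt.differentiableWithinAt ?_
    have hn : ∀ {u : ℂ → ℂ}, Differentiable ℂ u → (∀ n : ℤ, u t ≠ n) →
        DifferentiableAt ℂ (fun s => Complex.Gamma (k + u s)) t := fun hu h =>
      differentiableAt_Gamma_comp ((hu t).const_add _) (not_int_natCast_add h k)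
    have hi : ∀ {u : ℂ → ℂ}, Differentiable ℂ u →
        DifferentiableAt ℂ (fun s => (Complex.Gamma (k + u s))⁻¹) t := fun hu =>
      (Complex.differentiable_one_div_Gamma _).comp t ((hu t).const_add _)
    have := ((((hn hda ht.2.1.1).mul (hn hdb ht.2.1.2)).mul (hn hdc ht.2.2.1)).mul
      (hn hdd ht.2.2.2)).mul ((((hi hde).mul (hi hdf)).mul (hi hdg)).const_mul
        (k.factorial : ℂ)⁻¹)
    refine this.congr_of_eventuallyEq (Eventually.of_forall fun s => ?_)
    simp only [hT, Pi.mul_apply, div_eq_mul_inv, mul_inv]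
    ring
  have hD : DifferentiableOn ℂ (fun t => ∑ k ∈ Finset.range K, T k t + ∑' k, T (k + K) t) V :=
    (DifferentiableOn.fun_sum fun k _ => hTd k).add
      (Complex.differentiableOn_tsum_of_summable_norm hs (fun k => hTd _) hVo hT_le)
  refine (hD.differentiableAt (hVo.mem_nhds hV0)).congr_of_eventuallyEq ?_
  filter_upwards [hVo.mem_nhds hV0] with t ht
  have hsum : Summable fun k => T k t :=
    (summable_nat_add_iff K).1 (Summable.of_norm_bounded hs fun k => hT_le k t ht)
  exact (hsum.sum_add_tsum_nat_add K).symm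

lemma differentiableAt_Lf {a b c d e f g : ℂ → ℂ} (hda : Differentiable ℂ a)
    (hdb : Differentiable ℂ b) (hdc : Differentiable ℂ c) (hdd : Differentiable ℂ d)
    (hde : Differentiable ℂ e) (hdf : Differentiable ℂ f) (hdg : Differentiable ℂ g)
    (hsaal : ∀ t, e t + f t + g t = a t + b t + c t + d t + 1) {t₀ : ℂ}
    (ha : ∀ n : ℤ, a t₀ ≠ n) (hb : ∀ n : ℤ, b t₀ ≠ n) (hc : ∀ n : ℤ, c t₀ ≠ n)
    (hd : ∀ n : ℤ, d t₀ ≠ n) (he : ∀ n : ℤ, e t₀ ≠ n)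
    (hae : ∀ n : ℤ, a t₀ - e t₀ ≠ n) (hbe : ∀ n : ℤ, b t₀ - e t₀ ≠ n)
    (hce : ∀ n : ℤ, c t₀ - e t₀ ≠ n) (hde' : ∀ n : ℤ, d t₀ - e t₀ ≠ n) :
    DifferentiableAt ℂ (fun t => Lf (a t) (b t) (c t) (d t) (e t) (f t) (g t)) t₀ := by
  have hG : ∀ {u : ℂ → ℂ}, Differentiable ℂ u → (∀ n : ℤ, u t₀ ≠ n) →
      DifferentiableAt ℂ (fun s => Complex.Gamma (u s)) t₀ := fun hu h =>
    differentiableAt_Gamma_comp (hu t₀) h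
  have hsub : ∀ {u : ℂ → ℂ}, Differentiable ℂ u → Differentiable ℂ fun t => 1 + u t - e t :=
    fun hu => (hu.const_add 1).sub hde
  unfold Lf
  refine DifferentiableAt.fun_div ((differentiableAt_Fstar hda hdb hdc hdd hde hdf hdg hsaal
    ha hb hc hd).sub (differentiableAt_Fstar (hsub hda) (hsub hdb) (hsub hdc) (hsub hdd)
    (hde.const_sub 2) (hsub hdf) (hsub hdg)
    (fun t => by linear_combination hsaal t)
    (not_int_one_add_sub hae) (not_int_one_add_sub hbe) (not_int_one_add_sub hce)
    (not_int_one_add_sub hde'))) ?_ ?_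
  · have hS : DifferentiableAt ℂ (fun t => Sn (e t)) t₀ := by
      unfold Sn
      exact (Complex.differentiable_sin _).comp t₀ ((hde t₀).const_mul _)
    exact ((((((((hS.mul (hG hda ha)).mul (hG hdb hb)).mul (hG hdc hc)).mul (hG hdd hd)).mul
      (hG (hsub hda) (not_int_one_add_sub hae))).mul
      (hG (hsub hdb) (not_int_one_add_sub hbe))).mul
      (hG (hsub hdc) (not_int_one_add_sub hce))).mul
      (hG (hsub hdd) (not_int_one_add_sub hde')))
  · have hn := @Gamma_ne_zero_of_not_int
    exact (mul_ne_zero (mul_ne_zero (mul_ne_zero (mul_ne_zero (mul_ne_zero (mul_ne_zero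
      (mul_ne_zero (mul_ne_zero (Sn_ne_zero he) (hn ha)) (hn hb)) (hn hc)) (hn hd))
      (hn (not_int_one_add_sub hae))) (hn (not_int_one_add_sub hbe)))
      (hn (not_int_one_add_sub hce))) (hn (not_int_one_add_sub hde')))

/-- The parameters on a complex line at which finitely many affine functions avoid the
integers. -/
def avoidSet {m : ℕ} (x y : Fin m → ℂ) : Set ℂ := {t | ∀ i, ∀ n : ℤ, x i + t * (y i - x i) ≠ n}

lemma isOpen_avoidSet {m : ℕ} (x y : Fin m → ℂ) : IsOpen (avoidSet x y) := by
  have : avoidSet x y = ⋂ i, {t | ∀ n : ℤ, x i + t * (y i - x i) ≠ n} := by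
    ext t
    simp [avoidSet]
  rw [this]
  exact isOpen_iInter_of_finite fun i => isOpen_setOf_not_int (by fun_prop)

lemma isPreconnected_avoidSet {m : ℕ} {x : Fin m → ℂ} (y : Fin m → ℂ)
    (hx : ∀ i, ∀ n : ℤ, x i ≠ n) : IsPreconnected (avoidSet x y) := by
  have hc : (⋃ i : Fin m, ⋃ n : ℤ, {t : ℂ | x i + t * (y i - x i) = n}).Countable := by
    refine Set.countable_iUnion fun i => Set.countable_iUnion fun n => ?_
    refine Set.Subsingleton.countable fun s hs t ht => ?_
    simp only [Set.mem_ofPred_eq] at hs ht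
    by_cases h : y i - x i = 0
    · exact absurd (by simpa [h] using hs) (hx i n)
    · exact mul_right_cancel₀ h (by linear_combination hs - ht)
  have : avoidSet x y = (⋃ i : Fin m, ⋃ n : ℤ, {t : ℂ | x i + t * (y i - x i) = n})ᶜ := by
    ext t
    simp [avoidSet]
  rw [this]
  refine (hc.isPathConnected_compl_of_one_lt_rank ?_).isConnected.isPreconnected
  simp [Complex.rank_real_complex]

lemma not_int_of_re {z : ℂ} (m : ℤ) (h1 : (m : ℝ) < z.re) (h2 : z.re < m + 1) :
    ∀ n : ℤ, z ≠ n := by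
  rintro n rfl
  rw [Complex.intCast_re] at h1 h2
  have h1' : m < n := by exact_mod_cast h1
  have h2' : n < m + 1 := by exact_mod_cast h2
  omega

lemma Lf_swap_last (a b c d e f g : ℂ) : Lf a b c d e f g = Lf a b c d e g f := by
  unfold Lf Fstar
  congr 2 <;> exact tsum_congr fun k => by ring

lemma Lf_perm_bdc (a b c d e f g : ℂ) : Lf a b c d e f g = Lf a d b c e f g := by
  unfold Lf Fstar
  congr 1
  · congr 1 <;> exact tsum_congr fun k => by ring
  · ring

lemma Lf_perm_dacb (a b c d e f g : ℂ) : Lf a b c d e f g = Lf d a c b e f g := by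
  unfold Lf Fstar
  congr 1
  · congr 1 <;> exact tsum_congr fun k => by ring
  · ring

lemma Lf_perm_bcdd (a b c d e f g : ℂ) : Lf a b c d e f g = Lf c d a b e f g := by
  unfold Lf Fstar
  congr 1
  · congr 1 <;> exact tsum_congr fun k => by ring
  · ring

set_option maxHeartbeats 1000000 in
/-- The inversion formula for `L` near one explicit real parameter point. -/
lemma Lf_inversion_of_re {a b c d e f g : ℂ} (hsaal : e + f + g = a + b + c + d + 1)
    (ha : a.re ∈ Set.Ioo (0.299 : ℝ) 0.301) (hb : b.re ∈ Set.Ioo (0.309 : ℝ) 0.311)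
    (hc : c.re ∈ Set.Ioo (0.349 : ℝ) 0.351) (hd : d.re ∈ Set.Ioo (0.319 : ℝ) 0.321)
    (he : e.re ∈ Set.Ioo (0.719 : ℝ) 0.721) (hf : f.re ∈ Set.Ioo (0.659 : ℝ) 0.661) :
    Lf a b c d g e f = Lf (f - a) (f - b) (f - c) (f - d) (1 + f - e) f (1 + f - g) := by
  obtain ⟨ha1, ha2⟩ := ha
  obtain ⟨hb1, hb2⟩ := hb
  obtain ⟨hc1, hc2⟩ := hc
  obtain ⟨hd1, hd2⟩ := hd
  obtain ⟨he1, he2⟩ := he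
  obtain ⟨hf1, hf2⟩ := hf
  have hg : g.re = a.re + b.re + c.re + d.re + 1 - e.re - f.re := by
    have := congrArg Complex.re hsaal
    simp only [Complex.add_re, Complex.one_re] at this
    linarith
  norm_num at ha1 ha2 hb1 hb2 hc1 hc2 hd1 hd2 he1 he2 hf1 hf2
  have ni : ∀ {z : ℂ} (m : ℤ), (m : ℝ) < z.re → z.re < m + 1 → ∀ n : ℤ, z ≠ n :=
    fun m => not_int_of_re m
  have h1 : Lf a d b c g e f =
      Lf (f - c) (e - c) b (1 + b - g) (1 + b - c) (1 + d + b - g) (1 + a + b - g) := by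
    apply Lf_eq_of_re
    any_goals
      try simp only [Complex.add_re, Complex.sub_re, Complex.one_re]
      linarith
    · linear_combination hsaal
    all_goals
      first
      | refine ni 0 ?_ ?_ <;> simp only [Complex.add_re, Complex.sub_re, Complex.mul_re,
          Complex.re_ofNat, Complex.im_ofNat, Int.cast_zero] <;> linarith
      | refine ni (-1) ?_ ?_ <;> simp only [Complex.add_re, Complex.sub_re, Complex.mul_re,
          Complex.re_ofNat, Complex.im_ofNat, Int.cast_neg, Int.cast_one] <;> linarith
  have h2 : Lf b (1 + b - g) (f - c) (e - c) (1 + b - c) (1 + d + b - g) (1 + a + b - g) =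
      Lf (1 + a + b - g - (e - c)) (1 + d + b - g - (e - c)) (f - c) (1 + (f - c) - (1 + b - c))
        (1 + (f - c) - (e - c)) (1 + (1 + b - g) + (f - c) - (1 + b - c))
        (1 + b + (f - c) - (1 + b - c)) := by
    apply Lf_eq_of_re
    any_goals
      try simp only [Complex.add_re, Complex.sub_re, Complex.one_re]
      linarith
    · linear_combination -hsaal
    all_goals
      first
      | refine ni 0 ?_ ?_ <;> simp only [Complex.add_re, Complex.sub_re, Complex.mul_re,
          Complex.one_re, Complex.re_ofNat, Complex.im_ofNat, Int.cast_zero] <;> linarith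
      | refine ni (-1) ?_ ?_ <;> simp only [Complex.add_re, Complex.sub_re, Complex.mul_re,
          Complex.one_re, Complex.re_ofNat, Complex.im_ofNat, Int.cast_neg, Int.cast_one] <;>
          linarith
  rw [Lf_perm_bdc a b c d, h1, Lf_perm_bcdd, h2, Lf_perm_dacb (f - a), Lf_swap_last (f - d)]
  congr 1 <;> first | ring1 | linear_combination -hsaal

/-- The inversion formula for `L`. -/
lemma Lf_inversion {a b c d e f g : ℂ} (hsaal : e + f + g = a + b + c + d + 1)
    (ha : ∀ n : ℤ, a ≠ n) (hb : ∀ n : ℤ, b ≠ n) (hc : ∀ n : ℤ, c ≠ n) (hd : ∀ n : ℤ, d ≠ n)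
    (hg : ∀ n : ℤ, g ≠ n) (hag : ∀ n : ℤ, a - g ≠ n) (hbg : ∀ n : ℤ, b - g ≠ n)
    (hcg : ∀ n : ℤ, c - g ≠ n) (hdg : ∀ n : ℤ, d - g ≠ n) (hfa : ∀ n : ℤ, f - a ≠ n)
    (hfb : ∀ n : ℤ, f - b ≠ n) (hfc : ∀ n : ℤ, f - c ≠ n) (hfd : ∀ n : ℤ, f - d ≠ n)
    (hfe : ∀ n : ℤ, f - e ≠ n) (hae : ∀ n : ℤ, a - e ≠ n) (hbe : ∀ n : ℤ, b - e ≠ n)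
    (hce : ∀ n : ℤ, c - e ≠ n) (hde : ∀ n : ℤ, d - e ≠ n) :
    Lf a b c d g e f = Lf (f - a) (f - b) (f - c) (f - d) (1 + f - e) f (1 + f - g) := by
  obtain ⟨ℓ, hℓ⟩ : ∃ ℓ : ℂ → ℂ → ℂ → ℂ, ℓ = fun x y t => x + t * (y - x) := ⟨_, rfl⟩
  have hℓd : ∀ x y, Differentiable ℂ (ℓ x y) := fun x y => by
    simp only [hℓ]
    fun_prop
  obtain ⟨x, hx⟩ : ∃ x : Fin 18 → ℂ, x = ![a, b, c, d, g, a - g, b - g, c - g, d - g, f - a, f - b, f - c, f - d,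
    f - e, a - e, b - e, c - e, d - e] := ⟨_, rfl⟩
  obtain ⟨y, hy⟩ : ∃ y : Fin 18 → ℂ, y = ![0.3, 0.31, 0.35, 0.32, 0.9, 0.3 - 0.9, 0.31 - 0.9, 0.35 - 0.9,
    0.32 - 0.9, 0.66 - 0.3, 0.66 - 0.31, 0.66 - 0.35, 0.66 - 0.32, 0.66 - 0.72, 0.3 - 0.72,
    0.31 - 0.72, 0.35 - 0.72, 0.32 - 0.72] := ⟨_, rfl⟩
  have hx0 : ∀ i, ∀ n : ℤ, x i ≠ n := by
    intro i
    subst hx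
    fin_cases i <;> assumption
  have hℓ' : ∀ {t}, t ∈ avoidSet x y → ∀ i, ∀ n : ℤ, ℓ (x i) (y i) t ≠ n := by
    subst hℓ
    exact fun ht => ht
  have hs : ∀ t, ℓ e 0.72 t + ℓ f 0.66 t + ℓ g 0.9 t =
      ℓ a 0.3 t + ℓ b 0.31 t + ℓ c 0.35 t + ℓ d 0.32 t + 1 := fun t => by
    simp only [hℓ]
    linear_combination (1 - t) * hsaal
  have hsub : ∀ x₁ y₁ x₂ y₂ t, ℓ (x₁ - x₂) (y₁ - y₂) t = ℓ x₁ y₁ t - ℓ x₂ y₂ t :=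
    fun x₁ y₁ x₂ y₂ t => by
      simp only [hℓ]
      ring
  have hL : AnalyticOnNhd ℂ (fun t => Lf (ℓ a 0.3 t) (ℓ b 0.31 t) (ℓ c 0.35 t) (ℓ d 0.32 t)
      (ℓ g 0.9 t) (ℓ e 0.72 t) (ℓ f 0.66 t)) (avoidSet x y) := by
    refine DifferentiableOn.analyticOnNhd (fun t ht => ?_) (isOpen_avoidSet x y)
    refine (differentiableAt_Lf (hℓd _ _) (hℓd _ _) (hℓd _ _) (hℓd _ _) (hℓd _ _) (hℓd _ _)
      (hℓd _ _) (fun t => by linear_combination hs t) ?_ ?_ ?_ ?_ ?_ ?_ ?_ ?_ ?_).differentiableWithinAt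
    · simpa only [hx, hy, Matrix.cons_val] using hℓ' ht 0
    · simpa only [hx, hy, Matrix.cons_val] using hℓ' ht 1
    · simpa only [hx, hy, Matrix.cons_val] using hℓ' ht 2
    · simpa only [hx, hy, Matrix.cons_val] using hℓ' ht 3
    · simpa only [hx, hy, Matrix.cons_val] using hℓ' ht 4
    · simpa only [← hsub, hx, hy, Matrix.cons_val] using hℓ' ht 5
    · simpa only [← hsub, hx, hy, Matrix.cons_val] using hℓ' ht 6
    · simpa only [← hsub, hx, hy, Matrix.cons_val] using hℓ' ht 7
    · simpa only [← hsub, hx, hy, Matrix.cons_val] using hℓ' ht 8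
  have hR : AnalyticOnNhd ℂ (fun t => Lf (ℓ f 0.66 t - ℓ a 0.3 t) (ℓ f 0.66 t - ℓ b 0.31 t)
      (ℓ f 0.66 t - ℓ c 0.35 t) (ℓ f 0.66 t - ℓ d 0.32 t)
      (1 + ℓ f 0.66 t - ℓ e 0.72 t) (ℓ f 0.66 t) (1 + ℓ f 0.66 t - ℓ g 0.9 t))
      (avoidSet x y) := by
    refine DifferentiableOn.analyticOnNhd (fun t ht => ?_) (isOpen_avoidSet x y)
    have hd2 : ∀ x y x' y', Differentiable ℂ fun t => ℓ x y t - ℓ x' y' t :=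
      fun x y x' y' => (hℓd x y).sub (hℓd x' y')
    have hd3 : ∀ x y x' y', Differentiable ℂ fun t => 1 + ℓ x y t - ℓ x' y' t :=
      fun x y x' y' => ((hℓd x y).const_add 1).sub (hℓd x' y')
    have hsh : ∀ x₁ y₁ x₂ y₂, (∀ n : ℤ, ℓ x₁ y₁ t - ℓ x₂ y₂ t ≠ n) → ∀ n : ℤ,
        ℓ f 0.66 t - ℓ x₁ y₁ t - (1 + ℓ f 0.66 t - ℓ x₂ y₂ t) ≠ n :=
      fun x₁ y₁ x₂ y₂ h n hn => h (-n - 1) (by push_cast; linear_combination -hn)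
    refine (differentiableAt_Lf (hd2 _ _ _ _) (hd2 _ _ _ _) (hd2 _ _ _ _) (hd2 _ _ _ _)
      (hd3 _ _ _ _) (hℓd _ _) (hd3 _ _ _ _) (fun t => by linear_combination -hs t)
      ?_ ?_ ?_ ?_ (not_int_one_add_sub ?_) (hsh _ _ _ _ ?_) (hsh _ _ _ _ ?_) (hsh _ _ _ _ ?_)
      (hsh _ _ _ _ ?_)).differentiableWithinAt
    · simpa only [← hsub, hx, hy, Matrix.cons_val] using hℓ' ht 9
    · simpa only [← hsub, hx, hy, Matrix.cons_val] using hℓ' ht 10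
    · simpa only [← hsub, hx, hy, Matrix.cons_val] using hℓ' ht 11
    · simpa only [← hsub, hx, hy, Matrix.cons_val] using hℓ' ht 12
    · simpa only [← hsub, hx, hy, Matrix.cons_val] using hℓ' ht 13
    · simpa only [← hsub, hx, hy, Matrix.cons_val] using hℓ' ht 14
    · simpa only [← hsub, hx, hy, Matrix.cons_val] using hℓ' ht 15
    · simpa only [← hsub, hx, hy, Matrix.cons_val] using hℓ' ht 16
    · simpa only [← hsub, hx, hy, Matrix.cons_val] using hℓ' ht 17
  have hnear : ∀ u v : ℂ, ∀ r s : ℝ, r < v.re → v.re < s →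
      ∀ᶠ t in 𝓝 (1 : ℂ), (ℓ u v t).re ∈ Set.Ioo r s := by
    intro u v r s h1 h2
    have hc : ContinuousAt (fun t => (ℓ u v t).re) 1 :=
      (Complex.continuous_re.comp (hℓd u v).continuous).continuousAt
    refine hc.eventually_mem (Ioo_mem_nhds ?_ ?_) <;> simpa [hℓ]
  have h1 : (1 : ℂ) ∈ avoidSet x y := by
    intro i
    have : x i + 1 * (y i - x i) = y i := by ring
    rw [this]
    fin_cases i <;>
      first
      | (refine not_int_of_re 0 ?_ ?_ <;> norm_num [hy]; done)
      | (refine not_int_of_re (-1) ?_ ?_ <;> norm_num [hy])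
  have key := hL.eqOn_of_preconnected_of_eventuallyEq hR (isPreconnected_avoidSet y hx0) h1 (by
    filter_upwards [hnear a 0.3 0.299 0.301 (by norm_num) (by norm_num),
      hnear b 0.31 0.309 0.311 (by norm_num) (by norm_num),
      hnear c 0.35 0.349 0.351 (by norm_num) (by norm_num),
      hnear d 0.32 0.319 0.321 (by norm_num) (by norm_num),
      hnear e 0.72 0.719 0.721 (by norm_num) (by norm_num),
      hnear f 0.66 0.659 0.661 (by norm_num) (by norm_num)] with t t1 t2 t3 t4 t5 t6
    exact Lf_inversion_of_re (hs t) t1 t2 t3 t4 t5 t6)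
  have h0 : (0 : ℂ) ∈ avoidSet x y := fun i => by simpa using hx0 i
  simpa [hℓ] using key h0

lemma exists_Sn_eq_exp : ∃ E : ℂ → ℂ, (∀ x, E x ≠ 0) ∧ (∀ x y, E (x + y) = E x * E y) ∧
    (∀ x y, E (x - y) = E x / E y) ∧ ∀ x, Sn x = ((E x)⁻¹ - E x) * (Complex.I / 2) := by
  refine ⟨fun x => Complex.exp (Real.pi * x * Complex.I), fun x => Complex.exp_ne_zero _,
    fun x y => ?_, fun x y => ?_, fun x => ?_⟩
  · rw [← Complex.exp_add]
    ring_nf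
  · rw [← Complex.exp_sub]
    ring_nf
  · rw [← Complex.exp_neg, Sn, Complex.sin]
    ring_nf

lemma Sn_mul_triple_sub (b c d f g : ℂ) :
    Sn f * (Sn (b - g) * Sn (c - g) * Sn (d - g)) -
        Sn g * (Sn (b - f) * Sn (c - f) * Sn (d - f)) =
      Sn (f - g) * (Sn b * Sn c * Sn d - Sn (b + c + d - f - g) * Sn f * Sn g) := by
  obtain ⟨E, hE0, hEadd, hEsub, hE⟩ := exists_Sn_eq_exp
  simp only [hE, hEadd, hEsub]
  have hb := hE0 b
  have hc := hE0 c
  have hd := hE0 d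
  have hf := hE0 f
  have hg := hE0 g
  field_simp
  ring

/-- The function `K` in terms of two functions `L`. -/
lemma Kf_mul_eq {a b c d e f g : ℂ} (hsaal : e + f + g = a + b + c + d + 1)
    (ha : ∀ n : ℤ, a ≠ n) (hb : ∀ n : ℤ, b ≠ n) (hc : ∀ n : ℤ, c ≠ n) (hd : ∀ n : ℤ, d ≠ n)
    (hf : ∀ n : ℤ, f ≠ n) (hg : ∀ n : ℤ, g ≠ n) (hfg : ∀ n : ℤ, f - g ≠ n)
    (hae : ∀ n : ℤ, a - e ≠ n)
    (haf : ∀ n : ℤ, a - f ≠ n) (hbf : ∀ n : ℤ, b - f ≠ n) (hcf : ∀ n : ℤ, c - f ≠ n)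
    (hdf : ∀ n : ℤ, d - f ≠ n)
    (hag : ∀ n : ℤ, a - g ≠ n) (hbg : ∀ n : ℤ, b - g ≠ n) (hcg : ∀ n : ℤ, c - g ≠ n)
    (hdg : ∀ n : ℤ, d - g ≠ n) :
    Kf a b c d e f g * (Sn a * Complex.Gamma a * Complex.Gamma (1 + a - e) *
        Complex.Gamma (1 + a - f) * Complex.Gamma (1 + a - g) * Sn (e - a) * Sn (f - g)) =
      Sn (b - g) * Sn (c - g) * Sn (d - g) *
          (Complex.Gamma (1 + a - g) * Complex.Gamma (1 + b - g) * Complex.Gamma (1 + c - g) *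
            Complex.Gamma (1 + d - g)) * Lf a b c d g e f -
        Sn (b - f) * Sn (c - f) * Sn (d - f) *
          (Complex.Gamma (1 + a - f) * Complex.Gamma (1 + b - f) * Complex.Gamma (1 + c - f) *
            Complex.Gamma (1 + d - f)) * Lf a b c d f e g := by
  have h4 := Fstar_four_term a b c d e f g hsaal ha hb hc hd hf hg hfg hae haf hbf hcf hdf
    hag hbg hcg hdg
  have htrig := Sn_mul_triple_sub b c d f g
  rw [show b + c + d - f - g = -(1 + (a - e)) by linear_combination -hsaal, Sn_neg, Sn_one_add,
    Sn_sub_comm a e] at htrig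
  have hGa := Gamma_ne_zero_of_not_int ha
  have hGb := Gamma_ne_zero_of_not_int hb
  have hGc := Gamma_ne_zero_of_not_int hc
  have hGd := Gamma_ne_zero_of_not_int hd
  have hGae := Gamma_ne_zero_of_not_int (not_int_one_add_sub hae)
  have hGaf := Gamma_ne_zero_of_not_int (not_int_one_add_sub haf)
  have hGbf := Gamma_ne_zero_of_not_int (not_int_one_add_sub hbf)
  have hGcf := Gamma_ne_zero_of_not_int (not_int_one_add_sub hcf)
  have hGdf := Gamma_ne_zero_of_not_int (not_int_one_add_sub hdf)
  have hGag := Gamma_ne_zero_of_not_int (not_int_one_add_sub hag)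
  have hGbg := Gamma_ne_zero_of_not_int (not_int_one_add_sub hbg)
  have hGcg := Gamma_ne_zero_of_not_int (not_int_one_add_sub hcg)
  have hGdg := Gamma_ne_zero_of_not_int (not_int_one_add_sub hdg)
  have hSa := Sn_ne_zero ha
  have hSf := Sn_ne_zero hf
  have hSg := Sn_ne_zero hg
  have hSfg := Sn_ne_zero hfg
  have hF : Fstar a b c d g e f = Fstar a b c d e f g := tsum_congr fun k => by ring
  have hF' : Fstar a b c d f e g = Fstar a b c d e f g := tsum_congr fun k => by ring
  unfold Kf Lf
  rw [hF, hF']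
  generalize Fstar a (1 + a - e) (1 + a - f) (1 + a - g) (1 + a - b) (1 + a - c) (1 + a - d) =
    Fa at *
  generalize Fstar (1 + a - f) (1 + b - f) (1 + c - f) (1 + d - f) (2 - f) (1 + e - f)
    (1 + g - f) = Ff at *
  generalize Fstar (1 + a - g) (1 + b - g) (1 + c - g) (1 + d - g) (2 - g) (1 + e - g)
    (1 + f - g) = Fg at *
  generalize Fstar a b c d e f g = F at *
  field_simp at h4 ⊢
  linear_combination (-1 : ℂ) * h4 - F * htrig

lemma one_div_four_Gamma_mul {x x' y y' z z' t t' : ℂ} (hx : x + x' = 1) (hy : y + y' = 1)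
    (hz : z + z' = 1) (ht : t + t' = 1) (hx' : ∀ n : ℤ, x' ≠ n) (hy' : ∀ n : ℤ, y' ≠ n)
    (hz' : ∀ n : ℤ, z' ≠ n) (ht' : ∀ n : ℤ, t' ≠ n) :
    Af x y z t = Sn x' * Sn y' * Sn z' * Sn t' * (Complex.Gamma x' * Complex.Gamma y' *
      Complex.Gamma z' * Complex.Gamma t') / (Real.pi : ℂ) ^ 4 := by
  have key : ∀ {u v : ℂ}, u + v = 1 → (∀ n : ℤ, v ≠ n) →
      (Complex.Gamma u)⁻¹ = Sn v * Complex.Gamma v / Real.pi := fun {u v} h hv => by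
    have h1 := Gamma_mul_Gamma_one_sub_eq ((add_comm v u).trans h)
    have h2 := Sn_ne_zero hv
    have h3 := Gamma_ne_zero_of_not_int hv
    have hpi : (Real.pi : ℂ) ≠ 0 := by exact_mod_cast Real.pi_ne_zero
    have h4 : Complex.Gamma u ≠ 0 := by
      intro h0
      rw [h0, mul_zero, eq_comm, div_eq_zero_iff] at h1
      tauto
    field_simp at h1 ⊢
    linear_combination -h1
  rw [Af, one_div, mul_inv, mul_inv, mul_inv, key hx hx', key hy hy', key hz hz', key ht ht']
  ring

end

theorem orbit4_LKK_relation (a b c d e f g : ℂ)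
    (hsaal : e + f + g = a + b + c + d + 1)
    (hint : ∀ i : Fin 7, ∀ n : ℤ, ![a, b, c, d, e, f, g] i ≠ (n : ℂ))
    (hdiff : ∀ i j : Fin 7, i ≠ j → ∀ n : ℤ,
      ![a, b, c, d, e, f, g] i - ![a, b, c, d, e, f, g] j ≠ (n : ℂ)) :
    Sn (f - a) * Af (1 - a) (e - a) (f - a) (g - a) *
        Af (1 + a - g) (1 + b - g) (1 + c - g) (1 + d - g) * Kf a b c d e f g -
      Sn (g - a) * Af (f - a) (f - b) (f - c) (f - d) *
        Af a (1 + a - e) (1 + a - f) (1 + a - g) *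
        Kf (e - a) (e - b) (e - c) (e - d) e (1 + e - f) (1 + e - g) -
      B2 a b c d e f g * Lf a b c d g f e = 0 := by
  have ha := hint 0
  have hb := hint 1
  have hc := hint 2
  have hd := hint 3
  have he := hint 4
  have hf := hint 5
  have hg := hint 6
  have hae := hdiff 0 4 (by decide)
  have hbe := hdiff 1 4 (by decide)
  have hce := hdiff 2 4 (by decide)
  have hde := hdiff 3 4 (by decide)
  have haf := hdiff 0 5 (by decide)
  have hbf := hdiff 1 5 (by decide)
  have hcf := hdiff 2 5 (by decide)
  have hdf := hdiff 3 5 (by decide)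
  have hag := hdiff 0 6 (by decide)
  have hbg := hdiff 1 6 (by decide)
  have hcg := hdiff 2 6 (by decide)
  have hdg := hdiff 3 6 (by decide)
  have hea := hdiff 4 0 (by decide)
  have heb := hdiff 4 1 (by decide)
  have hec := hdiff 4 2 (by decide)
  have hed := hdiff 4 3 (by decide)
  have hfa := hdiff 5 0 (by decide)
  have hfb := hdiff 5 1 (by decide)
  have hfc := hdiff 5 2 (by decide)
  have hfd := hdiff 5 3 (by decide)
  have hga := hdiff 6 0 (by decide)
  have hgb := hdiff 6 1 (by decide)
  have hgc := hdiff 6 2 (by decide)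
  have hgd := hdiff 6 3 (by decide)
  have hef := hdiff 4 5 (by decide)
  have heg := hdiff 4 6 (by decide)
  have hfg := hdiff 5 6 (by decide)
  have hgf := hdiff 6 5 (by decide)
  simp only [Matrix.cons_val] at *
  clear hint hdiff
  have hK := Kf_mul_eq hsaal ha hb hc hd hf hg hfg hae haf hbf hcf hdf hag hbg hcg hdg
  have hsub : ∀ {x y : ℂ}, (∀ n : ℤ, x - y ≠ n) → ∀ n : ℤ, e - y - (1 + e - x) ≠ n :=
    fun {x y} h n hn => h (n + 1) (by push_cast; linear_combination hn)
  have hK' := Kf_mul_eq (a := e - a) (b := e - b) (c := e - c) (d := e - d) (e := e)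
    (f := 1 + e - f) (g := 1 + e - g) (by linear_combination -hsaal) hea heb hec hed
    (not_int_one_add_sub hef) (not_int_one_add_sub heg) (by simpa using hgf)
    (by simpa using not_int_neg ha) (hsub hfa) (hsub hfb) (hsub hfc) (hsub hfd)
    (hsub hga) (hsub hgb) (hsub hgc) (hsub hgd)
  have hLg := Lf_inversion (e := f) (f := e) (by linear_combination hsaal) ha hb hc hd hg
    hag hbg hcg hdg hea heb hec hed hef haf hbf hcf hdf
  have hLf := Lf_inversion (e := g) (f := e) (g := f) (by linear_combination hsaal) ha hb hc hd hf
    haf hbf hcf hdf hea heb hec hed heg hag hbg hcg hdg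
  have hG : ∀ x y, 1 + (e - x) - (1 + e - y) = y - x := fun x y => by ring
  have hS : ∀ x y, Sn (e - x - (1 + e - y)) = Sn (x - y) := fun x y => by
    rw [show e - x - (1 + e - y) = -(1 + (x - y)) by ring, Sn_neg, Sn_one_add, neg_neg]
  have hS1 : ∀ x y, Sn (1 + x - y) = Sn (y - x) := fun x y => by
    rw [add_sub_assoc, Sn_one_add, Sn_sub_comm, neg_neg]
  rw [← hLf, ← hLg, show 1 + e - f - (1 + e - g) = g - f by ring, sub_sub_cancel,
    show 1 + (e - a) - e = 1 - a by ring] at hK'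
  simp only [hG, hS, Sn_sub_comm g f] at hK'
  rw [Lf_swap_last _ _ _ _ f, Lf_swap_last _ _ _ _ g] at hK
  have hA₁ := one_div_four_Gamma_mul (x := 1 - a) (x' := a) (y := e - a) (y' := 1 + a - e)
    (z := f - a) (z' := 1 + a - f) (t := g - a) (t' := 1 + a - g) (by ring) (by ring) (by ring)
    (by ring) ha (not_int_one_add_sub hae) (not_int_one_add_sub haf) (not_int_one_add_sub hag)
  have hA₂ := one_div_four_Gamma_mul (x := a) (x' := 1 - a) (y := 1 + a - e) (y' := e - a)
    (z := 1 + a - f) (z' := f - a) (t := 1 + a - g) (t' := g - a) (by ring) (by ring) (by ring)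
    (by ring) (by simpa only [sub_eq_add_neg] using not_int_one_add (not_int_neg ha)) hea hfa hga
  have hu := one_div_four_Gamma_mul (x := 1 + a - g) (x' := g - a) (y := 1 + b - g) (y' := g - b)
    (z := 1 + c - g) (z' := g - c) (t := 1 + d - g) (t' := g - d) (by ring) (by ring) (by ring)
    (by ring) hga hgb hgc hgd
  have hv := one_div_four_Gamma_mul (x := f - a) (x' := 1 + a - f) (y := f - b) (y' := 1 + b - f)
    (z := f - c) (z' := 1 + c - f) (t := f - d) (t' := 1 + d - f) (by ring) (by ring) (by ring)
    (by ring) (not_int_one_add_sub haf) (not_int_one_add_sub hbf) (not_int_one_add_sub hcf)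
    (not_int_one_add_sub hdf)
  have hu' : Af (1 + a - g) (1 + b - g) (1 + c - g) (1 + d - g) * (Complex.Gamma (1 + a - g) *
      Complex.Gamma (1 + b - g) * Complex.Gamma (1 + c - g) * Complex.Gamma (1 + d - g)) = 1 :=
    one_div_mul_cancel (mul_ne_zero (mul_ne_zero (mul_ne_zero
      (Gamma_ne_zero_of_not_int (not_int_one_add_sub hag))
      (Gamma_ne_zero_of_not_int (not_int_one_add_sub hbg)))
      (Gamma_ne_zero_of_not_int (not_int_one_add_sub hcg)))
      (Gamma_ne_zero_of_not_int (not_int_one_add_sub hdg)))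
  have hv' : Af (f - a) (f - b) (f - c) (f - d) * (Complex.Gamma (f - a) *
      Complex.Gamma (f - b) * Complex.Gamma (f - c) * Complex.Gamma (f - d)) = 1 :=
    one_div_mul_cancel (mul_ne_zero (mul_ne_zero (mul_ne_zero (Gamma_ne_zero_of_not_int hfa)
      (Gamma_ne_zero_of_not_int hfb)) (Gamma_ne_zero_of_not_int hfc))
      (Gamma_ne_zero_of_not_int hfd))
  have htrig := Sn_mul_triple_sub (b - a) (c - a) (d - a) (f - a) (g - a)
  simp only [sub_sub_sub_cancel_right] at htrig
  rw [show b - a + (c - a) + (d - a) - (f - a) - (g - a) = -(1 + (2 * a - e)) by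
    linear_combination -hsaal, Sn_neg, Sn_one_add, Sn_sub_comm (2 * a) e] at htrig
  simp only [hS1, Sn_one_sub] at hA₁ hA₂ hu hv
  rw [hA₁, hA₂]
  set u := Af (1 + a - g) (1 + b - g) (1 + c - g) (1 + d - g)
  set v := Af (f - a) (f - b) (f - c) (f - d)
  unfold B2
  rw [Sn_sub_comm g b, Sn_sub_comm g c, Sn_sub_comm g d] at hu
  rw [Sn_sub_comm f b, Sn_sub_comm f c, Sn_sub_comm f d] at hv
  refine (mul_eq_zero.1 ?_).resolve_left (Sn_ne_zero hfg)
  generalize Complex.Gamma (1 + a - g) * Complex.Gamma (1 + b - g) * Complex.Gamma (1 + c - g) *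
    Complex.Gamma (1 + d - g) = γ₁ at *
  generalize Complex.Gamma (1 + a - f) * Complex.Gamma (1 + b - f) * Complex.Gamma (1 + c - f) *
    Complex.Gamma (1 + d - f) = γ₂ at *
  generalize Complex.Gamma (g - a) * Complex.Gamma (g - b) * Complex.Gamma (g - c) *
    Complex.Gamma (g - d) = γ₃ at *
  generalize Complex.Gamma (f - a) * Complex.Gamma (f - b) * Complex.Gamma (f - c) *
    Complex.Gamma (f - d) = γ₄ at *
  set Pf := Sn (b - f) * Sn (c - f) * Sn (d - f) with hPf
  set Pg := Sn (b - g) * Sn (c - g) * Sn (d - g) with hPg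
  have hu₂ : u = -(Sn (g - a) * Pg * γ₃ / (Real.pi : ℂ) ^ 4) := by
    rw [hu, hPg]
    ring
  have hv₂ : v = -(Sn (f - a) * Pf * γ₂ / (Real.pi : ℂ) ^ 4) := by
    rw [hv, hPf]
    ring
  generalize Lf a b c d g f e = Lg at *
  generalize Lf a b c d f g e = L₂ at *
  set X := Sn (f - a) * Sn (g - a) / (Real.pi : ℂ) ^ 4 with hX
  linear_combination X * Sn (f - a) * u * hK + X * Sn (g - a) * v * hK' +
    X * Sn (f - a) * Pg * Lg * hu' - X * Sn (g - a) * Pf * Lg * hv' + X * Lg * htrig -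
    X * Sn (f - a) * Pf * γ₂ * L₂ * hu₂ + X * Sn (g - a) * Pg * γ₃ * L₂ * hv₂
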